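/- ∑_{n=1}^∞ 1/(n⁵·2ⁿ·binom(3n,n)) = 4π·Im(Li₄((1+i)/2)) + 3π·β(4) − (51/2)·Li₅(1/2) − 15·Li₄(1/2)·log 2 + π²ζ(3)/4 + 9ζ(5)/2 − 3ζ(3)·log²2 − (97/240)·log⁵2 + (41/144)·π²·log³2 − (61/960)·π⁴·log 2. -/

import Mathlib

/-- Catalan's constant `C = ∑_{k≥0} (-1)^k/(2k+1)²`. -/
noncomputable def catalanConst : ℝ := ∑' k : ℕ, (-1 : ℝ) ^ k / ((2 * k + 1 : ℕ) : ℝ) ^ 2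

/-- `β(4) = ∑_{k≥0} (-1)^k/(2k+1)⁴`. -/
noncomputable def diriBeta4 : ℝ := ∑' k : ℕ, (-1 : ℝ) ^ k / ((2 * k + 1 : ℕ) : ℝ) ^ 4

/-- The real polylogarithm `Li_s(x) = ∑_{n≥1} xⁿ/n^s`. -/
noncomputable def rpolylog (s : ℕ) (x : ℝ) : ℝ :=
  ∑' n : ℕ, x ^ (n + 1) / ((n + 1 : ℕ) : ℝ) ^ s

/-- The complex polylogarithm `Li_s(z) = ∑_{n≥1} zⁿ/n^s`. -/
noncomputable def cpolylog (s : ℕ) (z : ℂ) : ℂ :=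
  ∑' n : ℕ, z ^ (n + 1) / ((n + 1 : ℕ) : ℂ) ^ s

open Set Filter Topology

set_option linter.unusedSimpArgs false

lemma norm_polylogTerm_le (k n : ℕ) {z : ℂ} (hz : ‖z‖ ≤ 1) :
    ‖z ^ (n + 1) / ((n + 1 : ℕ) : ℂ) ^ k‖ ≤ 1 / ((n + 1 : ℕ) : ℝ) ^ k := by
  rw [norm_div, norm_pow, norm_pow, Complex.norm_natCast]
  gcongr
  exact pow_le_one₀ (norm_nonneg _) hz

lemma summable_one_div_succ_pow {k : ℕ} (hk : 2 ≤ k) :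
    Summable fun n : ℕ => 1 / ((n + 1 : ℕ) : ℝ) ^ k :=
  (summable_nat_add_iff (f := fun n : ℕ => 1 / (n : ℝ) ^ k) 1).2
    (Real.summable_one_div_nat_pow.2 (by omega))

lemma cpolylog_continuousOn {k : ℕ} (hk : 2 ≤ k) :
    ContinuousOn (cpolylog k) (Metric.closedBall 0 1) := by
  unfold cpolylog
  refine continuousOn_tsum (fun n => by fun_prop) (summable_one_div_succ_pow hk) ?_
  intro n z hz
  exact norm_polylogTerm_le k n (by simpa using hz)

lemma summable_polylog {k : ℕ} (hk : 2 ≤ k) {z : ℂ} (hz : ‖z‖ ≤ 1) :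
    Summable fun n : ℕ => z ^ (n + 1) / ((n + 1 : ℕ) : ℂ) ^ k :=
  Summable.of_norm_bounded (summable_one_div_succ_pow hk) fun n => norm_polylogTerm_le k n hz

lemma cpolylog_one {z : ℂ} (hz : ‖z‖ < 1) : cpolylog 1 z = -Complex.log (1 - z) := by
  have h := (hasSum_nat_add_iff' 1).2 (Complex.hasSum_taylorSeries_neg_log hz)
  simp only [Finset.range_one, Finset.sum_singleton, pow_zero, Nat.cast_zero, div_zero,
    sub_zero] at h
  rw [cpolylog, ← h.tsum_eq]
  simp

/-- Termwise derivative of the polylogarithm inside the unit disc. -/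
lemma hasDerivAt_cpolylog_tsum (k : ℕ) {z : ℂ} (hz : ‖z‖ < 1) :
    HasDerivAt (cpolylog (k + 1)) (∑' n : ℕ, z ^ n / ((n + 1 : ℕ) : ℂ) ^ k) z := by
  obtain ⟨r, hzr, hr⟩ := exists_between hz
  have hr0 : 0 < r := (norm_nonneg z).trans_lt hzr
  refine hasDerivAt_tsum_of_isPreconnected (u := fun n : ℕ => r ^ n)
    (g := fun (n : ℕ) (z : ℂ) => z ^ (n + 1) / ((n + 1 : ℕ) : ℂ) ^ (k + 1))
    (g' := fun (n : ℕ) (z : ℂ) => z ^ n / ((n + 1 : ℕ) : ℂ) ^ k) (t := Metric.ball (0 : ℂ) r)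
    (y₀ := 0) (summable_geometric_of_lt_one hr0.le hr) Metric.isOpen_ball
    (convex_ball _ _).isPreconnected ?_ ?_ (by simpa using hr0) ?_ (by simpa using hzr)
  · intro n y _
    have hn : ((n + 1 : ℕ) : ℂ) ≠ 0 := Nat.cast_ne_zero.2 (by omega)
    refine ((hasDerivAt_pow (n + 1) y).div_const (((n + 1 : ℕ) : ℂ) ^ (k + 1))).congr_deriv ?_
    rw [Nat.add_sub_cancel]
    field_simp
    ring
  · intro n y hy
    rw [norm_div, norm_pow, norm_pow, Complex.norm_natCast]
    have hy' : ‖y‖ ≤ r := by simpa using (Metric.mem_ball.1 hy).le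
    have h1 : (1 : ℝ) ≤ ((n + 1 : ℕ) : ℝ) ^ k := one_le_pow₀ (by exact_mod_cast Nat.succ_pos n)
    calc ‖y‖ ^ n / ((n + 1 : ℕ) : ℝ) ^ k ≤ ‖y‖ ^ n / 1 := by gcongr
      _ ≤ r ^ n := by rw [div_one]; gcongr
  · simp [summable_zero]

lemma hasDerivAt_cpolylog (k : ℕ) {z : ℂ} (hz : ‖z‖ < 1) (h0 : z ≠ 0) :
    HasDerivAt (cpolylog (k + 1)) (cpolylog k z / z) z := by
  convert hasDerivAt_cpolylog_tsum k hz using 1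
  rw [cpolylog, ← tsum_div_const]
  congr 1
  ext n
  field_simp
  ring

/-- The polylogarithm, with `Li₁ z = -log (1 - z)` also on the boundary of the disc. -/
noncomputable def Li (k : ℕ) (z : ℂ) : ℂ :=
  if k = 1 then -Complex.log (1 - z) else cpolylog k z

lemma Li_one (z : ℂ) : Li 1 z = -Complex.log (1 - z) := by simp [Li]

lemma Li_of_two_le {k : ℕ} (hk : 2 ≤ k) (z : ℂ) : Li k z = cpolylog k z := by
  simp [Li, show k ≠ 1 by omega]

lemma Li_eq_of_norm_lt {k : ℕ} {z : ℂ} (hz : ‖z‖ < 1) : Li k z = cpolylog k z := by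
  by_cases h : k = 1
  · subst h; rw [Li_one, cpolylog_one hz]
  · simp [Li, h]

lemma one_sub_mem_slitPlane {z : ℂ} (hz : ‖z‖ ≤ 1) (h1 : z ≠ 1) : 1 - z ∈ Complex.slitPlane := by
  rw [Complex.mem_slitPlane_iff]
  by_contra! h
  have h2 : z.re ≤ 1 := (Complex.re_le_norm z).trans hz
  simp only [Complex.sub_re, Complex.one_re, Complex.sub_im, Complex.one_im] at h
  exact h1 (Complex.ext (by simpa using (by linarith [h.1] : z.re = 1)) (by simpa using h.2))

lemma Li_continuousWithinAt {k : ℕ} (hk : 1 ≤ k) {z : ℂ} (hz : ‖z‖ ≤ 1) (h1 : z ≠ 1) :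
    ContinuousWithinAt (Li k) (Metric.closedBall 0 1) z := by
  rcases hk.eq_or_lt with rfl | hk
  · have : ContinuousAt (fun w : ℂ => -Complex.log (1 - w)) z :=
      ((continuousAt_const.sub continuousAt_id).clog (one_sub_mem_slitPlane hz h1)).neg
    refine this.continuousWithinAt.congr (fun w _ => Li_one w) (Li_one z)
  · have := cpolylog_continuousOn hk z (by simpa using hz)
    exact this.congr (fun w _ => Li_of_two_le hk w) (Li_of_two_le hk z)

/-- Derivative of the polylogarithm on the closed disc, away from `0` and `1`. -/
lemma hasFDerivWithinAt_cpolylog {k : ℕ} (hk : 1 ≤ k) {z : ℂ} (hz : ‖z‖ ≤ 1) (h0 : z ≠ 0)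
    (h1 : z ≠ 1) :
    HasFDerivWithinAt (𝕜 := ℝ) (cpolylog (k + 1))
      (((ContinuousLinearMap.toSpanSingleton ℂ (Li k z / z))).restrictScalars ℝ)
      (Metric.closedBall 0 1) z := by
  rw [← closure_ball (0 : ℂ) one_ne_zero]
  refine hasFDerivWithinAt_closure_of_tendsto_fderiv ?_ (convex_ball _ _) Metric.isOpen_ball ?_ ?_
  · intro w hw
    exact ((hasDerivAt_cpolylog_tsum k
      (by simpa using hw)).differentiableAt.restrictScalars ℝ).differentiableWithinAt
  · intro w hw
    rw [closure_ball (0 : ℂ) one_ne_zero] at hw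
    exact (cpolylog_continuousOn (by omega) w hw).mono Metric.ball_subset_closedBall
  · have hc : Tendsto (fun w => Li k w / w) (𝓝[Metric.ball 0 1] z) (𝓝 (Li k z / z)) :=
      ((Li_continuousWithinAt hk hz h1).mono Metric.ball_subset_closedBall).div
        continuousWithinAt_id h0
    have hT : Continuous fun c : ℂ =>
        (ContinuousLinearMap.toSpanSingleton ℂ c).restrictScalars ℝ := by
      have h2 : Continuous fun c : ℂ => ContinuousLinearMap.toSpanSingleton (R₁ := ℂ) (M₁ := ℂ) c :=
        (ContinuousLinearMap.toSpanSingletonCLE (𝕜 := ℂ) (E := ℂ)).continuous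
      exact (ContinuousLinearMap.restrictScalarsL ℂ ℂ ℂ ℝ ℝ).continuous.comp h2
    refine ((hT.tendsto _).comp hc).congr' ?_
    have h0' : ∀ᶠ w in 𝓝[Metric.ball 0 1] z, w ≠ 0 :=
      nhdsWithin_le_nhds (isOpen_ne.mem_nhds h0)
    filter_upwards [self_mem_nhdsWithin, h0'] with w hw hw0
    have hw1 : ‖w‖ < 1 := by simpa using hw
    have := (hasDerivAt_cpolylog k hw1 hw0).hasFDerivAt.restrictScalars ℝ
    rw [this.fderiv, Function.comp_apply, Li_eq_of_norm_lt hw1]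

/-- Chain rule for polylogarithms along a path in the closed unit disc. -/
lemma hasDerivWithinAt_cpolylog_comp {k : ℕ} (hk : 1 ≤ k) {R : ℝ → ℂ} {R' : ℂ} {S : Set ℝ} {t : ℝ}
    (hR : HasDerivWithinAt R R' S t) (hS : ∀ x ∈ S, ‖R x‖ ≤ 1) (ht : ‖R t‖ ≤ 1)
    (h0 : R t ≠ 0) (h1 : R t ≠ 1) :
    HasDerivWithinAt (fun x => cpolylog (k + 1) (R x)) (Li k (R t) * (R' / R t)) S t := by
  have h := (hasFDerivWithinAt_cpolylog hk ht h0 h1).comp_hasDerivWithinAt t hR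
    (fun x hx => by simpa using hS x hx)
  refine h.congr_deriv ?_
  change (R' • (Li k (R t) / R t) : ℂ) = _
  rw [smul_eq_mul]
  ring

/-- Single-valued-type combinations of polylogarithms: along a path `R` with logarithm `ℓ`,
`d (polyComb n R ℓ) = n ℓ ^ (n - 1) log (1 - R) dℓ`. -/
noncomputable def polyComb1 (R _ℓ : ℂ) : ℂ := -cpolylog 2 R

noncomputable def polyComb2 (R ℓ : ℂ) : ℂ := 2 * cpolylog 3 R - 2 * ℓ * cpolylog 2 R

noncomputable def polyComb3 (R ℓ : ℂ) : ℂ :=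
  -6 * cpolylog 4 R + 6 * ℓ * cpolylog 3 R - 3 * ℓ ^ 2 * cpolylog 2 R

noncomputable def polyComb4 (R ℓ : ℂ) : ℂ :=
  24 * cpolylog 5 R - 24 * ℓ * cpolylog 4 R + 12 * ℓ ^ 2 * cpolylog 3 R
    - 4 * ℓ ^ 3 * cpolylog 2 R

noncomputable def re1 (a θ m b : ℝ) : ℝ :=
  (polyComb1 (Complex.exp (a + θ * Complex.I)) (m + b * Complex.I)).re

noncomputable def re2 (a θ m b : ℝ) : ℝ :=
  (polyComb2 (Complex.exp (a + θ * Complex.I)) (m + b * Complex.I)).re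

/-- Real part of a third order combination with complex weight `u + v i`. -/
noncomputable def re3 (u v a θ m b : ℝ) : ℝ :=
  ((u + v * Complex.I) *
    polyComb3 (Complex.exp (a + θ * Complex.I)) (m + b * Complex.I)).re

noncomputable def re4 (a θ m b : ℝ) : ℝ :=
  (polyComb4 (Complex.exp (a + θ * Complex.I)) (m + b * Complex.I)).re

/-- A path `exp (a + i θ)` in the closed unit disc, with modified logarithm `m + i b`, and with
`log (1 - exp (a + i θ)) = c + i d` at time `t`. -/
structure LogPath (a θ m b : ℝ → ℝ) (a' b' c d : ℝ) (S : Set ℝ) (t : ℝ) : Prop where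
  mem : t ∈ S
  nonpos : ∀ x ∈ S, a x ≤ 0
  deriv_a : HasDerivWithinAt a a' S t
  deriv_θ : HasDerivWithinAt θ b' S t
  deriv_m : HasDerivWithinAt m a' S t
  deriv_b : HasDerivWithinAt b b' S t
  exp_eq : Complex.exp (c + d * Complex.I) = 1 - Complex.exp (a t + θ t * Complex.I)
  neg_pi_lt : -Real.pi < d
  le_pi : d ≤ Real.pi

lemma hasDerivWithinAt_add_mul_I {a b : ℝ → ℝ} {a' b' : ℝ} {S : Set ℝ} {t : ℝ}
    (ha : HasDerivWithinAt a a' S t) (hb : HasDerivWithinAt b b' S t) :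
    HasDerivWithinAt (fun x => (a x : ℂ) + b x * Complex.I) (a' + b' * Complex.I) S t :=
  ha.ofReal_comp.add (hb.ofReal_comp.mul_const Complex.I)

lemma norm_exp_add_mul_I (a θ : ℝ) : ‖Complex.exp (a + θ * Complex.I)‖ = Real.exp a := by
  simp [Complex.norm_exp]

lemma hasDerivWithinAt_re {f : ℝ → ℂ} {f' : ℂ} {S : Set ℝ} {t : ℝ}
    (hf : HasDerivWithinAt f f' S t) : HasDerivWithinAt (fun x => (f x).re) f'.re S t :=
  (Complex.reCLM.hasFDerivAt.comp_hasDerivWithinAt t hf)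

namespace LogPath

variable {a θ m b : ℝ → ℝ} {a' b' c d : ℝ} {S : Set ℝ} {t : ℝ}

lemma log_eq (h : LogPath a θ m b a' b' c d S t) :
    Complex.log (1 - Complex.exp (a t + θ t * Complex.I)) = c + d * Complex.I := by
  rw [← h.exp_eq, Complex.log_exp] <;> simp [h.neg_pi_lt, h.le_pi]

lemma hasDeriv_cpolylog (h : LogPath a θ m b a' b' c d S t) {k : ℕ} (hk : 1 ≤ k) :
    HasDerivWithinAt (fun x => cpolylog (k + 1) (Complex.exp (a x + θ x * Complex.I)))
      (Li k (Complex.exp (a t + θ t * Complex.I)) * (a' + b' * Complex.I)) S t := by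
  have hle : ∀ x ∈ S, ‖Complex.exp (a x + θ x * Complex.I)‖ ≤ 1 := fun x hx => by
    rw [norm_exp_add_mul_I]; exact Real.exp_le_one_iff.2 (h.nonpos x hx)
  have hne : Complex.exp (a t + θ t * Complex.I) ≠ 1 := fun h1 => by
    have := h.exp_eq
    rw [h1, sub_self] at this
    exact Complex.exp_ne_zero _ this
  have := hasDerivWithinAt_cpolylog_comp hk (hasDerivWithinAt_add_mul_I h.deriv_a h.deriv_θ).cexp
    hle (hle t h.mem) (Complex.exp_ne_zero _) hne
  refine this.congr_deriv ?_
  have h0 := Complex.exp_ne_zero (a t + θ t * Complex.I)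
  field_simp

lemma hasDeriv_two (h : LogPath a θ m b a' b' c d S t) :
    HasDerivWithinAt (fun x => cpolylog 2 (Complex.exp (a x + θ x * Complex.I)))
      (-(c + d * Complex.I) * (a' + b' * Complex.I)) S t := by
  have := h.hasDeriv_cpolylog le_rfl
  rwa [Li_one, h.log_eq] at this

lemma hasDeriv_succ (h : LogPath a θ m b a' b' c d S t) {k : ℕ} (hk : 2 ≤ k) :
    HasDerivWithinAt (fun x => cpolylog (k + 1) (Complex.exp (a x + θ x * Complex.I)))
      (cpolylog k (Complex.exp (a t + θ t * Complex.I)) * (a' + b' * Complex.I)) S t := by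
  have := h.hasDeriv_cpolylog (by omega : 1 ≤ k)
  rwa [Li_of_two_le hk] at this

lemma hasDeriv_polyComb2 (h : LogPath a θ m b a' b' c d S t) :
    HasDerivWithinAt
      (fun x => polyComb2 (Complex.exp (a x + θ x * Complex.I)) (m x + b x * Complex.I))
      (2 * (m t + b t * Complex.I) * (a' + b' * Complex.I) * (c + d * Complex.I)) S t := by
  have hl := hasDerivWithinAt_add_mul_I h.deriv_m h.deriv_b
  refine (((h.hasDeriv_succ le_rfl).const_mul 2).sub
    ((hl.const_mul 2).mul h.hasDeriv_two)).congr_deriv ?_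
  ring

lemma hasDeriv_polyComb3 (h : LogPath a θ m b a' b' c d S t) :
    HasDerivWithinAt
      (fun x => polyComb3 (Complex.exp (a x + θ x * Complex.I)) (m x + b x * Complex.I))
      (3 * (m t + b t * Complex.I) ^ 2 * (a' + b' * Complex.I) * (c + d * Complex.I)) S t := by
  have hl := hasDerivWithinAt_add_mul_I h.deriv_m h.deriv_b
  refine ((((h.hasDeriv_succ (k := 3) (by norm_num)).const_mul (-6)).add
    ((hl.const_mul 6).mul (h.hasDeriv_succ le_rfl))).sub
    (((hl.pow 2).const_mul 3).mul h.hasDeriv_two)).congr_deriv ?_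
  simp only [Pi.pow_apply]
  push_cast
  ring

lemma hasDeriv_polyComb4 (h : LogPath a θ m b a' b' c d S t) :
    HasDerivWithinAt
      (fun x => polyComb4 (Complex.exp (a x + θ x * Complex.I)) (m x + b x * Complex.I))
      (4 * (m t + b t * Complex.I) ^ 3 * (a' + b' * Complex.I) * (c + d * Complex.I)) S t := by
  have hl := hasDerivWithinAt_add_mul_I h.deriv_m h.deriv_b
  refine (((((h.hasDeriv_succ (k := 4) (by norm_num)).const_mul 24).sub
    ((hl.const_mul 24).mul (h.hasDeriv_succ (k := 3) (by norm_num)))).add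
    (((hl.pow 2).const_mul 12).mul (h.hasDeriv_succ le_rfl))).sub
    (((hl.pow 3).const_mul 4).mul h.hasDeriv_two)).congr_deriv ?_
  simp only [Pi.pow_apply]
  push_cast
  ring

lemma hasDeriv_re1 (h : LogPath a θ m b a' b' c d S t) :
    HasDerivWithinAt (fun x => re1 (a x) (θ x) (m x) (b x)) (a' * c - b' * d) S t := by
  refine (hasDerivWithinAt_re h.hasDeriv_two.neg).congr_deriv ?_
  simp
  ring

lemma hasDeriv_re2 (h : LogPath a θ m b a' b' c d S t) :
    HasDerivWithinAt (fun x => re2 (a x) (θ x) (m x) (b x))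
      (2 * (m t * (a' * c - b' * d) - b t * (a' * d + b' * c))) S t := by
  refine (hasDerivWithinAt_re h.hasDeriv_polyComb2).congr_deriv ?_
  simp
  ring

lemma hasDeriv_re3 (h : LogPath a θ m b a' b' c d S t) (u v : ℝ) :
    HasDerivWithinAt (fun x => re3 u v (a x) (θ x) (m x) (b x))
      (3 * ((u * (m t ^ 2 - b t ^ 2) - v * (2 * m t * b t)) * (a' * c - b' * d)
        - (u * (2 * m t * b t) + v * (m t ^ 2 - b t ^ 2)) * (a' * d + b' * c))) S t := by
  refine (hasDerivWithinAt_re (h.hasDeriv_polyComb3.const_mul (u + v * Complex.I))).congr_deriv ?_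
  simp [pow_succ]
  ring

lemma hasDeriv_re4 (h : LogPath a θ m b a' b' c d S t) :
    HasDerivWithinAt (fun x => re4 (a x) (θ x) (m x) (b x))
      (4 * ((m t ^ 3 - 3 * m t * b t ^ 2) * (a' * c - b' * d)
        - (3 * m t ^ 2 * b t - b t ^ 3) * (a' * d + b' * c))) S t := by
  refine (hasDerivWithinAt_re h.hasDeriv_polyComb4).congr_deriv ?_
  simp [pow_succ]
  ring

end LogPath

section Limits

variable {F : Filter ℝ} {a θ m b : ℝ → ℝ} {a₀ θ₀ m₀ b₀ : ℝ}

lemma tendsto_cpolylog_exp {k : ℕ} (hk : 2 ≤ k) (ha : Tendsto a F (𝓝 a₀))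
    (hθ : Tendsto θ F (𝓝 θ₀)) (h0 : ∀ᶠ x in F, a x ≤ 0) (ha₀ : a₀ ≤ 0) :
    Tendsto (fun x => cpolylog k (Complex.exp (a x + θ x * Complex.I))) F
      (𝓝 (cpolylog k (Complex.exp (a₀ + θ₀ * Complex.I)))) := by
  have hc := cpolylog_continuousOn hk (Complex.exp (a₀ + θ₀ * Complex.I))
    (by simpa [norm_exp_add_mul_I] using ha₀)
  refine hc.tendsto.comp (tendsto_nhdsWithin_iff.2 ⟨?_, ?_⟩)
  · exact (Complex.continuous_exp.tendsto _).comp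
      (((Complex.continuous_ofReal.tendsto _).comp ha).add
        (((Complex.continuous_ofReal.tendsto _).comp hθ).mul_const _))
  · filter_upwards [h0] with x hx
    simpa [norm_exp_add_mul_I] using hx

lemma tendsto_add_mul_I (hm : Tendsto m F (𝓝 m₀)) (hb : Tendsto b F (𝓝 b₀)) :
    Tendsto (fun x => (m x : ℂ) + b x * Complex.I) F (𝓝 (m₀ + b₀ * Complex.I)) :=
  ((Complex.continuous_ofReal.tendsto _).comp hm).add
    (((Complex.continuous_ofReal.tendsto _).comp hb).mul_const _)

lemma tendsto_re1 (ha : Tendsto a F (𝓝 a₀)) (hθ : Tendsto θ F (𝓝 θ₀))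
    (h0 : ∀ᶠ x in F, a x ≤ 0) (ha₀ : a₀ ≤ 0) :
    Tendsto (fun x => re1 (a x) (θ x) (m x) (b x)) F (𝓝 (re1 a₀ θ₀ m₀ b₀)) :=
  (Complex.continuous_re.tendsto _).comp (tendsto_cpolylog_exp le_rfl ha hθ h0 ha₀).neg

lemma tendsto_re2 (ha : Tendsto a F (𝓝 a₀)) (hθ : Tendsto θ F (𝓝 θ₀))
    (hm : Tendsto m F (𝓝 m₀)) (hb : Tendsto b F (𝓝 b₀))
    (h0 : ∀ᶠ x in F, a x ≤ 0) (ha₀ : a₀ ≤ 0) :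
    Tendsto (fun x => re2 (a x) (θ x) (m x) (b x)) F (𝓝 (re2 a₀ θ₀ m₀ b₀)) := by
  have hl := tendsto_add_mul_I hm hb
  have h2 := tendsto_cpolylog_exp (k := 2) le_rfl ha hθ h0 ha₀
  have h3 := tendsto_cpolylog_exp (k := 3) (by norm_num) ha hθ h0 ha₀
  exact (Complex.continuous_re.tendsto _).comp
    ((h3.const_mul 2).sub ((hl.const_mul 2).mul h2))

lemma tendsto_re3 (u v : ℝ) (ha : Tendsto a F (𝓝 a₀)) (hθ : Tendsto θ F (𝓝 θ₀))
    (hm : Tendsto m F (𝓝 m₀)) (hb : Tendsto b F (𝓝 b₀))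
    (h0 : ∀ᶠ x in F, a x ≤ 0) (ha₀ : a₀ ≤ 0) :
    Tendsto (fun x => re3 u v (a x) (θ x) (m x) (b x)) F (𝓝 (re3 u v a₀ θ₀ m₀ b₀)) := by
  have hl := tendsto_add_mul_I hm hb
  have h2 := tendsto_cpolylog_exp (k := 2) le_rfl ha hθ h0 ha₀
  have h3 := tendsto_cpolylog_exp (k := 3) (by norm_num) ha hθ h0 ha₀
  have h4 := tendsto_cpolylog_exp (k := 4) (by norm_num) ha hθ h0 ha₀
  exact (Complex.continuous_re.tendsto _).comp
    ((((h4.const_mul (-6)).add ((hl.const_mul 6).mul h3)).sub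
      (((hl.pow 2).const_mul 3).mul h2)).const_mul _)

lemma tendsto_re4 (ha : Tendsto a F (𝓝 a₀)) (hθ : Tendsto θ F (𝓝 θ₀))
    (hm : Tendsto m F (𝓝 m₀)) (hb : Tendsto b F (𝓝 b₀))
    (h0 : ∀ᶠ x in F, a x ≤ 0) (ha₀ : a₀ ≤ 0) :
    Tendsto (fun x => re4 (a x) (θ x) (m x) (b x)) F (𝓝 (re4 a₀ θ₀ m₀ b₀)) := by
  have hl := tendsto_add_mul_I hm hb
  have h2 := tendsto_cpolylog_exp (k := 2) le_rfl ha hθ h0 ha₀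
  have h3 := tendsto_cpolylog_exp (k := 3) (by norm_num) ha hθ h0 ha₀
  have h4 := tendsto_cpolylog_exp (k := 4) (by norm_num) ha hθ h0 ha₀
  have h5 := tendsto_cpolylog_exp (k := 5) (by norm_num) ha hθ h0 ha₀
  exact (Complex.continuous_re.tendsto _).comp
    ((((h5.const_mul 24).sub ((hl.const_mul 24).mul h4)).add
      (((hl.pow 2).const_mul 12).mul h3)).sub (((hl.pow 3).const_mul 4).mul h2))

lemma norm_cpolylog_le {k : ℕ} (hk : 2 ≤ k) {z : ℂ} (hz : ‖z‖ ≤ 1) :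
    ‖cpolylog k z‖ ≤ (∑' n : ℕ, 1 / ((n + 1 : ℕ) : ℝ) ^ k) * ‖z‖ := by
  rw [cpolylog, ← tsum_mul_right]
  refine tsum_of_norm_bounded ((summable_one_div_succ_pow hk).mul_right ‖z‖).hasSum fun n => ?_
  have h := norm_polylogTerm_le k n hz
  rw [norm_div, norm_pow, norm_pow, Complex.norm_natCast, div_mul_eq_mul_div, one_mul]
  gcongr
  exact pow_le_of_le_one (norm_nonneg z) hz (by omega)

/-- Powers of the logarithm are beaten by the polylogarithm as its argument tends to `0`. -/
lemma tendsto_pow_mul_cpolylog_exp {k j : ℕ} (hk : 2 ≤ k) (hj : j ≤ 3) {c : ℝ}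
    (ha : Tendsto a F atBot) (hm : ∀ᶠ x in F, m x = a x + c) (hb : Tendsto b F (𝓝 b₀)) :
    Tendsto (fun x => ((m x : ℂ) + b x * Complex.I) ^ j
      * cpolylog k (Complex.exp (a x + θ x * Complex.I))) F (𝓝 0) := by
  set C := ∑' n : ℕ, 1 / ((n + 1 : ℕ) : ℝ) ^ k
  have hexp : Tendsto (fun x => Real.exp (a x / 4)) F (𝓝 0) :=
    Real.tendsto_exp_atBot.comp (ha.atBot_div_const (by norm_num))
  have hae : Tendsto (fun x => a x * Real.exp (a x / 4)) F (𝓝 0) := by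
    have h := ((Real.tendsto_pow_mul_exp_neg_atTop_nhds_zero 1).comp
      (tendsto_neg_atBot_atTop.comp (ha.atBot_div_const (r := 4) (by norm_num)))).const_mul (-4)
    rw [mul_zero] at h
    refine h.congr fun x => ?_
    simp only [Function.comp_apply, pow_one, neg_neg]
    ring
  have hq : Tendsto (fun x => ((m x : ℂ) + b x * Complex.I) * Real.exp (a x / 4)) F (𝓝 0) := by
    have h1 : Tendsto (fun x => m x * Real.exp (a x / 4)) F (𝓝 0) := by
      have := hae.add (hexp.const_mul c)
      rw [mul_zero, add_zero] at this
      refine this.congr' ?_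
      filter_upwards [hm] with x hx
      rw [hx]; ring
    have h2 : Tendsto (fun x => b x * Real.exp (a x / 4)) F (𝓝 0) := by
      simpa using hb.mul hexp
    have := tendsto_add_mul_I h1 h2
    simp only [Complex.ofReal_zero, zero_mul, add_zero] at this
    refine this.congr fun x => ?_
    push_cast
    ring
  have hmain : Tendsto (fun x => C * (‖((m x : ℂ) + b x * Complex.I) * Real.exp (a x / 4)‖ ^ j
      * Real.exp (a x / 4) ^ (4 - j))) F (𝓝 0) := by
    have h1 := (hq.norm.pow j).mul (hexp.pow (4 - j))
    have h2 : ‖(0 : ℂ)‖ ^ j * (0 : ℝ) ^ (4 - j) = 0 := by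
      rw [zero_pow (by omega : 4 - j ≠ 0), mul_zero]
    rw [h2] at h1
    simpa using h1.const_mul C
  refine squeeze_zero_norm' ?_ hmain
  filter_upwards [ha.eventually_le_atBot 0] with x hx
  have hle : ‖Complex.exp (a x + θ x * Complex.I)‖ ≤ 1 := by
    rw [norm_exp_add_mul_I]; exact Real.exp_le_one_iff.2 hx
  have h4 : Real.exp (a x) = Real.exp (a x / 4) ^ j * Real.exp (a x / 4) ^ (4 - j) := by
    rw [← pow_add, Nat.add_sub_cancel' (by omega : j ≤ 4), ← Real.exp_nat_mul]
    congr 1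
    push_cast
    ring
  have hn : ‖((Real.exp (a x / 4) : ℝ) : ℂ)‖ = Real.exp (a x / 4) := by
    rw [Complex.norm_real, Real.norm_of_nonneg (Real.exp_pos _).le]
  rw [norm_mul, norm_pow, norm_mul, hn, mul_pow]
  calc _ ≤ ‖(m x : ℂ) + b x * Complex.I‖ ^ j * (C * ‖Complex.exp (a x + θ x * Complex.I)‖) := by
        gcongr
        exact norm_cpolylog_le hk hle
    _ = _ := by rw [norm_exp_add_mul_I, h4]; ring

lemma tendsto_re1_zero {c : ℝ} (ha : Tendsto a F atBot) (hm : ∀ᶠ x in F, m x = a x + c)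
    (hb : Tendsto b F (𝓝 b₀)) :
    Tendsto (fun x => re1 (a x) (θ x) (m x) (b x)) F (𝓝 0) := by
  have h := (Complex.continuous_re.tendsto _).comp
    (tendsto_pow_mul_cpolylog_exp (θ := θ) (k := 2) (j := 0) le_rfl (by norm_num) ha hm hb).neg
  simpa [Function.comp_def, re1, polyComb1] using h

lemma tendsto_re2_zero {c : ℝ} (ha : Tendsto a F atBot) (hm : ∀ᶠ x in F, m x = a x + c)
    (hb : Tendsto b F (𝓝 b₀)) :
    Tendsto (fun x => re2 (a x) (θ x) (m x) (b x)) F (𝓝 0) := by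
  have h := fun (k j : ℕ) (hk : 2 ≤ k) (hj : j ≤ 3) =>
    tendsto_pow_mul_cpolylog_exp (θ := θ) hk hj ha hm hb
  have := (Complex.continuous_re.tendsto _).comp
    (((h 3 0 (by norm_num) (by norm_num)).const_mul 2).sub
      ((h 2 1 (by norm_num) (by norm_num)).const_mul 2))
  simpa [Function.comp_def, re2, polyComb2, mul_assoc] using this

lemma tendsto_re3_zero (u v : ℝ) {c : ℝ} (ha : Tendsto a F atBot)
    (hm : ∀ᶠ x in F, m x = a x + c) (hb : Tendsto b F (𝓝 b₀)) :
    Tendsto (fun x => re3 u v (a x) (θ x) (m x) (b x)) F (𝓝 0) := by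
  have h := fun (k j : ℕ) (hk : 2 ≤ k) (hj : j ≤ 3) =>
    tendsto_pow_mul_cpolylog_exp (θ := θ) hk hj ha hm hb
  have := (Complex.continuous_re.tendsto _).comp
    (((((h 4 0 (by norm_num) (by norm_num)).const_mul (-6)).add
      ((h 3 1 (by norm_num) (by norm_num)).const_mul 6)).sub
      ((h 2 2 (by norm_num) (by norm_num)).const_mul 3)).const_mul ((u : ℂ) + v * Complex.I))
  rw [mul_zero, mul_zero, mul_zero, add_zero, sub_zero, mul_zero, Complex.zero_re] at this
  refine this.congr fun x => ?_
  simp only [Function.comp_apply, re3, polyComb3]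
  congr 1
  ring

lemma tendsto_re4_zero {c : ℝ} (ha : Tendsto a F atBot) (hm : ∀ᶠ x in F, m x = a x + c)
    (hb : Tendsto b F (𝓝 b₀)) :
    Tendsto (fun x => re4 (a x) (θ x) (m x) (b x)) F (𝓝 0) := by
  have h := fun (k j : ℕ) (hk : 2 ≤ k) (hj : j ≤ 3) =>
    tendsto_pow_mul_cpolylog_exp (θ := θ) hk hj ha hm hb
  have := (Complex.continuous_re.tendsto _).comp
    (((((h 5 0 (by norm_num) (by norm_num)).const_mul 24).sub
      ((h 4 1 (by norm_num) (by norm_num)).const_mul 24)).add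
      ((h 3 2 (by norm_num) (by norm_num)).const_mul 12)).sub
      ((h 2 3 (by norm_num) (by norm_num)).const_mul 4))
  simp only [mul_zero, add_zero, sub_zero, Complex.zero_re] at this
  refine this.congr fun x => ?_
  simp only [Function.comp_apply, re4, polyComb4]
  congr 1
  ring

end Limits

section SpecialValues

lemma HasSum.of_forall_eq {α : Type*} [AddCommMonoid α] [TopologicalSpace α] {f g : ℕ → α} {a : α}
    (hf : HasSum f a) (h : ∀ n, g n = f n) : HasSum g a := by
  rwa [funext h]

lemma cpolylog_ofReal (k : ℕ) (x : ℝ) : cpolylog k (x : ℂ) = (rpolylog k x : ℂ) := by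
  rw [cpolylog, rpolylog, Complex.ofReal_tsum]
  push_cast
  rfl

lemma cpolylog_conj (k : ℕ) (z : ℂ) :
    cpolylog k (starRingEnd ℂ z) = starRingEnd ℂ (cpolylog k z) := by
  rw [cpolylog, cpolylog, Complex.conj_tsum]
  simp

lemma riemannZeta_eq_rpolylog {k : ℕ} (hk : 2 ≤ k) : riemannZeta k = (rpolylog k 1 : ℂ) := by
  rw [zeta_nat_eq_tsum_of_gt_one (by omega), ← cpolylog_ofReal, cpolylog,
    ((Complex.summable_one_div_nat_cpow (p := k)).2 (by simp; omega) |>.congr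
      (fun n => by simp)).tsum_eq_zero_add]
  simp [show k ≠ 0 by omega]

lemma rpolylog_two_one : rpolylog 2 1 = Real.pi ^ 2 / 6 := by
  have h := riemannZeta_eq_rpolylog (k := 2) le_rfl
  rw [show ((2 : ℕ) : ℂ) = 2 by norm_num, riemannZeta_two] at h
  exact_mod_cast h.symm

lemma rpolylog_four_one : rpolylog 4 1 = Real.pi ^ 4 / 90 := by
  have h := riemannZeta_eq_rpolylog (k := 4) (by norm_num)
  rw [show ((4 : ℕ) : ℂ) = 4 by norm_num, riemannZeta_four] at h
  exact_mod_cast h.symm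

/-- The duplication formula for polylogarithms. -/
lemma cpolylog_add_neg {k : ℕ} (hk : 2 ≤ k) {z : ℂ} (hz : ‖z‖ ≤ 1) :
    cpolylog k z + cpolylog k (-z) = 2 / 2 ^ k * cpolylog k (z ^ 2) := by
  have h1 := summable_polylog hk hz
  have h2 := summable_polylog hk (z := -z) (by simpa using hz)
  have h3 := summable_polylog hk (z := z ^ 2)
    (by rw [norm_pow]; exact pow_le_one₀ (norm_nonneg z) hz)
  have hs := h1.hasSum.add h2.hasSum
  have he : HasSum (fun n : ℕ => z ^ (2 * n + 1) / ((2 * n + 1 : ℕ) : ℂ) ^ k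
      + (-z) ^ (2 * n + 1) / ((2 * n + 1 : ℕ) : ℂ) ^ k) 0 := by
    refine hasSum_zero.of_forall_eq fun n => ?_
    rw [Odd.neg_pow ⟨n, rfl⟩]
    ring
  have ho : HasSum (fun n : ℕ => z ^ (2 * n + 1 + 1) / ((2 * n + 1 + 1 : ℕ) : ℂ) ^ k
      + (-z) ^ (2 * n + 1 + 1) / ((2 * n + 1 + 1 : ℕ) : ℂ) ^ k)
      (2 / 2 ^ k * cpolylog k (z ^ 2)) := by
    refine (h3.hasSum.mul_left (2 / 2 ^ k)).of_forall_eq fun n => ?_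
    rw [Even.neg_pow ⟨n + 1, by ring⟩, show 2 * n + 1 + 1 = 2 * (n + 1) by ring, pow_mul,
      Nat.cast_mul, mul_pow]
    have : ((n + 1 : ℕ) : ℂ) ≠ 0 := Nat.cast_ne_zero.2 (by omega)
    push_cast
    field_simp
    ring
  have := HasSum.even_add_odd (f := fun n : ℕ => z ^ (n + 1) / ((n + 1 : ℕ) : ℂ) ^ k
    + (-z) ^ (n + 1) / ((n + 1 : ℕ) : ℂ) ^ k) he ho
  rw [zero_add] at this
  exact hs.unique this

lemma rpolylog_neg_one {k : ℕ} (hk : 2 ≤ k) :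
    rpolylog k (-1) = (2 / 2 ^ k - 1) * rpolylog k 1 := by
  have h := cpolylog_add_neg hk (z := 1) (by simp)
  have h1 := cpolylog_ofReal k 1
  have h2 := cpolylog_ofReal k (-1)
  push_cast at h1 h2
  rw [one_pow, h1, h2] at h
  have h' : rpolylog k 1 + rpolylog k (-1) = 2 / 2 ^ k * rpolylog k 1 := by
    rw [← Complex.ofReal_inj]; push_cast; exact h
  linarith

lemma cpolylog_I_re {k : ℕ} (hk : 2 ≤ k) :
    (cpolylog k Complex.I).re = 1 / 2 ^ k * ((2 / 2 ^ k - 1) * rpolylog k 1) := by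
  have h := cpolylog_add_neg hk (z := Complex.I) (by simp)
  have h2 := cpolylog_ofReal k (-1)
  push_cast at h2
  rw [Complex.I_sq, h2, rpolylog_neg_one hk, ← Complex.conj_I, cpolylog_conj] at h
  have h3 := congrArg Complex.re h
  rw [Complex.add_re, Complex.conj_re] at h3
  have h4 : (2 / 2 ^ k * ((((2 / 2 ^ k - 1) * rpolylog k 1 : ℝ)) : ℂ)).re
      = 2 / 2 ^ k * ((2 / 2 ^ k - 1) * rpolylog k 1) := by
    rw [show (2 / 2 ^ k : ℂ) = ((2 / 2 ^ k : ℝ) : ℂ) by push_cast; rfl, ← Complex.ofReal_mul,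
      Complex.ofReal_re]
  rw [h4] at h3
  linear_combination h3 / 2

lemma cpolylog_four_I_im : (cpolylog 4 Complex.I).im = diriBeta4 := by
  have hs := summable_polylog (k := 4) (by norm_num) (z := Complex.I) (by simp)
  have h : HasSum (fun n : ℕ => (Complex.I ^ (n + 1) / ((n + 1 : ℕ) : ℂ) ^ 4).im)
      (cpolylog 4 Complex.I).im := Complex.hasSum_im hs.hasSum
  have hp : ∀ n : ℕ, Complex.I ^ (2 * n) = ((-1 : ℝ) ^ n : ℝ) := fun n => by
    rw [pow_mul, Complex.I_sq]; push_cast; rfl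
  have hb : Summable fun k : ℕ => (-1 : ℝ) ^ k / ((2 * k + 1 : ℕ) : ℝ) ^ 4 := by
    refine Summable.of_norm_bounded (summable_one_div_succ_pow (k := 4) (by norm_num)) fun n => ?_
    rw [norm_div, norm_pow, norm_pow, norm_neg, norm_one, one_pow, Real.norm_natCast]
    gcongr
    omega
  have he : HasSum (fun n : ℕ => (Complex.I ^ (2 * n + 1) / ((2 * n + 1 : ℕ) : ℂ) ^ 4).im)
      diriBeta4 := by
    refine hb.hasSum.of_forall_eq fun n => ?_
    rw [pow_succ, hp, show (((-1 : ℝ) ^ n : ℝ) * Complex.I / ((2 * n + 1 : ℕ) : ℂ) ^ 4)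
      = (((-1 : ℝ) ^ n / ((2 * n + 1 : ℕ) : ℝ) ^ 4 : ℝ) : ℂ) * Complex.I by push_cast; ring,
      Complex.im_ofReal_mul, Complex.I_im, mul_one]
  have ho : HasSum (fun n : ℕ => (Complex.I ^ (2 * n + 1 + 1) / ((2 * n + 1 + 1 : ℕ) : ℂ) ^ 4).im)
      0 := by
    refine hasSum_zero.of_forall_eq fun n => ?_
    rw [show 2 * n + 1 + 1 = 2 * (n + 1) by ring, hp,
      show (((-1 : ℝ) ^ (n + 1) : ℝ) / ((2 * (n + 1) : ℕ) : ℂ) ^ 4)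
      = (((-1 : ℝ) ^ (n + 1) / ((2 * (n + 1) : ℕ) : ℝ) ^ 4 : ℝ) : ℂ) by push_cast; ring,
      Complex.ofReal_im]
  have := HasSum.even_add_odd
    (f := fun n : ℕ => (Complex.I ^ (n + 1) / ((n + 1 : ℕ) : ℂ) ^ 4).im) he ho
  rw [add_zero] at this
  exact h.unique this

lemma re1_of_exp {a θ m b : ℝ} {R : ℂ} (h : Complex.exp (a + θ * Complex.I) = R) :
    re1 a θ m b = -(cpolylog 2 R).re := by
  simp [re1, polyComb1, h]

lemma re2_of_exp {a θ m b : ℝ} {R : ℂ} (h : Complex.exp (a + θ * Complex.I) = R) :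
    re2 a θ m b = 2 * (cpolylog 3 R).re
      - 2 * (m * (cpolylog 2 R).re - b * (cpolylog 2 R).im) := by
  simp [re2, polyComb2, h]
  ring

lemma re3_of_exp {a θ m b : ℝ} {R : ℂ} (u v : ℝ) (h : Complex.exp (a + θ * Complex.I) = R) :
    re3 u v a θ m b =
      u * (-6 * (cpolylog 4 R).re + 6 * (m * (cpolylog 3 R).re - b * (cpolylog 3 R).im)
        - 3 * ((m ^ 2 - b ^ 2) * (cpolylog 2 R).re - 2 * m * b * (cpolylog 2 R).im))
      - v * (-6 * (cpolylog 4 R).im + 6 * (m * (cpolylog 3 R).im + b * (cpolylog 3 R).re)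
        - 3 * ((m ^ 2 - b ^ 2) * (cpolylog 2 R).im + 2 * m * b * (cpolylog 2 R).re)) := by
  simp [re3, polyComb3, h, pow_succ]
  ring

lemma re4_of_exp {a θ m b : ℝ} {R : ℂ} (h : Complex.exp (a + θ * Complex.I) = R) :
    re4 a θ m b = 24 * (cpolylog 5 R).re
      - 24 * (m * (cpolylog 4 R).re - b * (cpolylog 4 R).im)
      + 12 * ((m ^ 2 - b ^ 2) * (cpolylog 3 R).re - 2 * m * b * (cpolylog 3 R).im)
      - 4 * ((m ^ 3 - 3 * m * b ^ 2) * (cpolylog 2 R).re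
        - (3 * m ^ 2 * b - b ^ 3) * (cpolylog 2 R).im) := by
  simp [re4, polyComb4, h, pow_succ]
  ring

lemma exp_zero_add_zero : Complex.exp ((0 : ℝ) + (0 : ℝ) * Complex.I) = 1 := by simp

lemma exp_zero_add_pi : Complex.exp ((0 : ℝ) + (Real.pi : ℝ) * Complex.I) = -1 := by
  simp [Complex.exp_pi_mul_I]

lemma exp_zero_add_pi_div_two :
    Complex.exp ((0 : ℝ) + (Real.pi / 2 : ℝ) * Complex.I) = Complex.I := by
  simp [Complex.exp_pi_div_two_mul_I]

lemma exp_zero_add_neg_pi_div_two :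
    Complex.exp ((0 : ℝ) + (-(Real.pi / 2) : ℝ) * Complex.I) = starRingEnd ℂ Complex.I := by
  have := Complex.exp_neg_pi_div_two_mul_I
  rw [Complex.conj_I, ← this]
  congr 1
  push_cast
  ring

lemma exp_neg_log_two_add_zero :
    Complex.exp ((-Real.log 2 : ℝ) + (0 : ℝ) * Complex.I) = ((1 / 2 : ℝ) : ℂ) := by
  simp only [Complex.ofReal_zero, zero_mul, add_zero]
  rw [← Complex.ofReal_exp, Real.exp_neg, Real.exp_log (by norm_num)]
  norm_num

/-- Polar decomposition of `1 + y i`. -/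
lemma exp_half_log_add_arctan (y : ℝ) :
    Complex.exp ((Real.log (1 + y ^ 2) / 2 : ℝ) + (Real.arctan y : ℝ) * Complex.I)
      = 1 + y * Complex.I := by
  have h : (0 : ℝ) < 1 + y ^ 2 := by positivity
  have hs : Real.exp (Real.log (1 + y ^ 2) / 2) = √(1 + y ^ 2) := by
    rw [Real.exp_half, Real.exp_log h]
  have hs0 : √(1 + y ^ 2) ≠ 0 := (Real.sqrt_pos.2 h).ne'
  rw [Complex.exp_add, ← Complex.ofReal_exp, hs, Complex.exp_mul_I, ← Complex.ofReal_cos,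
    ← Complex.ofReal_sin, Real.cos_arctan, Real.sin_arctan]
  apply Complex.ext <;> simp <;> field_simp

lemma exp_neg_half_log_two_add_pi_div_four :
    Complex.exp ((-(Real.log 2 / 2) : ℝ) + (Real.pi / 4 : ℝ) * Complex.I)
      = (1 + Complex.I) / 2 := by
  have h := exp_half_log_add_arctan 1
  rw [Real.arctan_one, show (1 : ℝ) + 1 ^ 2 = 2 by norm_num, Complex.ofReal_one, one_mul] at h
  rw [← h, eq_div_iff two_ne_zero]
  have h2 : (2 : ℂ) = Complex.exp (Real.log 2 : ℝ) := by
    rw [← Complex.ofReal_exp, Real.exp_log (by norm_num)]; norm_num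
  rw [h2, ← Complex.exp_add]
  congr 1
  push_cast
  ring

lemma exp_neg_half_log_two_add_neg_pi_div_four :
    Complex.exp ((-(Real.log 2 / 2) : ℝ) + (-(Real.pi / 4) : ℝ) * Complex.I)
      = starRingEnd ℂ ((1 + Complex.I) / 2) := by
  rw [← exp_neg_half_log_two_add_pi_div_four, ← Complex.exp_conj]
  congr 1
  rw [map_add, map_mul, Complex.conj_ofReal, Complex.conj_ofReal, Complex.conj_I]
  push_cast
  ring

end SpecialValues

lemma eq_of_hasDerivWithinAt_zero_of_tendsto {F : ℝ → ℝ} {S : Set ℝ} (hS : Convex ℝ S)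
    (hF : ∀ t ∈ S, HasDerivWithinAt F 0 S t) {t₀ L : ℝ} (ht₀ : t₀ ∈ S) {l : Filter ℝ} [l.NeBot]
    (hl : ∀ᶠ x in l, x ∈ S) (hL : Tendsto F l (𝓝 L)) : F t₀ = L := by
  refine tendsto_nhds_unique (tendsto_const_nhds.congr' ?_) hL
  filter_upwards [hl] with x hx
  have hd : ∀ t ∈ S, HasFDerivWithinAt F (0 : ℝ →L[ℝ] ℝ) S t := fun t ht => by
    refine (hF t ht).hasFDerivWithinAt.congr_fderiv ?_
    ext; simp
  have := hS.norm_image_sub_le_of_norm_hasFDerivWithin_le (C := 0) hd (by simp) hx ht₀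
  rw [zero_mul] at this
  exact sub_eq_zero.1 (norm_le_zero_iff.1 this)

section CubicPath

/-- The parameter interval of the path `z = (3 - s²)³ / (4 (1 + s²)²)` from `1 / 2` to `0`. -/
def cubicDom : Set ℝ := Ico 1 √3

noncomputable def cubicP (s : ℝ) : ℝ := Real.log (3 - s ^ 2)

noncomputable def cubicQ (s : ℝ) : ℝ := Real.log (1 + s ^ 2)

lemma cubicDom_pos {s : ℝ} (hs : s ∈ cubicDom) : 0 < s := one_pos.trans_le hs.1

lemma sq_lt_three {s : ℝ} (hs : s ∈ cubicDom) : s ^ 2 < 3 :=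
  (Real.lt_sqrt (cubicDom_pos hs).le).1 hs.2

lemma one_le_sq {s : ℝ} (hs : s ∈ cubicDom) : 1 ≤ s ^ 2 := one_le_pow₀ hs.1

lemma convex_cubicDom : Convex ℝ cubicDom := convex_Ico _ _

lemma one_mem_cubicDom : (1 : ℝ) ∈ cubicDom :=
  ⟨le_rfl, (Real.lt_sqrt zero_le_one).2 (by norm_num)⟩

lemma hasDeriv_cubicP {s : ℝ} (hs : s ∈ cubicDom) :
    HasDerivWithinAt cubicP (-(2 * s) / (3 - s ^ 2)) cubicDom s := by
  have h := ((hasDerivAt_pow 2 s).const_sub 3).log (by linarith [sq_lt_three hs])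
  refine h.hasDerivWithinAt.congr_deriv ?_
  simp

lemma hasDeriv_cubicQ {s : ℝ} (S : Set ℝ) :
    HasDerivWithinAt cubicQ (2 * s / (1 + s ^ 2)) S s := by
  have h := ((hasDerivAt_pow 2 s).const_add 1).log (by positivity)
  refine h.hasDerivWithinAt.congr_deriv ?_
  simp

lemma hasDeriv_arctan {s : ℝ} (S : Set ℝ) :
    HasDerivWithinAt Real.arctan (1 / (1 + s ^ 2)) S s :=
  (Real.hasDerivAt_arctan s).hasDerivWithinAt

lemma log_four_eq : Real.log 4 = 2 * Real.log 2 := by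
  rw [show (4 : ℝ) = 2 ^ 2 by norm_num, Real.log_pow]
  norm_num

lemma cubicP_le {s : ℝ} (hs : s ∈ cubicDom) : cubicP s ≤ Real.log 2 :=
  Real.log_le_log (by linarith [sq_lt_three hs]) (by linarith [one_le_sq hs])

lemma le_cubicQ {s : ℝ} (hs : s ∈ cubicDom) : Real.log 2 ≤ cubicQ s :=
  Real.log_le_log (by norm_num) (by linarith [one_le_sq hs])

lemma cubicQ_le {s : ℝ} (hs : s ∈ cubicDom) : cubicQ s ≤ 2 * Real.log 2 := by
  rw [← log_four_eq]
  exact Real.log_le_log (by positivity) (by linarith [sq_lt_three hs])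

lemma exp_cubicP {s : ℝ} (hs : s ∈ cubicDom) :
    Complex.exp (cubicP s) = 3 - (s : ℂ) ^ 2 := by
  rw [← Complex.ofReal_exp, cubicP, Real.exp_log (by linarith [sq_lt_three hs])]
  push_cast; rfl

lemma exp_cubicQ (s : ℝ) : Complex.exp (cubicQ s) = (1 + s * Complex.I) * (1 - s * Complex.I) := by
  rw [← Complex.ofReal_exp, cubicQ, Real.exp_log (by positivity)]
  push_cast
  linear_combination (s : ℂ) ^ 2 * Complex.I_sq

lemma exp_half_cubicQ_add_arctan (s : ℝ) :
    Complex.exp (cubicQ s / 2 + Real.arctan s * Complex.I) = 1 + s * Complex.I := by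
  rw [← exp_half_log_add_arctan, cubicQ]
  push_cast
  rfl

lemma exp_half_cubicQ_sub_arctan (s : ℝ) :
    Complex.exp (cubicQ s / 2 - Real.arctan s * Complex.I) = 1 - s * Complex.I := by
  have := exp_half_cubicQ_add_arctan (-s)
  rw [Real.arctan_neg, cubicQ, neg_sq, Complex.ofReal_neg, Complex.ofReal_neg] at this
  rw [sub_eq_add_neg, ← neg_mul, cubicQ, this]
  ring

lemma exp_log_two : Complex.exp (Real.log 2 : ℝ) = 2 := by
  rw [← Complex.ofReal_exp, Real.exp_log (by norm_num)]
  norm_num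

lemma one_add_mul_I_ne_zero (s : ℝ) : (1 + s * Complex.I : ℂ) ≠ 0 := by
  rw [← exp_half_cubicQ_add_arctan]; exact Complex.exp_ne_zero _

lemma one_sub_mul_I_ne_zero (s : ℝ) : (1 - s * Complex.I : ℂ) ≠ 0 := by
  rw [← exp_half_cubicQ_sub_arctan]; exact Complex.exp_ne_zero _

lemma arctan_mem {s : ℝ} (hs : s ∈ cubicDom) :
    Real.pi / 4 ≤ Real.arctan s ∧ Real.arctan s < Real.pi / 3 := by
  rw [← Real.arctan_one, ← Real.arctan_sqrt_three]
  exact ⟨Real.arctan_strictMono.monotone hs.1, Real.arctan_strictMono hs.2⟩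

local notation "L" => Real.log 2
local notation "π" => Real.pi

lemma cubicPath_A1 {s : ℝ} (hs : s ∈ cubicDom) :
    LogPath (fun s => cubicP s - 2 * L) (fun _ => 0) (fun s => cubicP s - L) (fun _ => 0)
      (-(2 * s) / (3 - s ^ 2)) 0 (cubicQ s - 2 * L) 0 cubicDom s where
  mem := hs
  nonpos x hx := by linarith [cubicP_le hx, Real.log_pos one_lt_two]
  deriv_a := (hasDeriv_cubicP hs).sub_const _
  deriv_θ := hasDerivWithinAt_const _ _ _
  deriv_m := (hasDeriv_cubicP hs).sub_const _
  deriv_b := hasDerivWithinAt_const _ _ _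
  exp_eq := by
    push_cast
    simp only [zero_mul, add_zero, Complex.exp_sub, two_mul, Complex.exp_add, exp_log_two, exp_cubicQ,
      exp_cubicP hs]
    linear_combination -(s : ℂ) ^ 2 * Complex.I_sq / 4
  neg_pi_lt := by linarith [Real.pi_pos]
  le_pi := Real.pi_pos.le

lemma cubicPath_A2 {s : ℝ} (hs : s ∈ cubicDom) :
    LogPath (fun s => cubicP s - cubicQ s) (fun s => -(2 * Real.arctan s))
      (fun s => cubicP s - cubicQ s) (fun s => π / 2 - 2 * Real.arctan s)
      (-(2 * s) / (3 - s ^ 2) - 2 * s / (1 + s ^ 2)) (-(2 * (1 / (1 + s ^ 2))))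
      (L - cubicQ s / 2) (π - 3 * Real.arctan s) cubicDom s where
  mem := hs
  nonpos x hx := by linarith [cubicP_le hx, le_cubicQ hx]
  deriv_a := (hasDeriv_cubicP hs).sub (hasDeriv_cubicQ _)
  deriv_θ := ((hasDeriv_arctan _).const_mul 2).neg
  deriv_m := (hasDeriv_cubicP hs).sub (hasDeriv_cubicQ _)
  deriv_b := ((hasDeriv_arctan _).const_mul 2).const_sub _
  exp_eq := by
    have h1 : ((cubicP s - cubicQ s : ℝ) : ℂ) + (-(2 * Real.arctan s) : ℝ) * Complex.I
        = cubicP s - (cubicQ s / 2 + Real.arctan s * Complex.I)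
          - (cubicQ s / 2 + Real.arctan s * Complex.I) := by push_cast; ring
    have h2 : ((L - cubicQ s / 2 : ℝ) : ℂ) + (π - 3 * Real.arctan s : ℝ) * Complex.I
        = L + π * Complex.I + (cubicQ s / 2 - Real.arctan s * Complex.I)
          - (cubicQ s / 2 + Real.arctan s * Complex.I)
          - (cubicQ s / 2 + Real.arctan s * Complex.I) := by push_cast; ring
    have hX := exp_half_cubicQ_add_arctan s
    have hY := exp_half_cubicQ_sub_arctan s
    rw [h1, h2]
    generalize (cubicQ s / 2 + Real.arctan s * Complex.I : ℂ) = X at *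
    generalize (cubicQ s / 2 - Real.arctan s * Complex.I : ℂ) = Y at *
    simp only [Complex.exp_sub, Complex.exp_add, Complex.exp_pi_mul_I, hX, hY, exp_log_two,
      exp_cubicP hs]
    have := one_add_mul_I_ne_zero s
    field_simp
    linear_combination -(s : ℂ) ^ 2 * Complex.I_sq
  neg_pi_lt := by linarith [Real.pi_pos, (arctan_mem hs).2]
  le_pi := by linarith [Real.pi_pos, (arctan_mem hs).1]

lemma cubicPath_B1 {s : ℝ} (hs : s ∈ cubicDom) :
    LogPath (fun s => cubicQ s - 2 * L) (fun _ => 0) (fun s => cubicQ s - L) (fun _ => 0)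
      (2 * s / (1 + s ^ 2)) (0) (cubicP s - 2 * L) (0) cubicDom s where
  mem := hs
  nonpos x hx := by linarith [cubicQ_le hx]
  deriv_a := (hasDeriv_cubicQ _).sub_const _
  deriv_θ := hasDerivWithinAt_const _ _ _
  deriv_m := (hasDeriv_cubicQ _).sub_const _
  deriv_b := hasDerivWithinAt_const _ _ _
  exp_eq := by
    have h1 : ((cubicQ s - 2 * L : ℝ) : ℂ) + (0 : ℝ) * Complex.I
        = (cubicQ s / 2 + Real.arctan s * Complex.I) + (cubicQ s / 2 - Real.arctan s * Complex.I) - (L + L) := by push_cast; ring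
    have h2 : ((cubicP s - 2 * L : ℝ) : ℂ) + (0 : ℝ) * Complex.I
        = cubicP s - (L + L) := by push_cast; ring
    have hX := exp_half_cubicQ_add_arctan s
    have hY := exp_half_cubicQ_sub_arctan s
    rw [h1, h2]
    generalize (cubicQ s / 2 + Real.arctan s * Complex.I : ℂ) = X at *
    generalize (cubicQ s / 2 - Real.arctan s * Complex.I : ℂ) = Y at *
    simp only [Complex.exp_sub, Complex.exp_add, hX, hY, exp_log_two,
      exp_cubicP hs]
    have hX0 := one_add_mul_I_ne_zero s
    have hY0 := one_sub_mul_I_ne_zero s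
    field_simp
    linear_combination -(s : ℂ) ^ 2 * Complex.I_sq
  neg_pi_lt := by linarith [Real.pi_pos]
  le_pi := by exact Real.pi_pos.le

lemma cubicPath_B2 {s : ℝ} (hs : s ∈ cubicDom) :
    LogPath (fun s => cubicQ s / 2 - L) (fun s => 3 * Real.arctan s - π) (fun s => cubicQ s / 2 - L / 2) (fun s => 3 * Real.arctan s - 3 * (π / 4))
      (2 * s / (1 + s ^ 2) / 2) (3 * (1 / (1 + s ^ 2))) (cubicP s - cubicQ s / 2 - L) (Real.arctan s) cubicDom s where
  mem := hs
  nonpos x hx := by linarith [cubicQ_le hx]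
  deriv_a := ((hasDeriv_cubicQ _).div_const 2).sub_const _
  deriv_θ := ((hasDeriv_arctan _).const_mul 3).sub_const _
  deriv_m := ((hasDeriv_cubicQ _).div_const 2).sub_const _
  deriv_b := ((hasDeriv_arctan _).const_mul 3).sub_const _
  exp_eq := by
    have h1 : ((cubicQ s / 2 - L : ℝ) : ℂ) + (3 * Real.arctan s - π : ℝ) * Complex.I
        = (cubicQ s / 2 + Real.arctan s * Complex.I) + (cubicQ s / 2 + Real.arctan s * Complex.I) - (cubicQ s / 2 - Real.arctan s * Complex.I) - L - π * Complex.I := by push_cast; ring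
    have h2 : ((cubicP s - cubicQ s / 2 - L : ℝ) : ℂ) + (Real.arctan s : ℝ) * Complex.I
        = cubicP s - (cubicQ s / 2 - Real.arctan s * Complex.I) - L := by push_cast; ring
    have hX := exp_half_cubicQ_add_arctan s
    have hY := exp_half_cubicQ_sub_arctan s
    rw [h1, h2]
    generalize (cubicQ s / 2 + Real.arctan s * Complex.I : ℂ) = X at *
    generalize (cubicQ s / 2 - Real.arctan s * Complex.I : ℂ) = Y at *
    simp only [Complex.exp_sub, Complex.exp_add, Complex.exp_pi_mul_I, hX, hY, exp_log_two,
      exp_cubicP hs]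
    have hX0 := one_add_mul_I_ne_zero s
    have hY0 := one_sub_mul_I_ne_zero s
    field_simp
    linear_combination -(s : ℂ) ^ 2 * Complex.I_sq
  neg_pi_lt := by linarith [Real.pi_pos, (arctan_mem hs).1]
  le_pi := by linarith [Real.pi_pos, (arctan_mem hs).2]

lemma cubicPath_C1 {s : ℝ} (hs : s ∈ cubicDom) :
    LogPath (fun s => cubicP s - cubicQ s) (fun _ => π) (fun s => cubicP s - cubicQ s) (fun _ => 0)
      (-(2 * s) / (3 - s ^ 2) - 2 * s / (1 + s ^ 2)) (0) (2 * L - cubicQ s) (0) cubicDom s where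
  mem := hs
  nonpos x hx := by linarith [cubicP_le hx, le_cubicQ hx]
  deriv_a := (hasDeriv_cubicP hs).sub (hasDeriv_cubicQ _)
  deriv_θ := hasDerivWithinAt_const _ _ _
  deriv_m := (hasDeriv_cubicP hs).sub (hasDeriv_cubicQ _)
  deriv_b := hasDerivWithinAt_const _ _ _
  exp_eq := by
    have h1 : ((cubicP s - cubicQ s : ℝ) : ℂ) + (π : ℝ) * Complex.I
        = cubicP s - (cubicQ s / 2 + Real.arctan s * Complex.I) - (cubicQ s / 2 - Real.arctan s * Complex.I) + π * Complex.I := by push_cast; ring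
    have h2 : ((2 * L - cubicQ s : ℝ) : ℂ) + (0 : ℝ) * Complex.I
        = L + L - (cubicQ s / 2 + Real.arctan s * Complex.I) - (cubicQ s / 2 - Real.arctan s * Complex.I) := by push_cast; ring
    have hX := exp_half_cubicQ_add_arctan s
    have hY := exp_half_cubicQ_sub_arctan s
    rw [h1, h2]
    generalize (cubicQ s / 2 + Real.arctan s * Complex.I : ℂ) = X at *
    generalize (cubicQ s / 2 - Real.arctan s * Complex.I : ℂ) = Y at *
    simp only [Complex.exp_sub, Complex.exp_add, Complex.exp_pi_mul_I, hX, hY, exp_log_two,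
      exp_cubicP hs]
    have hX0 := one_add_mul_I_ne_zero s
    have hY0 := one_sub_mul_I_ne_zero s
    field_simp
    linear_combination (s : ℂ) ^ 2 * Complex.I_sq
  neg_pi_lt := by linarith [Real.pi_pos]
  le_pi := by exact Real.pi_pos.le

lemma cubicPath_C2 {s : ℝ} (hs : s ∈ cubicDom) :
    LogPath (fun s => cubicP s - cubicQ s / 2 - L) (fun s => Real.arctan s) (fun s => cubicP s - cubicQ s / 2 - L / 2) (fun s => Real.arctan s - π / 4)
      (-(2 * s) / (3 - s ^ 2) - 2 * s / (1 + s ^ 2) / 2) (1 / (1 + s ^ 2)) (cubicQ s / 2 - L) (3 * Real.arctan s - π) cubicDom s where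
  mem := hs
  nonpos x hx := by linarith [cubicP_le hx, le_cubicQ hx, Real.log_pos one_lt_two]
  deriv_a := ((hasDeriv_cubicP hs).sub ((hasDeriv_cubicQ _).div_const 2)).sub_const _
  deriv_θ := (hasDeriv_arctan _)
  deriv_m := ((hasDeriv_cubicP hs).sub ((hasDeriv_cubicQ _).div_const 2)).sub_const _
  deriv_b := (hasDeriv_arctan _).sub_const _
  exp_eq := by
    have h1 : ((cubicP s - cubicQ s / 2 - L : ℝ) : ℂ) + (Real.arctan s : ℝ) * Complex.I
        = cubicP s - (cubicQ s / 2 - Real.arctan s * Complex.I) - L := by push_cast; ring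
    have h2 : ((cubicQ s / 2 - L : ℝ) : ℂ) + (3 * Real.arctan s - π : ℝ) * Complex.I
        = (cubicQ s / 2 + Real.arctan s * Complex.I) + (cubicQ s / 2 + Real.arctan s * Complex.I) - (cubicQ s / 2 - Real.arctan s * Complex.I) - L - π * Complex.I := by push_cast; ring
    have hX := exp_half_cubicQ_add_arctan s
    have hY := exp_half_cubicQ_sub_arctan s
    rw [h1, h2]
    generalize (cubicQ s / 2 + Real.arctan s * Complex.I : ℂ) = X at *
    generalize (cubicQ s / 2 - Real.arctan s * Complex.I : ℂ) = Y at *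
    simp only [Complex.exp_sub, Complex.exp_add, Complex.exp_pi_mul_I, hX, hY, exp_log_two,
      exp_cubicP hs]
    have hX0 := one_add_mul_I_ne_zero s
    have hY0 := one_sub_mul_I_ne_zero s
    field_simp
    linear_combination -(s : ℂ) ^ 2 * Complex.I_sq
  neg_pi_lt := by linarith [Real.pi_pos, (arctan_mem hs).1]
  le_pi := by linarith [Real.pi_pos, (arctan_mem hs).2]

end CubicPath

/-- A monomial in three functions. -/
noncomputable def monom (x y z : ℝ → ℝ) (i j k : ℕ) (t : ℝ) : ℝ := x t ^ i * y t ^ j * z t ^ k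

lemma hasDeriv_monom {x y z : ℝ → ℝ} {x' y' z' t : ℝ} {S : Set ℝ} (hx : HasDerivWithinAt x x' S t)
    (hy : HasDerivWithinAt y y' S t) (hz : HasDerivWithinAt z z' S t) (i j k : ℕ) :
    HasDerivWithinAt (monom x y z i j k) (i * x t ^ (i - 1) * x' * y t ^ j * z t ^ k
      + x t ^ i * (j * y t ^ (j - 1) * y') * z t ^ k
      + x t ^ i * y t ^ j * (k * z t ^ (k - 1) * z')) S t := by
  refine (((hx.fun_pow i).fun_mul (hy.fun_pow j)).fun_mul (hz.fun_pow k)).congr_deriv ?_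
  ring

section CubicRelations

local notation "L" => Real.log 2
local notation "π" => Real.pi

noncomputable def cubicM (s : ℝ) : ℝ := 3 * cubicP s - 2 * cubicQ s - L

noncomputable def cubicE (s : ℝ) : ℝ := cubicQ s - 2 * L

noncomputable def cubicK (s : ℝ) : ℝ := π - 3 * Real.arctan s

lemma hasDeriv_cubicM {s : ℝ} (hs : s ∈ cubicDom) :
    HasDerivWithinAt cubicM (3 * (-(2 * s) / (3 - s ^ 2)) - 2 * (2 * s / (1 + s ^ 2)))
      cubicDom s :=
  (((hasDeriv_cubicP hs).const_mul 3).fun_sub ((hasDeriv_cubicQ _).const_mul 2)).sub_const _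

lemma hasDeriv_cubicE {s : ℝ} (S : Set ℝ) :
    HasDerivWithinAt cubicE (2 * s / (1 + s ^ 2)) S s := (hasDeriv_cubicQ _).sub_const _

lemma hasDeriv_cubicK {s : ℝ} (S : Set ℝ) :
    HasDerivWithinAt cubicK (-(3 * (1 / (1 + s ^ 2)))) S s :=
  ((hasDeriv_arctan _).const_mul 3).const_sub _

/-- Monomials in the letters of the cubic path. -/
noncomputable def cubicMonom (i j k : ℕ) : ℝ → ℝ := monom cubicM cubicE cubicK i j k

lemma hasDeriv_cubicMonom {s : ℝ} (hs : s ∈ cubicDom) (i j k : ℕ) :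
    HasDerivWithinAt (cubicMonom i j k)
      (i * cubicM s ^ (i - 1) * (3 * (-(2 * s) / (3 - s ^ 2)) - 2 * (2 * s / (1 + s ^ 2)))
          * cubicE s ^ j * cubicK s ^ k
      + cubicM s ^ i * (j * cubicE s ^ (j - 1) * (2 * s / (1 + s ^ 2))) * cubicK s ^ k
      + cubicM s ^ i * cubicE s ^ j * (k * cubicK s ^ (k - 1) * (-(3 * (1 / (1 + s ^ 2))))))
      cubicDom s :=
  hasDeriv_monom (hasDeriv_cubicM hs) (hasDeriv_cubicE _) (hasDeriv_cubicK _) i j k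

/-- Evaluation of a function of four variables along a path. -/
noncomputable def pathA1 (R : ℝ → ℝ → ℝ → ℝ → ℝ) (s : ℝ) : ℝ :=
  R (cubicP s - 2 * L) (0) (cubicP s - L) (0)

/-- Evaluation of a function of four variables along a path. -/
noncomputable def pathA2 (R : ℝ → ℝ → ℝ → ℝ → ℝ) (s : ℝ) : ℝ :=
  R (cubicP s - cubicQ s) (-(2 * Real.arctan s)) (cubicP s - cubicQ s) (π / 2 - 2 * Real.arctan s)

/-- Evaluation of a function of four variables along a path. -/
noncomputable def pathB1 (R : ℝ → ℝ → ℝ → ℝ → ℝ) (s : ℝ) : ℝ :=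
  R (cubicQ s - 2 * L) (0) (cubicQ s - L) (0)

/-- Evaluation of a function of four variables along a path. -/
noncomputable def pathB2 (R : ℝ → ℝ → ℝ → ℝ → ℝ) (s : ℝ) : ℝ :=
  R (cubicQ s / 2 - L) (3 * Real.arctan s - π) (cubicQ s / 2 - L / 2) (3 * Real.arctan s - 3 * (π / 4))

/-- Evaluation of a function of four variables along a path. -/
noncomputable def pathC1 (R : ℝ → ℝ → ℝ → ℝ → ℝ) (s : ℝ) : ℝ :=
  R (cubicP s - cubicQ s) (π) (cubicP s - cubicQ s) (0)

/-- Evaluation of a function of four variables along a path. -/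
noncomputable def pathC2 (R : ℝ → ℝ → ℝ → ℝ → ℝ) (s : ℝ) : ℝ :=
  R (cubicP s - cubicQ s / 2 - L) (Real.arctan s) (cubicP s - cubicQ s / 2 - L / 2) (Real.arctan s - π / 4)

lemma tendsto_cubicDom : ∀ᶠ s in 𝓝[<] √3, s ∈ cubicDom :=
  Ico_mem_nhdsLT one_mem_cubicDom.2

lemma tendsto_cubicU : Tendsto (fun s : ℝ => 3 - s ^ 2) (𝓝[<] √3) (𝓝[>] 0) := by
  refine tendsto_nhdsWithin_iff.2 ⟨?_, ?_⟩
  · have : Continuous fun s : ℝ => 3 - s ^ 2 := by fun_prop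
    have h := (this.tendsto (√3)).mono_left (nhdsWithin_le_nhds (s := Iio √3))
    rwa [Real.sq_sqrt (by norm_num), sub_self] at h
  · filter_upwards [tendsto_cubicDom] with s hs
    simpa using sq_lt_three hs

lemma tendsto_cubicP : Tendsto cubicP (𝓝[<] √3) atBot :=
  Real.tendsto_log_nhdsGT_zero.comp tendsto_cubicU

lemma tendsto_cubicQ : Tendsto cubicQ (𝓝[<] √3) (𝓝 (2 * L)) := by
  have h := ((hasDeriv_cubicQ univ).continuousWithinAt (x := √3)).tendsto
  rw [nhdsWithin_univ, cubicQ, Real.sq_sqrt (by norm_num), show (1 + 3 : ℝ) = 4 by norm_num,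
    log_four_eq] at h
  exact h.mono_left nhdsWithin_le_nhds

lemma tendsto_arctan_sqrt_three : Tendsto Real.arctan (𝓝[<] √3) (𝓝 (π / 3)) := by
  rw [← Real.arctan_sqrt_three]
  exact (Real.continuous_arctan.tendsto _).mono_left nhdsWithin_le_nhds

lemma cubicE_sqrt_three : cubicE √3 = 0 := by
  rw [cubicE, cubicQ, Real.sq_sqrt (by norm_num), show (1 + 3 : ℝ) = 4 by norm_num, log_four_eq,
    sub_self]

lemma cubicK_sqrt_three : cubicK √3 = 0 := by
  rw [cubicK, Real.arctan_sqrt_three]; ring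

lemma isBigO_cubicU : (fun s : ℝ => s - √3) =O[𝓝[<] √3] fun s => 3 - s ^ 2 := by
  refine Asymptotics.IsBigO.of_bound 1 ?_
  filter_upwards [tendsto_cubicDom] with s hs
  have h : 3 - s ^ 2 = (√3 - s) * (√3 + s) := by
    linear_combination -(Real.sq_sqrt (show (0 : ℝ) ≤ 3 by norm_num))
  have h1 : 1 ≤ √3 + s := by linarith [hs.1, Real.sqrt_nonneg 3]
  have h2 : 0 < √3 - s := sub_pos.2 hs.2
  rw [h, Real.norm_eq_abs, Real.norm_eq_abs, abs_sub_comm, abs_of_pos h2,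
    abs_of_pos (by positivity), one_mul]
  nlinarith

lemma isBigO_cubicE : cubicE =O[𝓝[<] √3] fun s => 3 - s ^ 2 := by
  have h := ((hasDeriv_cubicE (s := √3) univ).hasDerivAt univ_mem).isBigO_sub
  simp only [cubicE_sqrt_three, sub_zero] at h
  exact (h.mono nhdsWithin_le_nhds).trans isBigO_cubicU

lemma isBigO_cubicK : cubicK =O[𝓝[<] √3] fun s => 3 - s ^ 2 := by
  have h := ((hasDeriv_cubicK (s := √3) univ).hasDerivAt univ_mem).isBigO_sub
  simp only [cubicK_sqrt_three, sub_zero] at h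
  exact (h.mono nhdsWithin_le_nhds).trans isBigO_cubicU

lemma isBigO_cubicM : cubicM =O[𝓝[<] √3] cubicP := by
  have hP : Tendsto (fun s => ‖cubicP s‖) (𝓝[<] √3) atTop :=
    tendsto_abs_atBot_atTop.comp tendsto_cubicP
  have h1 : (fun _ : ℝ => (1 : ℝ)) =O[𝓝[<] √3] cubicP :=
    ((Asymptotics.isLittleO_const_left (c := (1 : ℝ))).2 (Or.inr hP)).isBigO
  have h2 : (fun s => 2 * cubicQ s + L) =O[𝓝[<] √3] fun _ => (1 : ℝ) :=
    ((tendsto_cubicQ.const_mul 2).add_const _).isBigO_one ℝ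
  have h3 := ((Asymptotics.isBigO_refl cubicP (𝓝[<] √3)).const_mul_left 3).sub (h2.trans h1)
  refine h3.congr_left fun s => ?_
  simp only [cubicM]
  ring

lemma tendsto_cubicM_pow_mul {f : ℝ → ℝ} (hf : f =O[𝓝[<] √3] fun s => 3 - s ^ 2) (i : ℕ) :
    Tendsto (fun s => cubicM s ^ i * f s) (𝓝[<] √3) (𝓝 0) := by
  have h := (isBigO_cubicM.pow i).mul hf
  refine h.trans_tendsto ?_
  have h0 := (Real.tendsto_pow_mul_exp_neg_atTop_nhds_zero i).comp
    (tendsto_neg_atBot_atTop.comp tendsto_cubicP)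
  have h1 := h0.const_mul ((-1) ^ i)
  rw [mul_zero] at h1
  refine h1.congr' ?_
  filter_upwards [tendsto_cubicDom] with s hs
  simp only [Function.comp_apply, neg_neg]
  rw [← mul_assoc, ← mul_pow, neg_one_mul, neg_neg, cubicP,
    Real.exp_log (by linarith [sq_lt_three hs])]

lemma tendsto_cubicMonom (i j k : ℕ) (h : j + k ≠ 0) :
    Tendsto (cubicMonom i j k) (𝓝[<] √3) (𝓝 0) := by
  have he : Tendsto cubicE (𝓝[<] √3) (𝓝 0) := by
    simpa using tendsto_cubicM_pow_mul isBigO_cubicE 0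
  have hk : Tendsto cubicK (𝓝[<] √3) (𝓝 0) := by
    simpa using tendsto_cubicM_pow_mul isBigO_cubicK 0
  rcases j with _ | j
  · obtain ⟨k, rfl⟩ : ∃ k', k = k' + 1 := ⟨k - 1, by omega⟩
    have := (tendsto_cubicM_pow_mul isBigO_cubicK i).mul (hk.pow k)
    rw [zero_mul] at this
    refine this.congr fun s => ?_
    simp only [cubicMonom, monom]
    ring
  · have := ((tendsto_cubicM_pow_mul isBigO_cubicE i).mul (he.pow j)).mul (hk.pow k)
    rw [zero_mul, zero_mul] at this
    refine this.congr fun s => ?_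
    simp only [cubicMonom, monom]
    ring

lemma cubicMonom_one (i j k : ℕ) : cubicMonom i j k 1 = 0 ^ i * (-L) ^ j * (π / 4) ^ k := by
  have hM : cubicM 1 = 0 := by norm_num [cubicM, cubicP, cubicQ]; ring
  have hE : cubicE 1 = -L := by norm_num [cubicE, cubicQ]; ring
  have hK : cubicK 1 = π / 4 := by rw [cubicK, Real.arctan_one]; ring
  rw [cubicMonom, monom, hM, hE, hK]

end CubicRelations

section PathLimits

/-- Decay of a function of four variables as its first argument tends to `-∞`. -/
def DecaysAtBot (R : ℝ → ℝ → ℝ → ℝ → ℝ) : Prop :=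
  ∀ (F : Filter ℝ) (a θ m b : ℝ → ℝ) (b₀ c : ℝ), Tendsto a F atBot → (∀ᶠ x in F, m x = a x + c) →
    Tendsto b F (𝓝 b₀) → Tendsto (fun x => R (a x) (θ x) (m x) (b x)) F (𝓝 0)

/-- Continuity of a function of four variables on the half space where the first one is `≤ 0`. -/
def ContinuousOnNonpos (R : ℝ → ℝ → ℝ → ℝ → ℝ) : Prop :=
  ∀ (F : Filter ℝ) (a θ m b : ℝ → ℝ) (a₀ θ₀ m₀ b₀ : ℝ), Tendsto a F (𝓝 a₀) → Tendsto θ F (𝓝 θ₀) →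
    Tendsto m F (𝓝 m₀) → Tendsto b F (𝓝 b₀) → (∀ᶠ x in F, a x ≤ 0) → a₀ ≤ 0 →
    Tendsto (fun x => R (a x) (θ x) (m x) (b x)) F (𝓝 (R a₀ θ₀ m₀ b₀))

lemma decaysAtBot_re1 : DecaysAtBot re1 := fun _ _ _ _ _ _ _ ha hm hb => tendsto_re1_zero ha hm hb

lemma decaysAtBot_re2 : DecaysAtBot re2 := fun _ _ _ _ _ _ _ ha hm hb => tendsto_re2_zero ha hm hb

lemma decaysAtBot_re3 (u v : ℝ) : DecaysAtBot (re3 u v) :=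
  fun _ _ _ _ _ _ _ ha hm hb => tendsto_re3_zero u v ha hm hb

lemma decaysAtBot_re4 : DecaysAtBot re4 := fun _ _ _ _ _ _ _ ha hm hb => tendsto_re4_zero ha hm hb

lemma continuousOnNonpos_re1 : ContinuousOnNonpos re1 :=
  fun _ _ _ _ _ _ _ _ _ ha hθ _ _ h0 h => tendsto_re1 ha hθ h0 h

lemma continuousOnNonpos_re2 : ContinuousOnNonpos re2 :=
  fun _ _ _ _ _ _ _ _ _ ha hθ hm hb h0 h => tendsto_re2 ha hθ hm hb h0 h

lemma continuousOnNonpos_re3 (u v : ℝ) : ContinuousOnNonpos (re3 u v) :=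
  fun _ _ _ _ _ _ _ _ _ ha hθ hm hb h0 h => tendsto_re3 u v ha hθ hm hb h0 h

lemma continuousOnNonpos_re4 : ContinuousOnNonpos re4 :=
  fun _ _ _ _ _ _ _ _ _ ha hθ hm hb h0 h => tendsto_re4 ha hθ hm hb h0 h

local notation "L" => Real.log 2
local notation "π" => Real.pi

variable {R : ℝ → ℝ → ℝ → ℝ → ℝ}

lemma tendsto_pathA1 (hR : DecaysAtBot R) : Tendsto (pathA1 R) (𝓝[<] √3) (𝓝 0) :=
  hR _ _ _ _ _ 0 L (tendsto_atBot_add_const_right _ (-(2 * L)) tendsto_cubicP)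
    (Eventually.of_forall fun s => by ring) tendsto_const_nhds

lemma tendsto_pathA2 (hR : DecaysAtBot R) : Tendsto (pathA2 R) (𝓝[<] √3) (𝓝 0) :=
  hR _ _ _ _ _ _ 0 (tendsto_cubicP.atBot_add tendsto_cubicQ.neg)
    (Eventually.of_forall fun s => by ring) ((tendsto_arctan_sqrt_three.const_mul 2).const_sub _)

lemma tendsto_pathC1 (hR : DecaysAtBot R) : Tendsto (pathC1 R) (𝓝[<] √3) (𝓝 0) :=
  hR _ _ _ _ _ 0 0 (tendsto_cubicP.atBot_add tendsto_cubicQ.neg)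
    (Eventually.of_forall fun s => by ring) tendsto_const_nhds

lemma tendsto_pathC2 (hR : DecaysAtBot R) : Tendsto (pathC2 R) (𝓝[<] √3) (𝓝 0) := by
  refine hR _ _ _ _ _ (π / 3 - π / 4) (L / 2) ?_ (Eventually.of_forall fun s => by ring)
    (tendsto_arctan_sqrt_three.sub_const _)
  exact tendsto_atBot_add_const_right _ (-L)
    (tendsto_cubicP.atBot_add (tendsto_cubicQ.div_const 2).neg)

lemma tendsto_pathB1 (hR : ContinuousOnNonpos R) :
    Tendsto (pathB1 R) (𝓝[<] √3) (𝓝 (R 0 0 L 0)) := by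
  refine hR _ _ _ _ _ 0 0 L 0 ?_ tendsto_const_nhds ?_ tendsto_const_nhds ?_ le_rfl
  · simpa using tendsto_cubicQ.sub_const (2 * L)
  · have := tendsto_cubicQ.sub_const L
    rwa [show 2 * L - L = L by ring] at this
  · filter_upwards [tendsto_cubicDom] with s hs
    linarith [cubicQ_le hs]

lemma tendsto_pathB2 (hR : ContinuousOnNonpos R) :
    Tendsto (pathB2 R) (𝓝[<] √3) (𝓝 (R 0 0 (L / 2) (π / 4))) := by
  refine hR _ _ _ _ _ 0 0 (L / 2) (π / 4) ?_ ?_ ?_ ?_ ?_ le_rfl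
  · have := (tendsto_cubicQ.div_const 2).sub_const L
    rwa [show 2 * L / 2 - L = 0 by ring] at this
  · have := (tendsto_arctan_sqrt_three.const_mul 3).sub_const π
    rwa [show 3 * (π / 3) - π = 0 by ring] at this
  · have := (tendsto_cubicQ.div_const 2).sub_const (L / 2)
    rwa [show 2 * L / 2 - L / 2 = L / 2 by ring] at this
  · have := (tendsto_arctan_sqrt_three.const_mul 3).sub_const (3 * (π / 4))
    rwa [show 3 * (π / 3) - 3 * (π / 4) = π / 4 by ring] at this
  · filter_upwards [tendsto_cubicDom] with s hs
    linarith [cubicQ_le hs]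

lemma cubicP_one : cubicP 1 = L := by norm_num [cubicP]

lemma cubicQ_one : cubicQ 1 = L := by norm_num [cubicQ]

lemma pathA1_one : pathA1 R 1 = R (-L) 0 0 0 := by
  rw [pathA1]
  congr 1 <;> simp only [cubicP_one, cubicQ_one, Real.arctan_one] <;> ring

lemma pathA2_one : pathA2 R 1 = R 0 (-(π / 2)) 0 0 := by
  rw [pathA2]
  congr 1 <;> simp only [cubicP_one, cubicQ_one, Real.arctan_one] <;> ring

lemma pathB1_one : pathB1 R 1 = R (-L) 0 0 0 := by
  rw [pathB1]
  congr 1 <;> simp only [cubicP_one, cubicQ_one, Real.arctan_one] <;> ring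

lemma pathB2_one : pathB2 R 1 = R (-(L / 2)) (-(π / 4)) 0 0 := by
  rw [pathB2]
  congr 1 <;> simp only [cubicP_one, cubicQ_one, Real.arctan_one] <;> ring

lemma pathC1_one : pathC1 R 1 = R 0 π 0 0 := by
  rw [pathC1]
  congr 1 <;> simp only [cubicP_one, cubicQ_one, Real.arctan_one] <;> ring

lemma pathC2_one : pathC2 R 1 = R (-(L / 2)) (π / 4) 0 0 := by
  rw [pathC2]
  congr 1 <;> simp only [cubicP_one, cubicQ_one, Real.arctan_one] <;> ring

end PathLimits

section CubicRelations

local notation "L" => Real.log 2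
local notation "π" => Real.pi

/-- A closed combination of weight two. -/
noncomputable def cubicW2A (s : ℝ) : ℝ :=
    1 * pathA1 re1 s + 2 * pathA2 re1 s
    - ((-2 / 3) * cubicMonom 0 0 2 s + (1 / 2) * cubicMonom 0 2 0 s)

lemma hasDeriv_cubicW2A {s : ℝ} (hs : s ∈ cubicDom) : HasDerivWithinAt cubicW2A
    0 cubicDom s := by
  have hA10 : HasDerivWithinAt (pathA1 re1) _ cubicDom s := (cubicPath_A1 hs).hasDeriv_re1
  have hA21 : HasDerivWithinAt (pathA2 re1) _ cubicDom s := (cubicPath_A2 hs).hasDeriv_re1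
  have hm := fun i j k => hasDeriv_cubicMonom hs i j k
  refine HasDerivWithinAt.congr_deriv
    (((hA10.const_mul 1).fun_add (hA21.const_mul 2)).fun_sub (((hm 0 0 2).const_mul (-2 /
    3)).fun_add ((hm 0 2 0).const_mul (1 / 2)))) ?_
  simp only [cubicM, cubicE, cubicK]
  generalize 2 * s / (1 + s ^ 2) = q'
  generalize -(2 * s) / (3 - s ^ 2) = p'
  generalize 1 / (1 + s ^ 2) = w'
  push_cast
  ring

lemma tendsto_cubicW2A :
    Tendsto cubicW2A (𝓝[<] √3) (𝓝 (0)) := by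
  have ht := tendsto_cubicMonom
  have h :=
    ((((tendsto_pathA1 decaysAtBot_re1).const_mul 1).add ((tendsto_pathA2
    decaysAtBot_re1).const_mul 2)).sub (((ht 0 0 2 (by norm_num)).const_mul (-2 / 3)).add ((ht 0
    2 0 (by norm_num)).const_mul (1 / 2))))
  simp only [mul_zero, add_zero, zero_add, sub_zero] at h
  exact h

lemma cubicW2A_one : cubicW2A 1 =
    1 * re1 (-L) 0 0 0 + 2 * re1 0 (-(π / 2)) 0 0
    - ((-2 / 3) * ((-L) ^ 0 * (π / 4) ^ 2) + (1 / 2) * ((-L) ^ 2 * (π / 4) ^ 0)) := by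
  simp only [cubicW2A, cubicMonom_one, pathA1_one, pathA2_one]
  ring

/-- A closed combination of weight two. -/
noncomputable def cubicW2B (s : ℝ) : ℝ :=
    2 * pathB2 re1 s + (-1) * pathB1 re1 s
    - ((2 / 3 * π) * cubicMonom 0 0 1 s + (-1 / 3) * cubicMonom 0 0 2 s + (-1 / 4) * cubicMonom 0
      2 0 s)

lemma hasDeriv_cubicW2B {s : ℝ} (hs : s ∈ cubicDom) : HasDerivWithinAt cubicW2B
    0 cubicDom s := by
  have hB20 : HasDerivWithinAt (pathB2 re1) _ cubicDom s := (cubicPath_B2 hs).hasDeriv_re1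
  have hB11 : HasDerivWithinAt (pathB1 re1) _ cubicDom s := (cubicPath_B1 hs).hasDeriv_re1
  have hm := fun i j k => hasDeriv_cubicMonom hs i j k
  refine HasDerivWithinAt.congr_deriv
    (((hB20.const_mul 2).fun_add (hB11.const_mul (-1))).fun_sub ((((hm 0 0 1).const_mul (2 / 3 *
    π)).fun_add ((hm 0 0 2).const_mul (-1 / 3))).fun_add ((hm 0 2 0).const_mul (-1 / 4)))) ?_
  simp only [cubicM, cubicE, cubicK]
  generalize 2 * s / (1 + s ^ 2) = q'
  generalize -(2 * s) / (3 - s ^ 2) = p'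
  generalize 1 / (1 + s ^ 2) = w'
  push_cast
  ring

lemma tendsto_cubicW2B :
    Tendsto cubicW2B (𝓝[<] √3) (𝓝 (2 * re1 0 0 (L / 2) (π / 4) + (-1) * re1 0 0 L 0)) := by
  have ht := tendsto_cubicMonom
  have h :=
    ((((tendsto_pathB2 continuousOnNonpos_re1).const_mul 2).add ((tendsto_pathB1
    continuousOnNonpos_re1).const_mul (-1))).sub ((((ht 0 0 1 (by norm_num)).const_mul (2 / 3 *
    π)).add ((ht 0 0 2 (by norm_num)).const_mul (-1 / 3))).add ((ht 0 2 0 (by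
    norm_num)).const_mul (-1 / 4))))
  simp only [mul_zero, add_zero, zero_add, sub_zero] at h
  exact h

lemma cubicW2B_one : cubicW2B 1 =
    2 * re1 (-(L / 2)) (-(π / 4)) 0 0 + (-1) * re1 (-L) 0 0 0
    - ((2 / 3 * π) * ((-L) ^ 0 * (π / 4) ^ 1) + (-1 / 3) * ((-L) ^ 0 * (π / 4) ^ 2) + (-1 / 4) *
      ((-L) ^ 2 * (π / 4) ^ 0)) := by
  simp only [cubicW2B, cubicMonom_one, pathB2_one, pathB1_one]
  ring

/-- A closed combination of weight three. -/
noncomputable def cubicW3A (s : ℝ) : ℝ :=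
    1 * pathA1 re2 s + 2 * pathA2 re2 s + (-2) * pathC1 re2 s + (-4) * pathC2 re2 s
    - ((2 / 3 * L) * cubicMonom 0 0 2 s + (-1 / 3 * π) * cubicMonom 0 1 1 s + (4 / 3) *
      cubicMonom 0 1 2 s + (1 / 2 * L) * cubicMonom 0 2 0 s + (1 / 3) * cubicMonom 0 3 0 s)

lemma hasDeriv_cubicW3A {s : ℝ} (hs : s ∈ cubicDom) : HasDerivWithinAt cubicW3A
    0 cubicDom s := by
  have hA10 : HasDerivWithinAt (pathA1 re2) _ cubicDom s := (cubicPath_A1 hs).hasDeriv_re2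
  have hA21 : HasDerivWithinAt (pathA2 re2) _ cubicDom s := (cubicPath_A2 hs).hasDeriv_re2
  have hC12 : HasDerivWithinAt (pathC1 re2) _ cubicDom s := (cubicPath_C1 hs).hasDeriv_re2
  have hC23 : HasDerivWithinAt (pathC2 re2) _ cubicDom s := (cubicPath_C2 hs).hasDeriv_re2
  have hm := fun i j k => hasDeriv_cubicMonom hs i j k
  refine HasDerivWithinAt.congr_deriv
    (((((hA10.const_mul 1).fun_add (hA21.const_mul 2)).fun_add (hC12.const_mul (-2))).fun_add
    (hC23.const_mul (-4))).fun_sub ((((((hm 0 0 2).const_mul (2 / 3 * L)).fun_add ((hm 0 1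
    1).const_mul (-1 / 3 * π))).fun_add ((hm 0 1 2).const_mul (4 / 3))).fun_add ((hm 0 2
    0).const_mul (1 / 2 * L))).fun_add ((hm 0 3 0).const_mul (1 / 3)))) ?_
  simp only [cubicM, cubicE, cubicK]
  generalize 2 * s / (1 + s ^ 2) = q'
  generalize -(2 * s) / (3 - s ^ 2) = p'
  generalize 1 / (1 + s ^ 2) = w'
  push_cast
  ring

lemma tendsto_cubicW3A :
    Tendsto cubicW3A (𝓝[<] √3) (𝓝 (0)) := by
  have ht := tendsto_cubicMonom
  have h :=
    ((((((tendsto_pathA1 decaysAtBot_re2).const_mul 1).add ((tendsto_pathA2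
    decaysAtBot_re2).const_mul 2)).add ((tendsto_pathC1 decaysAtBot_re2).const_mul (-2))).add
    ((tendsto_pathC2 decaysAtBot_re2).const_mul (-4))).sub ((((((ht 0 0 2 (by
    norm_num)).const_mul (2 / 3 * L)).add ((ht 0 1 1 (by norm_num)).const_mul (-1 / 3 * π))).add
    ((ht 0 1 2 (by norm_num)).const_mul (4 / 3))).add ((ht 0 2 0 (by norm_num)).const_mul (1 / 2
    * L))).add ((ht 0 3 0 (by norm_num)).const_mul (1 / 3))))
  simp only [mul_zero, add_zero, zero_add, sub_zero] at h
  exact h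

lemma cubicW3A_one : cubicW3A 1 =
    1 * re2 (-L) 0 0 0 + 2 * re2 0 (-(π / 2)) 0 0 + (-2) * re2 0 π 0 0 + (-4) * re2 (-(L / 2))
    (π / 4) 0 0
    - ((2 / 3 * L) * ((-L) ^ 0 * (π / 4) ^ 2) + (-1 / 3 * π) * ((-L) ^ 1 * (π / 4) ^ 1) + (4 / 3)
      * ((-L) ^ 1 * (π / 4) ^ 2) + (1 / 2 * L) * ((-L) ^ 2 * (π / 4) ^ 0) + (1 / 3) * ((-L) ^ 3
      * (π / 4) ^ 0)) := by
  simp only [cubicW3A, cubicMonom_one, pathA1_one, pathA2_one, pathC1_one, pathC2_one]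
  ring

/-- A closed combination of weight three. -/
noncomputable def cubicW3B (s : ℝ) : ℝ :=
    3 * pathC1 re2 s + 6 * pathC2 re2 s + 1 * pathB1 re2 s + 2 * pathB2 re2 s
    - ((1 / 3 * L * π) * cubicMonom 0 0 1 s + (-L ^ 2 - 1 / 6 * π ^ 2) * cubicMonom 0 1 0 s + (π)
      * cubicMonom 0 1 1 s + (-4 / 3) * cubicMonom 0 1 2 s + (1 / 3) * cubicMonom 0 3 0 s + (1 /
      3 * π) * cubicMonom 1 0 1 s + (-4 / 3) * cubicMonom 1 0 2 s + (L) * cubicMonom 1 1 0 s +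
      (1) * cubicMonom 1 2 0 s)

lemma hasDeriv_cubicW3B {s : ℝ} (hs : s ∈ cubicDom) : HasDerivWithinAt cubicW3B
    0 cubicDom s := by
  have hC10 : HasDerivWithinAt (pathC1 re2) _ cubicDom s := (cubicPath_C1 hs).hasDeriv_re2
  have hC21 : HasDerivWithinAt (pathC2 re2) _ cubicDom s := (cubicPath_C2 hs).hasDeriv_re2
  have hB12 : HasDerivWithinAt (pathB1 re2) _ cubicDom s := (cubicPath_B1 hs).hasDeriv_re2
  have hB23 : HasDerivWithinAt (pathB2 re2) _ cubicDom s := (cubicPath_B2 hs).hasDeriv_re2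
  have hm := fun i j k => hasDeriv_cubicMonom hs i j k
  refine HasDerivWithinAt.congr_deriv
    (((((hC10.const_mul 3).fun_add (hC21.const_mul 6)).fun_add (hB12.const_mul 1)).fun_add
    (hB23.const_mul 2)).fun_sub ((((((((((hm 0 0 1).const_mul (1 / 3 * L * π)).fun_add ((hm 0 1
    0).const_mul (-L ^ 2 - 1 / 6 * π ^ 2))).fun_add ((hm 0 1 1).const_mul (π))).fun_add ((hm 0 1
    2).const_mul (-4 / 3))).fun_add ((hm 0 3 0).const_mul (1 / 3))).fun_add ((hm 1 0
    1).const_mul (1 / 3 * π))).fun_add ((hm 1 0 2).const_mul (-4 / 3))).fun_add ((hm 1 1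
    0).const_mul (L))).fun_add ((hm 1 2 0).const_mul (1)))) ?_
  simp only [cubicM, cubicE, cubicK]
  generalize 2 * s / (1 + s ^ 2) = q'
  generalize -(2 * s) / (3 - s ^ 2) = p'
  generalize 1 / (1 + s ^ 2) = w'
  push_cast
  ring

lemma tendsto_cubicW3B :
    Tendsto cubicW3B (𝓝[<] √3) (𝓝 (1 * re2 0 0 L 0 + 2 * re2 0 0 (L / 2) (π / 4))) := by
  have ht := tendsto_cubicMonom
  have h :=
    ((((((tendsto_pathC1 decaysAtBot_re2).const_mul 3).add ((tendsto_pathC2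
    decaysAtBot_re2).const_mul 6)).add ((tendsto_pathB1 continuousOnNonpos_re2).const_mul
    1)).add ((tendsto_pathB2 continuousOnNonpos_re2).const_mul 2)).sub ((((((((((ht 0 0 1 (by
    norm_num)).const_mul (1 / 3 * L * π)).add ((ht 0 1 0 (by norm_num)).const_mul (-L ^ 2 - 1 /
    6 * π ^ 2))).add ((ht 0 1 1 (by norm_num)).const_mul (π))).add ((ht 0 1 2 (by
    norm_num)).const_mul (-4 / 3))).add ((ht 0 3 0 (by norm_num)).const_mul (1 / 3))).add ((ht 1
    0 1 (by norm_num)).const_mul (1 / 3 * π))).add ((ht 1 0 2 (by norm_num)).const_mul (-4 /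
    3))).add ((ht 1 1 0 (by norm_num)).const_mul (L))).add ((ht 1 2 0 (by norm_num)).const_mul
    (1))))
  simp only [mul_zero, add_zero, zero_add, sub_zero] at h
  exact h

lemma cubicW3B_one : cubicW3B 1 =
    3 * re2 0 π 0 0 + 6 * re2 (-(L / 2)) (π / 4) 0 0 + 1 * re2 (-L) 0 0 0 + 2 * re2 (-(L / 2))
    (-(π / 4)) 0 0
    - ((1 / 3 * L * π) * ((-L) ^ 0 * (π / 4) ^ 1) + (-L ^ 2 - 1 / 6 * π ^ 2) * ((-L) ^ 1 * (π /
      4) ^ 0) + (π) * ((-L) ^ 1 * (π / 4) ^ 1) + (-4 / 3) * ((-L) ^ 1 * (π / 4) ^ 2) + (1 / 3) *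
      ((-L) ^ 3 * (π / 4) ^ 0)) := by
  simp only [cubicW3B, cubicMonom_one, pathC1_one, pathC2_one, pathB1_one, pathB2_one]
  ring

/-- A closed combination of weight four. -/
noncomputable def cubicW4 (s : ℝ) : ℝ :=
    3 * pathA1 (re3 1 0) s + 6 * pathA2 (re3 1 0) s + (-6) * pathC1 (re3 1 0) s + (-12) * pathC2
    (re3 1 0) s + (-4) * pathB2 (re3 1 0) s + 2 * pathB1 (re3 1 0) s
    - ((1 / 4 * π ^ 3) * cubicMonom 0 0 1 s + (-2 * L ^ 2 - π ^ 2) * cubicMonom 0 0 2 s + (4 / 3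
      * π) * cubicMonom 0 0 3 s + (3 / 8 * L * π ^ 2 - 3 / 2 * L ^ 3) * cubicMonom 0 1 0 s + (-L
      * π) * cubicMonom 0 1 1 s + (-2 * L) * cubicMonom 0 1 2 s + (3 / 2 * L ^ 2 + 1 / 4 * π ^
      2) * cubicMonom 0 2 0 s + (-π) * cubicMonom 0 2 1 s + (7 / 2 * L) * cubicMonom 0 3 0 s +
      (3 / 2) * cubicMonom 0 4 0 s + (-L * π) * cubicMonom 1 0 1 s + (4 * L) * cubicMonom 1 0 2
      s + (3 / 2 * L ^ 2 + 1 / 8 * π ^ 2) * cubicMonom 1 1 0 s + (-2 * π) * cubicMonom 1 1 1 s +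
      (6) * cubicMonom 1 1 2 s + (3 * L) * cubicMonom 1 2 0 s + (3 / 2) * cubicMonom 1 3 0 s)

lemma hasDeriv_cubicW4 {s : ℝ} (hs : s ∈ cubicDom) : HasDerivWithinAt cubicW4
    0 cubicDom s := by
  have hA10 : HasDerivWithinAt (pathA1 (re3 1 0)) _ cubicDom s := (cubicPath_A1 hs).hasDeriv_re3 1 0
  have hA21 : HasDerivWithinAt (pathA2 (re3 1 0)) _ cubicDom s := (cubicPath_A2 hs).hasDeriv_re3 1 0
  have hC12 : HasDerivWithinAt (pathC1 (re3 1 0)) _ cubicDom s := (cubicPath_C1 hs).hasDeriv_re3 1 0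
  have hC23 : HasDerivWithinAt (pathC2 (re3 1 0)) _ cubicDom s := (cubicPath_C2 hs).hasDeriv_re3 1 0
  have hB24 : HasDerivWithinAt (pathB2 (re3 1 0)) _ cubicDom s := (cubicPath_B2 hs).hasDeriv_re3 1 0
  have hB15 : HasDerivWithinAt (pathB1 (re3 1 0)) _ cubicDom s := (cubicPath_B1 hs).hasDeriv_re3 1 0
  have hm := fun i j k => hasDeriv_cubicMonom hs i j k
  refine HasDerivWithinAt.congr_deriv
    (((((((hA10.const_mul 3).fun_add (hA21.const_mul 6)).fun_add (hC12.const_mul (-6))).fun_add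
    (hC23.const_mul (-12))).fun_add (hB24.const_mul (-4))).fun_add (hB15.const_mul 2)).fun_sub
    ((((((((((((((((((hm 0 0 1).const_mul (1 / 4 * π ^ 3)).fun_add ((hm 0 0 2).const_mul (-2 * L
    ^ 2 - π ^ 2))).fun_add ((hm 0 0 3).const_mul (4 / 3 * π))).fun_add ((hm 0 1 0).const_mul (3
    / 8 * L * π ^ 2 - 3 / 2 * L ^ 3))).fun_add ((hm 0 1 1).const_mul (-L * π))).fun_add ((hm 0 1
    2).const_mul (-2 * L))).fun_add ((hm 0 2 0).const_mul (3 / 2 * L ^ 2 + 1 / 4 * π ^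
    2))).fun_add ((hm 0 2 1).const_mul (-π))).fun_add ((hm 0 3 0).const_mul (7 / 2 *
    L))).fun_add ((hm 0 4 0).const_mul (3 / 2))).fun_add ((hm 1 0 1).const_mul (-L *
    π))).fun_add ((hm 1 0 2).const_mul (4 * L))).fun_add ((hm 1 1 0).const_mul (3 / 2 * L ^ 2 +
    1 / 8 * π ^ 2))).fun_add ((hm 1 1 1).const_mul (-2 * π))).fun_add ((hm 1 1 2).const_mul
    (6))).fun_add ((hm 1 2 0).const_mul (3 * L))).fun_add ((hm 1 3 0).const_mul (3 / 2)))) ?_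
  simp only [cubicM, cubicE, cubicK]
  generalize 2 * s / (1 + s ^ 2) = q'
  generalize -(2 * s) / (3 - s ^ 2) = p'
  generalize 1 / (1 + s ^ 2) = w'
  push_cast
  ring

lemma tendsto_cubicW4 :
    Tendsto cubicW4 (𝓝[<] √3) (𝓝 ((-4) * (re3 1 0) 0 0 (L / 2) (π / 4) + 2 * (re3 1 0) 0 0 L 0)) := by
  have ht := tendsto_cubicMonom
  have h :=
    ((((((((tendsto_pathA1 (decaysAtBot_re3 1 0)).const_mul 3).add ((tendsto_pathA2
    (decaysAtBot_re3 1 0)).const_mul 6)).add ((tendsto_pathC1 (decaysAtBot_re3 1 0)).const_mul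
    (-6))).add ((tendsto_pathC2 (decaysAtBot_re3 1 0)).const_mul (-12))).add ((tendsto_pathB2
    (continuousOnNonpos_re3 1 0)).const_mul (-4))).add ((tendsto_pathB1 (continuousOnNonpos_re3
    1 0)).const_mul 2)).sub ((((((((((((((((((ht 0 0 1 (by norm_num)).const_mul (1 / 4 * π ^
    3)).add ((ht 0 0 2 (by norm_num)).const_mul (-2 * L ^ 2 - π ^ 2))).add ((ht 0 0 3 (by
    norm_num)).const_mul (4 / 3 * π))).add ((ht 0 1 0 (by norm_num)).const_mul (3 / 8 * L * π ^
    2 - 3 / 2 * L ^ 3))).add ((ht 0 1 1 (by norm_num)).const_mul (-L * π))).add ((ht 0 1 2 (by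
    norm_num)).const_mul (-2 * L))).add ((ht 0 2 0 (by norm_num)).const_mul (3 / 2 * L ^ 2 + 1 /
    4 * π ^ 2))).add ((ht 0 2 1 (by norm_num)).const_mul (-π))).add ((ht 0 3 0 (by
    norm_num)).const_mul (7 / 2 * L))).add ((ht 0 4 0 (by norm_num)).const_mul (3 / 2))).add
    ((ht 1 0 1 (by norm_num)).const_mul (-L * π))).add ((ht 1 0 2 (by norm_num)).const_mul (4 *
    L))).add ((ht 1 1 0 (by norm_num)).const_mul (3 / 2 * L ^ 2 + 1 / 8 * π ^ 2))).add ((ht 1 1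
    1 (by norm_num)).const_mul (-2 * π))).add ((ht 1 1 2 (by norm_num)).const_mul (6))).add ((ht
    1 2 0 (by norm_num)).const_mul (3 * L))).add ((ht 1 3 0 (by norm_num)).const_mul (3 / 2))))
  simp only [mul_zero, add_zero, zero_add, sub_zero] at h
  exact h

lemma cubicW4_one : cubicW4 1 =
    3 * (re3 1 0) (-L) 0 0 0 + 6 * (re3 1 0) 0 (-(π / 2)) 0 0 + (-6) * (re3 1 0) 0 π 0 0 + (-12)
    * (re3 1 0) (-(L / 2)) (π / 4) 0 0 + (-4) * (re3 1 0) (-(L / 2)) (-(π / 4)) 0 0 + 2 * (re3 1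
    0) (-L) 0 0 0
    - ((1 / 4 * π ^ 3) * ((-L) ^ 0 * (π / 4) ^ 1) + (-2 * L ^ 2 - π ^ 2) * ((-L) ^ 0 * (π / 4) ^
      2) + (4 / 3 * π) * ((-L) ^ 0 * (π / 4) ^ 3) + (3 / 8 * L * π ^ 2 - 3 / 2 * L ^ 3) * ((-L)
      ^ 1 * (π / 4) ^ 0) + (-L * π) * ((-L) ^ 1 * (π / 4) ^ 1) + (-2 * L) * ((-L) ^ 1 * (π / 4)
      ^ 2) + (3 / 2 * L ^ 2 + 1 / 4 * π ^ 2) * ((-L) ^ 2 * (π / 4) ^ 0) + (-π) * ((-L) ^ 2 * (π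
      / 4) ^ 1) + (7 / 2 * L) * ((-L) ^ 3 * (π / 4) ^ 0) + (3 / 2) * ((-L) ^ 4 * (π / 4) ^ 0)) := by
  simp only [cubicW4, cubicMonom_one, pathA1_one, pathA2_one, pathC1_one, pathC2_one, pathB2_one, pathB1_one]
  ring

/-- A combination of weight five whose derivative is that of the generating series. -/
noncomputable def cubicW5 (s : ℝ) : ℝ :=
    (-(3 / 8)) * pathA1 re4 s + (-(3 / 4)) * pathA2 re4 s + (-(3 / 2)) * pathC1 re4 s + (-3) *
    pathC2 re4 s + (-(1 / 6)) * pathB1 re4 s + (-(1 / 3)) * pathB2 re4 s + 2 * pathC1 (re3 (-L)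
    0) s + 4 * pathC2 (re3 (L / 2) (π / 4)) s + (2 / 3) * pathB1 (re3 L 0) s + (4 / 3) * pathB2
    (re3 (L / 2) (π / 4)) s + (-1) * pathA1 (re3 (-L) 0) s + (-2) * pathA2 (re3 (L / 2) (π / 4))
    s
    - ((-5 / 72 * L * π ^ 3 - 1 / 18 * L ^ 3 * π) * cubicMonom 0 0 1 s + (1 / 8 * L * π ^ 2 + 1 /
      6 * L ^ 3) * cubicMonom 0 0 2 s + (1 / 9 * L) * cubicMonom 0 0 4 s + (-1 / 24 * L ^ 2 * π
      ^ 2 - 1 / 2 * L ^ 4 + 1 / 144 * π ^ 4) * cubicMonom 0 1 0 s + (-1 / 24 * π ^ 3) *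
      cubicMonom 0 1 1 s + (2 / 9 * π) * cubicMonom 0 1 3 s + (-1 / 32 * L * π ^ 2 + 7 / 24 * L
      ^ 3) * cubicMonom 0 2 0 s + (-1 / 6 * L) * cubicMonom 0 2 2 s + (2 / 3 * L ^ 2) *
      cubicMonom 0 3 0 s + (-1 / 18 * π) * cubicMonom 0 3 1 s + (1 / 16 * L) * cubicMonom 0 4 0
      s + (-2 / 15) * cubicMonom 0 5 0 s + (1 / 6 * L ^ 2 * π - 1 / 72 * π ^ 3) * cubicMonom 1 0
      1 s + (-1 / 3 * L ^ 2 + 1 / 12 * π ^ 2) * cubicMonom 1 0 2 s + (-4 / 9) * cubicMonom 1 0 4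
      s + (-1 / 24 * L * π ^ 2 + 1 / 2 * L ^ 3) * cubicMonom 1 1 0 s + (1 / 3 * L * π) *
      cubicMonom 1 1 1 s + (3 / 4 * L ^ 2 - 1 / 48 * π ^ 2) * cubicMonom 1 2 0 s + (2 / 3) *
      cubicMonom 1 2 2 s + (-1 / 4) * cubicMonom 1 4 0 s + (2 / 9) * cubicMonom 3 0 2 s + (-1 /
      6) * cubicMonom 3 2 0 s)

lemma hasDeriv_cubicW5 {s : ℝ} (hs : s ∈ cubicDom) : HasDerivWithinAt cubicW5
    (cubicM s ^ 3 / 18 * (3 * cubicE s * (2 * s / (1 + s ^ 2))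
      - 4 * cubicK s * (-(3 * (1 / (1 + s ^ 2)))))) cubicDom s := by
  have hA10 : HasDerivWithinAt (pathA1 re4) _ cubicDom s := (cubicPath_A1 hs).hasDeriv_re4
  have hA21 : HasDerivWithinAt (pathA2 re4) _ cubicDom s := (cubicPath_A2 hs).hasDeriv_re4
  have hC12 : HasDerivWithinAt (pathC1 re4) _ cubicDom s := (cubicPath_C1 hs).hasDeriv_re4
  have hC23 : HasDerivWithinAt (pathC2 re4) _ cubicDom s := (cubicPath_C2 hs).hasDeriv_re4
  have hB14 : HasDerivWithinAt (pathB1 re4) _ cubicDom s := (cubicPath_B1 hs).hasDeriv_re4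
  have hB25 : HasDerivWithinAt (pathB2 re4) _ cubicDom s := (cubicPath_B2 hs).hasDeriv_re4
  have hC16 : HasDerivWithinAt (pathC1 (re3 (-L) 0)) _ cubicDom s := (cubicPath_C1 hs).hasDeriv_re3 (-L) 0
  have hC27 : HasDerivWithinAt (pathC2 (re3 (L / 2) (π / 4))) _ cubicDom s := (cubicPath_C2 hs).hasDeriv_re3 (L / 2) (π / 4)
  have hB18 : HasDerivWithinAt (pathB1 (re3 L 0)) _ cubicDom s := (cubicPath_B1 hs).hasDeriv_re3 L 0
  have hB29 : HasDerivWithinAt (pathB2 (re3 (L / 2) (π / 4))) _ cubicDom s := (cubicPath_B2 hs).hasDeriv_re3 (L / 2) (π / 4)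
  have hA110 : HasDerivWithinAt (pathA1 (re3 (-L) 0)) _ cubicDom s := (cubicPath_A1 hs).hasDeriv_re3 (-L) 0
  have hA211 : HasDerivWithinAt (pathA2 (re3 (L / 2) (π / 4))) _ cubicDom s := (cubicPath_A2 hs).hasDeriv_re3 (L / 2) (π / 4)
  have hm := fun i j k => hasDeriv_cubicMonom hs i j k
  refine HasDerivWithinAt.congr_deriv
    (((((((((((((hA10.const_mul (-(3 / 8))).fun_add (hA21.const_mul (-(3 / 4)))).fun_add
    (hC12.const_mul (-(3 / 2)))).fun_add (hC23.const_mul (-3))).fun_add (hB14.const_mul (-(1 /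
    6)))).fun_add (hB25.const_mul (-(1 / 3)))).fun_add (hC16.const_mul 2)).fun_add
    (hC27.const_mul 4)).fun_add (hB18.const_mul (2 / 3))).fun_add (hB29.const_mul (4 /
    3))).fun_add (hA110.const_mul (-1))).fun_add (hA211.const_mul (-2))).fun_sub
    (((((((((((((((((((((((hm 0 0 1).const_mul (-5 / 72 * L * π ^ 3 - 1 / 18 * L ^ 3 *
    π)).fun_add ((hm 0 0 2).const_mul (1 / 8 * L * π ^ 2 + 1 / 6 * L ^ 3))).fun_add ((hm 0 0
    4).const_mul (1 / 9 * L))).fun_add ((hm 0 1 0).const_mul (-1 / 24 * L ^ 2 * π ^ 2 - 1 / 2 *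
    L ^ 4 + 1 / 144 * π ^ 4))).fun_add ((hm 0 1 1).const_mul (-1 / 24 * π ^ 3))).fun_add ((hm 0
    1 3).const_mul (2 / 9 * π))).fun_add ((hm 0 2 0).const_mul (-1 / 32 * L * π ^ 2 + 7 / 24 * L
    ^ 3))).fun_add ((hm 0 2 2).const_mul (-1 / 6 * L))).fun_add ((hm 0 3 0).const_mul (2 / 3 * L
    ^ 2))).fun_add ((hm 0 3 1).const_mul (-1 / 18 * π))).fun_add ((hm 0 4 0).const_mul (1 / 16 *
    L))).fun_add ((hm 0 5 0).const_mul (-2 / 15))).fun_add ((hm 1 0 1).const_mul (1 / 6 * L ^ 2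
    * π - 1 / 72 * π ^ 3))).fun_add ((hm 1 0 2).const_mul (-1 / 3 * L ^ 2 + 1 / 12 * π ^
    2))).fun_add ((hm 1 0 4).const_mul (-4 / 9))).fun_add ((hm 1 1 0).const_mul (-1 / 24 * L * π
    ^ 2 + 1 / 2 * L ^ 3))).fun_add ((hm 1 1 1).const_mul (1 / 3 * L * π))).fun_add ((hm 1 2
    0).const_mul (3 / 4 * L ^ 2 - 1 / 48 * π ^ 2))).fun_add ((hm 1 2 2).const_mul (2 /
    3))).fun_add ((hm 1 4 0).const_mul (-1 / 4))).fun_add ((hm 3 0 2).const_mul (2 /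
    9))).fun_add ((hm 3 2 0).const_mul (-1 / 6)))) ?_
  simp only [cubicM, cubicE, cubicK]
  generalize 2 * s / (1 + s ^ 2) = q'
  generalize -(2 * s) / (3 - s ^ 2) = p'
  generalize 1 / (1 + s ^ 2) = w'
  push_cast
  ring

lemma tendsto_cubicW5 :
    Tendsto cubicW5 (𝓝[<] √3) (𝓝 ((-(1 / 6)) * re4 0 0 L 0 + (-(1 / 3)) * re4 0 0 (L / 2) (π / 4) + (2 / 3) * (re3 L 0) 0 0 L 0 + (4 / 3) * (re3 (L / 2) (π / 4)) 0 0 (L / 2) (π / 4))) := by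
  have ht := tendsto_cubicMonom
  have h :=
    ((((((((((((((tendsto_pathA1 decaysAtBot_re4).const_mul (-(3 / 8))).add ((tendsto_pathA2
    decaysAtBot_re4).const_mul (-(3 / 4)))).add ((tendsto_pathC1 decaysAtBot_re4).const_mul (-(3
    / 2)))).add ((tendsto_pathC2 decaysAtBot_re4).const_mul (-3))).add ((tendsto_pathB1
    continuousOnNonpos_re4).const_mul (-(1 / 6)))).add ((tendsto_pathB2
    continuousOnNonpos_re4).const_mul (-(1 / 3)))).add ((tendsto_pathC1 (decaysAtBot_re3 (-L)
    0)).const_mul 2)).add ((tendsto_pathC2 (decaysAtBot_re3 (L / 2) (π / 4))).const_mul 4)).add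
    ((tendsto_pathB1 (continuousOnNonpos_re3 L 0)).const_mul (2 / 3))).add ((tendsto_pathB2
    (continuousOnNonpos_re3 (L / 2) (π / 4))).const_mul (4 / 3))).add ((tendsto_pathA1
    (decaysAtBot_re3 (-L) 0)).const_mul (-1))).add ((tendsto_pathA2 (decaysAtBot_re3 (L / 2) (π
    / 4))).const_mul (-2))).sub (((((((((((((((((((((((ht 0 0 1 (by norm_num)).const_mul (-5 /
    72 * L * π ^ 3 - 1 / 18 * L ^ 3 * π)).add ((ht 0 0 2 (by norm_num)).const_mul (1 / 8 * L * π
    ^ 2 + 1 / 6 * L ^ 3))).add ((ht 0 0 4 (by norm_num)).const_mul (1 / 9 * L))).add ((ht 0 1 0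
    (by norm_num)).const_mul (-1 / 24 * L ^ 2 * π ^ 2 - 1 / 2 * L ^ 4 + 1 / 144 * π ^ 4))).add
    ((ht 0 1 1 (by norm_num)).const_mul (-1 / 24 * π ^ 3))).add ((ht 0 1 3 (by
    norm_num)).const_mul (2 / 9 * π))).add ((ht 0 2 0 (by norm_num)).const_mul (-1 / 32 * L * π
    ^ 2 + 7 / 24 * L ^ 3))).add ((ht 0 2 2 (by norm_num)).const_mul (-1 / 6 * L))).add ((ht 0 3
    0 (by norm_num)).const_mul (2 / 3 * L ^ 2))).add ((ht 0 3 1 (by norm_num)).const_mul (-1 /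
    18 * π))).add ((ht 0 4 0 (by norm_num)).const_mul (1 / 16 * L))).add ((ht 0 5 0 (by
    norm_num)).const_mul (-2 / 15))).add ((ht 1 0 1 (by norm_num)).const_mul (1 / 6 * L ^ 2 * π
    - 1 / 72 * π ^ 3))).add ((ht 1 0 2 (by norm_num)).const_mul (-1 / 3 * L ^ 2 + 1 / 12 * π ^
    2))).add ((ht 1 0 4 (by norm_num)).const_mul (-4 / 9))).add ((ht 1 1 0 (by
    norm_num)).const_mul (-1 / 24 * L * π ^ 2 + 1 / 2 * L ^ 3))).add ((ht 1 1 1 (by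
    norm_num)).const_mul (1 / 3 * L * π))).add ((ht 1 2 0 (by norm_num)).const_mul (3 / 4 * L ^
    2 - 1 / 48 * π ^ 2))).add ((ht 1 2 2 (by norm_num)).const_mul (2 / 3))).add ((ht 1 4 0 (by
    norm_num)).const_mul (-1 / 4))).add ((ht 3 0 2 (by norm_num)).const_mul (2 / 9))).add ((ht 3
    2 0 (by norm_num)).const_mul (-1 / 6))))
  simp only [mul_zero, add_zero, zero_add, sub_zero] at h
  exact h

lemma cubicW5_one : cubicW5 1 =
    (-(3 / 8)) * re4 (-L) 0 0 0 + (-(3 / 4)) * re4 0 (-(π / 2)) 0 0 + (-(3 / 2)) * re4 0 π 0 0 +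
    (-3) * re4 (-(L / 2)) (π / 4) 0 0 + (-(1 / 6)) * re4 (-L) 0 0 0 + (-(1 / 3)) * re4 (-(L /
    2)) (-(π / 4)) 0 0 + 2 * (re3 (-L) 0) 0 π 0 0 + 4 * (re3 (L / 2) (π / 4)) (-(L / 2)) (π / 4)
    0 0 + (2 / 3) * (re3 L 0) (-L) 0 0 0 + (4 / 3) * (re3 (L / 2) (π / 4)) (-(L / 2)) (-(π / 4))
    0 0 + (-1) * (re3 (-L) 0) (-L) 0 0 0 + (-2) * (re3 (L / 2) (π / 4)) 0 (-(π / 2)) 0 0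
    - ((-5 / 72 * L * π ^ 3 - 1 / 18 * L ^ 3 * π) * ((-L) ^ 0 * (π / 4) ^ 1) + (1 / 8 * L * π ^ 2
      + 1 / 6 * L ^ 3) * ((-L) ^ 0 * (π / 4) ^ 2) + (1 / 9 * L) * ((-L) ^ 0 * (π / 4) ^ 4) + (-1
      / 24 * L ^ 2 * π ^ 2 - 1 / 2 * L ^ 4 + 1 / 144 * π ^ 4) * ((-L) ^ 1 * (π / 4) ^ 0) + (-1 /
      24 * π ^ 3) * ((-L) ^ 1 * (π / 4) ^ 1) + (2 / 9 * π) * ((-L) ^ 1 * (π / 4) ^ 3) + (-1 / 32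
      * L * π ^ 2 + 7 / 24 * L ^ 3) * ((-L) ^ 2 * (π / 4) ^ 0) + (-1 / 6 * L) * ((-L) ^ 2 * (π /
      4) ^ 2) + (2 / 3 * L ^ 2) * ((-L) ^ 3 * (π / 4) ^ 0) + (-1 / 18 * π) * ((-L) ^ 3 * (π / 4)
      ^ 1) + (1 / 16 * L) * ((-L) ^ 4 * (π / 4) ^ 0) + (-2 / 15) * ((-L) ^ 5 * (π / 4) ^ 0)) := by
  simp only [cubicW5, cubicMonom_one, pathA1_one, pathA2_one, pathC1_one, pathC2_one, pathB1_one, pathB2_one]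
  ring

end CubicRelations

section BinomialSeries

lemma integral_pow_mul_one_sub_pow (a b : ℕ) :
    ∫ x in (0 : ℝ)..1, x ^ a * (1 - x) ^ b
      = (a.factorial : ℝ) * b.factorial / (a + b + 1).factorial := by
  have h := Complex.betaIntegral_eq_Gamma_mul_div (a + 1) (b + 1)
    (by simp; positivity) (by simp; positivity)
  rw [show (a + 1 + (b + 1) : ℂ) = ((a + b + 1 : ℕ) : ℂ) + 1 by push_cast; ring,
    Complex.Gamma_nat_eq_factorial, Complex.Gamma_nat_eq_factorial,
    Complex.Gamma_nat_eq_factorial, Complex.betaIntegral] at h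
  simp only [add_sub_cancel_right, Complex.cpow_natCast] at h
  apply Complex.ofReal_injective
  rw [← intervalIntegral.integral_ofReal]
  push_cast
  exact h

/-- The series `∑_{n ≥ 1} zⁿ / (n ^ k C(3n, n))`. -/
noncomputable def binomSeries (k : ℕ) (z : ℝ) : ℝ :=
  ∑' n : ℕ, z ^ (n + 1) / (((n + 1 : ℕ) : ℝ) ^ k * (Nat.choose (3 * (n + 1)) (n + 1) : ℝ))

lemma one_le_choose_three_mul (n : ℕ) : (1 : ℝ) ≤ (Nat.choose (3 * (n + 1)) (n + 1) : ℝ) := by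
  exact_mod_cast Nat.choose_pos (by omega)

lemma one_le_binomSeries_denom (k n : ℕ) :
    (1 : ℝ) ≤ ((n + 1 : ℕ) : ℝ) ^ k * (Nat.choose (3 * (n + 1)) (n + 1) : ℝ) :=
  one_le_mul_of_one_le_of_one_le (one_le_pow₀ (by exact_mod_cast Nat.succ_pos n))
    (one_le_choose_three_mul n)

lemma abs_binomSeries_le (k : ℕ) {z : ℝ} (h0 : 0 ≤ z) (hz : z ≤ 1 / 2) :
    |binomSeries k z| ≤ 2 * z := by
  have hg := (hasSum_geometric_of_lt_one h0 (by linarith : z < 1)).mul_left z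
  refine (tsum_of_norm_bounded (f := fun n : ℕ => z ^ (n + 1) / (((n + 1 : ℕ) : ℝ) ^ k *
    (Nat.choose (3 * (n + 1)) (n + 1) : ℝ))) hg fun n => ?_).trans ?_
  · rw [Real.norm_of_nonneg (by positivity), ← pow_succ']
    exact div_le_self (by positivity) (one_le_binomSeries_denom k n)
  · rw [← div_eq_mul_inv, div_le_iff₀ (by linarith)]
    nlinarith

lemma hasDerivAt_binomSeries (k : ℕ) {z : ℝ} (hz : |z| < 1) (h0 : z ≠ 0) :
    HasDerivAt (binomSeries (k + 1)) (binomSeries k z / z) z := by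
  obtain ⟨r, hzr, hr⟩ := exists_between hz
  have hr0 : 0 < r := (abs_nonneg z).trans_lt hzr
  have h : HasDerivAt (binomSeries (k + 1)) (∑' n : ℕ, z ^ n / (((n + 1 : ℕ) : ℝ) ^ k *
      (Nat.choose (3 * (n + 1)) (n + 1) : ℝ))) z := by
    refine hasDerivAt_tsum_of_isPreconnected (u := fun n : ℕ => r ^ n)
      (t := Metric.ball (0 : ℝ) r) (y₀ := 0) (summable_geometric_of_lt_one hr0.le hr)
      Metric.isOpen_ball (convex_ball _ _).isPreconnected
      (g := fun (n : ℕ) (z : ℝ) => z ^ (n + 1) / (((n + 1 : ℕ) : ℝ) ^ (k + 1) *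
        (Nat.choose (3 * (n + 1)) (n + 1) : ℝ)))
      (g' := fun (n : ℕ) (z : ℝ) => z ^ n / (((n + 1 : ℕ) : ℝ) ^ k *
        (Nat.choose (3 * (n + 1)) (n + 1) : ℝ))) ?_ ?_ (by simpa using hr0) ?_ (by simpa using hzr)
    · intro n y _
      have hn : ((n + 1 : ℕ) : ℝ) ≠ 0 := Nat.cast_ne_zero.2 (by omega)
      have hc := (zero_lt_one.trans_le (one_le_choose_three_mul n)).ne'
      refine ((hasDerivAt_pow (n + 1) y).div_const _).congr_deriv ?_
      rw [Nat.add_sub_cancel]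
      field_simp
      ring
    · intro n y hy
      have hy' : ‖y‖ ≤ r := by simpa using (Metric.mem_ball.1 hy).le
      rw [norm_div, norm_pow, Real.norm_of_nonneg (zero_le_one.trans (one_le_binomSeries_denom k n))]
      exact (div_le_self (by positivity) (one_le_binomSeries_denom k n)).trans (by gcongr)
    · simp [summable_zero]
  refine h.congr_deriv ?_
  rw [binomSeries, ← tsum_div_const]
  congr 1
  ext n
  field_simp
  ring

lemma mul_sq_one_sub_le_one {x : ℝ} (hx : x ∈ Icc (0 : ℝ) 1) : x * (1 - x) ^ 2 ≤ 1 := by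
  have h1 : (1 - x) ^ 2 ≤ 1 := pow_le_one₀ (by linarith [hx.2]) (by linarith [hx.1])
  exact mul_le_one₀ hx.2 (by positivity) h1

/-- Integral representation of the series of weight one. -/
lemma binomSeries_one {z : ℝ} (h0 : 0 ≤ z) (hz : z < 1) :
    binomSeries 1 z = ∫ x in (0 : ℝ)..1, z * (1 - x) ^ 2 / (1 - z * (x * (1 - x) ^ 2)) := by
  have h := intervalIntegral.hasSum_integral_of_dominated_convergence (a := 0) (b := 1)
    (μ := MeasureTheory.volume)
    (F := fun (n : ℕ) (x : ℝ) => z * (1 - x) ^ 2 * (z * (x * (1 - x) ^ 2)) ^ n)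
    (f := fun x => z * (1 - x) ^ 2 / (1 - z * (x * (1 - x) ^ 2)))
    (fun n _ => z * z ^ n) ?_ ?_ ?_ ?_ ?_
  · rw [← h.tsum_eq, binomSeries]
    congr 1
    ext n
    have h1 : (fun x : ℝ => z * (1 - x) ^ 2 * (z * (x * (1 - x) ^ 2)) ^ n)
        = fun x => z ^ (n + 1) * (x ^ n * (1 - x) ^ (2 * (n + 1))) := by
      ext x; rw [mul_pow, mul_pow, ← pow_mul]; ring
    rw [h1, intervalIntegral.integral_const_mul, integral_pow_mul_one_sub_pow]
    have h2 := Nat.choose_mul_factorial_mul_factorial (show n + 1 ≤ 3 * (n + 1) by omega)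
    rw [show 3 * (n + 1) - (n + 1) = 2 * (n + 1) by omega] at h2
    rw [show n + 2 * (n + 1) + 1 = 3 * (n + 1) by ring, ← h2, Nat.factorial_succ n]
    have hc := (zero_lt_one.trans_le (one_le_choose_three_mul n)).ne'
    have hf : (n.factorial : ℝ) ≠ 0 := by positivity
    have hf2 : ((2 * (n + 1)).factorial : ℝ) ≠ 0 := by positivity
    push_cast at hc ⊢
    field_simp
  · intro n
    exact (by fun_prop : Continuous fun x : ℝ => z * (1 - x) ^ 2 * (z * (x * (1 - x) ^ 2)) ^ n).aestronglyMeasurable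
  · refine fun n => .of_forall fun x hx => ?_
    rw [uIoc_of_le zero_le_one] at hx
    have h1 : (1 - x) ^ 2 ≤ 1 := pow_le_one₀ (by linarith [hx.2]) (by linarith [hx.1])
    have h2 := mul_sq_one_sub_le_one ⟨hx.1.le, hx.2⟩
    have hx0 := hx.1.le
    rw [Real.norm_of_nonneg (by positivity)]
    exact mul_le_mul (mul_le_of_le_one_right h0 h1)
      (pow_le_pow_left₀ (by positivity) (mul_le_of_le_one_right h0 h2) n) (by positivity) h0
  · exact .of_forall fun x _ => (summable_geometric_of_lt_one h0 hz).mul_left z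
  · exact intervalIntegrable_const
  · refine .of_forall fun x hx => ?_
    rw [uIoc_of_le zero_le_one] at hx
    have h2 := mul_sq_one_sub_le_one ⟨hx.1.le, hx.2⟩
    have hx0 := hx.1.le
    exact (hasSum_geometric_of_lt_one (by positivity)
      ((mul_le_of_le_one_right h0 h2).trans_lt hz)).mul_left (z * (1 - x) ^ 2)

end BinomialSeries

section BinomialSeriesCubic

local notation "L" => Real.log 2
local notation "π" => Real.pi

/-- The argument of the binomial series along the cubic path. -/
noncomputable def cubicZ (s : ℝ) : ℝ := (3 - s ^ 2) ^ 3 / (4 * (1 + s ^ 2) ^ 2)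

lemma cubicZ_pos {s : ℝ} (hs : s ∈ cubicDom) : 0 < cubicZ s := by
  have := sq_lt_three hs
  exact div_pos (pow_pos (by linarith) 3) (by positivity)

lemma cubicZ_le {s : ℝ} (hs : s ∈ cubicDom) : cubicZ s ≤ 1 / 2 := by
  have h1 := one_le_sq hs
  have h3 := sq_lt_three hs
  rw [cubicZ, div_le_iff₀ (by positivity)]
  have h2 : (3 - s ^ 2) ^ 3 ≤ 2 ^ 3 := pow_le_pow_left₀ (by linarith) (by linarith) 3
  nlinarith

lemma hasDeriv_cubicZ {s : ℝ} (hs : s ∈ cubicDom) : HasDerivWithinAt cubicZ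
    (cubicZ s * (3 * (-(2 * s) / (3 - s ^ 2)) - 2 * (2 * s / (1 + s ^ 2)))) cubicDom s := by
  have h3 : 3 - s ^ 2 ≠ 0 := by linarith [sq_lt_three hs]
  have h1 : 1 + s ^ 2 ≠ 0 := by positivity
  have h := ((((hasDerivAt_pow 2 s).const_sub 3).pow 3).div
    ((((hasDerivAt_pow 2 s).const_add 1).pow 2).const_mul 4) (by simp; positivity))
  refine h.hasDerivWithinAt.congr_deriv ?_
  simp only [cubicZ, Pi.pow_apply]
  field_simp
  ring

lemma cubicDenom_ne_zero {s : ℝ} (hs : s ∈ cubicDom) (x : ℝ) :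
    (1 + s * Complex.I : ℂ) ^ 2 - (3 - s ^ 2) * x ≠ 0 := by
  intro h
  have := congrArg Complex.im h
  simp [pow_two] at this
  exact (cubicDom_pos hs).ne' (by linarith)

/-- Partial fractions for the integrand of the series of weight one. -/
lemma cubic_partial_fractions {s : ℝ} (hs : s ∈ cubicDom) {x : ℝ} (hx : x ∈ Icc (0 : ℝ) 1) :
    (1 + s ^ 2) / (9 + s ^ 2) * ((3 - s ^ 2) / (4 - (3 - s ^ 2) * x))
      + 2 * (Complex.I * (1 - s * Complex.I) / (s * (3 + s * Complex.I))
        * ((3 - s ^ 2) / ((1 + s * Complex.I) ^ 2 - (3 - s ^ 2) * x))).re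
      = cubicZ s * (1 - x) ^ 2 / (1 - cubicZ s * (x * (1 - x) ^ 2)) := by
  have h1 := one_le_sq hs
  have h3 := sq_lt_three hs
  have hs0 := cubicDom_pos hs
  have hD : 0 < (1 - s ^ 2 - (3 - s ^ 2) * x) ^ 2 + 4 * s ^ 2 := by positivity
  have h4 : 0 < 4 - (3 - s ^ 2) * x := by nlinarith [hx.1, hx.2]
  have hd := cubicDenom_ne_zero hs x
  have hsI : (3 + s * Complex.I : ℂ) ≠ 0 := fun h => by simpa using congrArg Complex.re h
  have hre : Complex.I * (1 - s * Complex.I) / (s * (3 + s * Complex.I))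
        * ((3 - s ^ 2) / ((1 + s * Complex.I) ^ 2 - (3 - s ^ 2) * x))
      = (((3 - s ^ 2) * (s * (4 * (1 - s ^ 2 - (3 - s ^ 2) * x) + 2 * (3 - s ^ 2)))
          / (s * (9 + s ^ 2) * ((1 - s ^ 2 - (3 - s ^ 2) * x) ^ 2 + 4 * s ^ 2)) : ℝ) : ℂ)
        + (((3 - s ^ 2) * ((3 - s ^ 2) * (1 - s ^ 2 - (3 - s ^ 2) * x) - 8 * s ^ 2)
          / (s * (9 + s ^ 2) * ((1 - s ^ 2 - (3 - s ^ 2) * x) ^ 2 + 4 * s ^ 2)) : ℝ) : ℂ)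
          * Complex.I := by
    have hs0' : (s : ℂ) ≠ 0 := by exact_mod_cast hs0.ne'
    have h9 : (9 + s ^ 2 : ℂ) ≠ 0 := by
      exact_mod_cast (by positivity : 9 + s ^ 2 ≠ 0)
    have hD' : ((1 - s ^ 2 - (3 - s ^ 2) * x) ^ 2 + 4 * s ^ 2 : ℂ) ≠ 0 := by
      exact_mod_cast hD.ne'
    push_cast
    rw [div_mul_div_comm, div_mul_eq_mul_div, ← add_div, div_eq_div_iff (by positivity) (by positivity)]
    refine Complex.ext ?_ ?_
    · simp [pow_two]
      ring
    · simp [pow_two]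
      ring
  have hden : (1 - cubicZ s * (x * (1 - x) ^ 2)) * (4 * (1 + s ^ 2) ^ 2)
      = (4 - (3 - s ^ 2) * x) * ((1 - s ^ 2 - (3 - s ^ 2) * x) ^ 2 + 4 * s ^ 2) := by
    rw [cubicZ]
    field_simp
    ring
  have hZ : cubicZ s * (4 * (1 + s ^ 2) ^ 2) = (3 - s ^ 2) ^ 3 := by
    rw [cubicZ]
    field_simp
  rw [hre, Complex.add_re, Complex.ofReal_re, Complex.re_ofReal_mul, Complex.I_re, mul_zero, add_zero,
    ← mul_div_mul_right (cubicZ s * (1 - x) ^ 2) _ (by positivity : 4 * (1 + s ^ 2) ^ 2 ≠ 0), hden,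
    mul_right_comm (cubicZ s), hZ]
  field_simp
  ring

/-- The series of weight one along the cubic path. -/
lemma binomSeries_one_cubicZ {s : ℝ} (hs : s ∈ cubicDom) :
    binomSeries 1 (cubicZ s) = -((1 + s ^ 2) / (9 + s ^ 2) * cubicE s
      + 2 * (Complex.I * (1 - s * Complex.I) / (s * (3 + s * Complex.I))
        * (-(cubicE s / 2 : ℝ) + cubicK s * Complex.I)).re) := by
  have h3 := sq_lt_three hs
  set u : ℂ := (3 - s ^ 2) / (1 + s * Complex.I) ^ 2 with hu
  have hs1 := one_add_mul_I_ne_zero s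
  have hslit : ∀ x ∈ Icc (0 : ℝ) 1, 1 - u * x ∈ Complex.slitPlane := by
    intro x hx
    refine one_sub_mem_slitPlane ?_ fun h => cubicDenom_ne_zero hs x ?_
    · rw [hu, norm_mul, norm_div, norm_pow, Complex.norm_real, Real.norm_of_nonneg hx.1,
        ← Complex.normSq_eq_norm_sq,
        show (3 - s ^ 2 : ℂ) = ((3 - s ^ 2 : ℝ) : ℂ) by push_cast; rfl, Complex.norm_real,
        Real.norm_of_nonneg (by linarith)]
      refine mul_le_one₀ ((div_le_one ?_).2 ?_) hx.1 hx.2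
      · exact Complex.normSq_pos.2 hs1
      · simp [Complex.normSq_apply]
        nlinarith [one_le_sq hs]
    · rw [hu, div_mul_eq_mul_div, div_eq_one_iff_eq (pow_ne_zero 2 hs1)] at h
      rw [h, sub_self]
  have hderiv : ∀ x ∈ uIcc (0 : ℝ) 1, HasDerivAt
      (fun x : ℝ => -((1 + s ^ 2) / (9 + s ^ 2) * Real.log (1 - (3 - s ^ 2) / 4 * x)
        + 2 * (Complex.I * (1 - s * Complex.I) / (s * (3 + s * Complex.I))
          * Complex.log (1 - u * x)).re))
      (cubicZ s * (1 - x) ^ 2 / (1 - cubicZ s * (x * (1 - x) ^ 2))) x := by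
    intro x hx
    rw [uIcc_of_le zero_le_one] at hx
    have h4 : 0 < 4 - (3 - s ^ 2) * x := by nlinarith [hx.1, hx.2]
    have hr := (((hasDerivAt_id x).const_mul ((3 - s ^ 2) / 4)).const_sub 1).log
      (by simp only [id]; linarith : 1 - (3 - s ^ 2) / 4 * id x ≠ 0)
    have hc := (((Complex.ofRealCLM.hasDerivAt (x := x)).const_mul u).const_sub 1).clog_real
      (hslit x hx)
    have hc' := Complex.reCLM.hasFDerivAt.comp_hasDerivAt x
      (hc.const_mul (Complex.I * (1 - s * Complex.I) / (s * (3 + s * Complex.I))))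
    rw [← cubic_partial_fractions hs hx]
    refine ((hr.const_mul ((1 + s ^ 2) / (9 + s ^ 2))).add (hc'.const_mul 2)).neg.congr_deriv ?_
    have hu' : -(u * Complex.ofRealCLM 1) / (1 - u * x)
        = -((3 - s ^ 2) / ((1 + s * Complex.I) ^ 2 - (3 - s ^ 2) * x)) := by
      have := cubicDenom_ne_zero hs x
      have h1 : (1 - u * x) * (1 + s * Complex.I) ^ 2
          = (1 + s * Complex.I) ^ 2 - (3 - s ^ 2) * x := by rw [hu]; field_simp
      rw [← h1, hu]
      have := Complex.slitPlane_ne_zero (hslit x hx)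
      rw [hu] at this
      simp only [Complex.ofRealCLM_apply, Complex.ofReal_one]
      field_simp
    simp only [Complex.ofRealCLM_apply] at hu' ⊢
    rw [hu', mul_neg, map_neg, Complex.reCLM_apply]
    have : 1 - (3 - s ^ 2) / 4 * x = (4 - (3 - s ^ 2) * x) / 4 := by ring
    simp only [id]
    rw [this]
    field_simp
    ring
  have hexp : Complex.exp ((cubicP s - cubicQ s : ℝ) + (-(2 * Real.arctan s) : ℝ) * Complex.I)
      = u := by
    rw [show ((cubicP s - cubicQ s : ℝ) + (-(2 * Real.arctan s) : ℝ) * Complex.I : ℂ)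
      = cubicP s - (cubicQ s / 2 + Real.arctan s * Complex.I)
        - (cubicQ s / 2 + Real.arctan s * Complex.I) by push_cast; ring, Complex.exp_sub,
      Complex.exp_sub, exp_cubicP hs, exp_half_cubicQ_add_arctan, hu]
    field_simp
  have hlog := (cubicPath_A2 hs).log_eq
  rw [hexp] at hlog
  have hlog' : Real.log (1 - (3 - s ^ 2) / 4) = cubicE s := by
    rw [show 1 - (3 - s ^ 2) / 4 = (1 + s ^ 2) / 4 by ring,
      Real.log_div (by positivity) (by norm_num), log_four_eq, cubicE, cubicQ]
  rw [binomSeries_one (cubicZ_pos hs).le (by linarith [cubicZ_le hs]),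
    intervalIntegral.integral_eq_sub_of_hasDerivAt hderiv ?_]
  · simp only [Complex.ofReal_one, Complex.ofReal_zero, mul_one, mul_zero, sub_zero, hlog, hlog',
      Complex.log_one, Real.log_one, Complex.zero_re, add_zero, neg_zero, cubicE, cubicK]
    congr 6
    push_cast
    ring
  · refine ContinuousOn.intervalIntegrable fun x hx => ContinuousAt.continuousWithinAt ?_
    rw [uIcc_of_le zero_le_one] at hx
    have h2 := mul_sq_one_sub_le_one hx
    have h0 : 1 - cubicZ s * (x * (1 - x) ^ 2) ≠ 0 := by
      nlinarith [mul_le_of_le_one_right (cubicZ_pos hs).le h2, cubicZ_le hs]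
    fun_prop (disch := assumption)

lemma binomSeries_one_cubicZ_mul {s : ℝ} (hs : s ∈ cubicDom) :
    binomSeries 1 (cubicZ s) * (3 * (-(2 * s) / (3 - s ^ 2)) - 2 * (2 * s / (1 + s ^ 2)))
      = -(cubicE s * (2 * s / (1 + s ^ 2)))
        + 4 / 3 * (cubicK s * (-(3 * (1 / (1 + s ^ 2))))) := by
  have h3 : 3 - s ^ 2 ≠ 0 := by linarith [sq_lt_three hs]
  have hs0 := (cubicDom_pos hs).ne'
  have hw : Complex.I * (1 - s * Complex.I) / (s * (3 + s * Complex.I))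
      = ((4 / (9 + s ^ 2) : ℝ) : ℂ) + ((3 - s ^ 2) / (s * (9 + s ^ 2)) : ℝ) * Complex.I := by
    have hs0' : (s : ℂ) ≠ 0 := by exact_mod_cast hs0
    have h9 : (9 + s ^ 2 : ℂ) ≠ 0 := by exact_mod_cast (by positivity : 9 + s ^ 2 ≠ 0)
    have hsI : (3 + s * Complex.I : ℂ) ≠ 0 := fun h => by simpa using congrArg Complex.re h
    push_cast
    rw [div_mul_eq_mul_div, div_add_div _ _ h9 (mul_ne_zero hs0' h9),
      div_eq_div_iff (mul_ne_zero hs0' hsI) (mul_ne_zero h9 (mul_ne_zero hs0' h9))]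
    refine Complex.ext ?_ ?_
    · simp [pow_two]
      ring
    · simp [pow_two]
      ring
  rw [binomSeries_one_cubicZ hs, hw]
  simp only [Complex.mul_re, Complex.add_re, Complex.add_im, Complex.neg_re, Complex.neg_im,
    Complex.mul_im, Complex.ofReal_re, Complex.ofReal_im, Complex.I_re, Complex.I_im]
  field_simp
  ring

/-- The generating series along the cubic path. -/
noncomputable def cubicT (s : ℝ) : ℝ :=
  binomSeries 5 (cubicZ s) - cubicM s * binomSeries 4 (cubicZ s)
    + cubicM s ^ 2 / 2 * binomSeries 3 (cubicZ s) - cubicM s ^ 3 / 6 * binomSeries 2 (cubicZ s)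

lemma hasDeriv_cubicT {s : ℝ} (hs : s ∈ cubicDom) : HasDerivWithinAt cubicT
    (cubicM s ^ 3 / 18 * (3 * cubicE s * (2 * s / (1 + s ^ 2))
      - 4 * cubicK s * (-(3 * (1 / (1 + s ^ 2)))))) cubicDom s := by
  have hz := cubicZ_pos hs
  have hZ := hasDeriv_cubicZ hs
  have hM := hasDeriv_cubicM hs
  have hS : ∀ k, HasDerivWithinAt (fun s => binomSeries (k + 1) (cubicZ s))
      (binomSeries k (cubicZ s)
        * (3 * (-(2 * s) / (3 - s ^ 2)) - 2 * (2 * s / (1 + s ^ 2)))) cubicDom s := fun k => by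
    refine ((hasDerivAt_binomSeries k (by rw [abs_of_pos hz]; linarith [cubicZ_le hs])
      hz.ne').comp_hasDerivWithinAt s hZ).congr_deriv ?_
    field_simp
  refine ((((hS 4).fun_sub (hM.fun_mul (hS 3))).fun_add
    (((hM.fun_pow 2).div_const 2).fun_mul (hS 2))).fun_sub
    (((hM.fun_pow 3).div_const 6).fun_mul (hS 1))).congr_deriv ?_
  have h := binomSeries_one_cubicZ_mul hs
  push_cast
  linear_combination -(cubicM s ^ 3 / 6) * h

lemma tendsto_cubicT : Tendsto cubicT (𝓝[<] √3) (𝓝 0) := by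
  have hO : ∀ k, (fun s => binomSeries k (cubicZ s)) =O[𝓝[<] √3] fun s => 3 - s ^ 2 := fun k => by
    refine Asymptotics.IsBigO.of_bound 2 ?_
    filter_upwards [tendsto_cubicDom] with s hs
    have h1 := one_le_sq hs
    have h3 := sq_lt_three hs
    rw [Real.norm_of_nonneg (by linarith : 0 ≤ 3 - s ^ 2)]
    refine (abs_binomSeries_le k (cubicZ_pos hs).le (cubicZ_le hs)).trans ?_
    gcongr
    rw [cubicZ, div_le_iff₀ (by positivity)]
    have h2 : (3 - s ^ 2) ^ 2 ≤ 2 ^ 2 := pow_le_pow_left₀ (by linarith) (by linarith) 2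
    nlinarith [mul_le_mul_of_nonneg_left h2 (by linarith : 0 ≤ 3 - s ^ 2)]
  have h := fun k i => tendsto_cubicM_pow_mul (hO k) i
  have ht := (((h 5 0).sub (h 4 1)).add ((h 3 2).div_const 2)).sub ((h 2 3).div_const 6)
  simp only [pow_zero, one_mul, pow_one, zero_div, sub_zero, add_zero] at ht
  refine ht.congr fun s => ?_
  rw [cubicT]
  ring

lemma cubicT_one : cubicT 1 = binomSeries 5 (1 / 2) := by
  have hM : cubicM 1 = 0 := by norm_num [cubicM, cubicP, cubicQ]; ring
  have hZ : cubicZ 1 = 1 / 2 := by norm_num [cubicZ]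
  rw [cubicT, hM, hZ]
  ring

/-- The binomial sum in terms of polylogarithms. -/
lemma binomSeries_five_half : binomSeries 5 (1 / 2) = cubicW5 1
    - ((-(1 / 6)) * re4 0 0 L 0 + (-(1 / 3)) * re4 0 0 (L / 2) (π / 4)
      + 2 / 3 * (re3 L 0) 0 0 L 0 + 4 / 3 * (re3 (L / 2) (π / 4)) 0 0 (L / 2) (π / 4)) := by
  have h := eq_of_hasDerivWithinAt_zero_of_tendsto convex_cubicDom
    (fun s hs => ((hasDeriv_cubicW5 hs).fun_sub (hasDeriv_cubicT hs)).congr_deriv (sub_self _))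
    one_mem_cubicDom tendsto_cubicDom (tendsto_cubicW5.sub tendsto_cubicT)
  rw [cubicT_one] at h
  linarith

end BinomialSeriesCubic

section OctahedralRelation

local notation "L" => Real.log 2
local notation "π" => Real.pi

/-- The logarithm of the modulus of `1 + i y`. -/
noncomputable def octR (y : ℝ) : ℝ := Real.log (1 + y ^ 2) / 2

/-- Real part of a logarithm along the octahedral path. -/
noncomputable def octA (i j l y : ℝ) : ℝ := i * Real.log y + j * octR y + l * L

/-- Imaginary part of a logarithm along the octahedral path. -/
noncomputable def octB (t q y : ℝ) : ℝ := t * Real.arctan y + q * π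

/-- Combination of polylogarithms of weight five along the octahedral path. -/
noncomputable def octTerm (i j l t p q y : ℝ) : ℝ :=
  re4 (octA i j l y) (octB t p y) (octA i j l y) (octB t q y)

/-- The derivative of `octTerm`. -/
noncomputable def octDeriv (i j l t q c d y : ℝ) : ℝ :=
  4 * ((octA i j l y ^ 3 - 3 * octA i j l y * octB t q y ^ 2)
      * ((i * (1 / y) + j * (y / (1 + y ^ 2))) * c - t * (1 / (1 + y ^ 2)) * d)
    - (3 * octA i j l y ^ 2 * octB t q y - octB t q y ^ 3)
      * ((i * (1 / y) + j * (y / (1 + y ^ 2))) * d + t * (1 / (1 + y ^ 2)) * c))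

lemma hasDeriv_octR (y : ℝ) (S : Set ℝ) : HasDerivWithinAt octR (y / (1 + y ^ 2)) S y := by
  have h := (((hasDerivAt_pow 2 y).const_add 1).log (by positivity)).div_const 2
  refine h.hasDerivWithinAt.congr_deriv ?_
  norm_num
  field_simp

lemma hasDeriv_log {y : ℝ} (hy : y ∈ Ioo (0 : ℝ) 1) (S : Set ℝ) :
    HasDerivWithinAt Real.log (1 / y) S y := by
  rw [one_div]
  exact (Real.hasDerivAt_log hy.1.ne').hasDerivWithinAt

lemma hasDeriv_octA (i j l : ℝ) {y : ℝ} (hy : y ∈ Ioo (0 : ℝ) 1) (S : Set ℝ) :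
    HasDerivWithinAt (octA i j l) (i * (1 / y) + j * (y / (1 + y ^ 2))) S y :=
  (((hasDeriv_log hy S).const_mul i).fun_add ((hasDeriv_octR y S).const_mul j)).add_const _

lemma hasDeriv_octB (t q y : ℝ) (S : Set ℝ) :
    HasDerivWithinAt (octB t q) (t * (1 / (1 + y ^ 2))) S y :=
  ((hasDeriv_arctan S).const_mul t).add_const _

lemma hasDeriv_octTerm {i j l t p q c d y : ℝ} {S : Set ℝ} (hS : S ⊆ Ioo 0 1) (hy : y ∈ S)
    (h0 : ∀ x ∈ S, octA i j l x ≤ 0)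
    (hexp : Complex.exp (c + d * Complex.I)
      = 1 - Complex.exp (octA i j l y + octB t p y * Complex.I)) (hd : -π < d) (hd' : d ≤ π) :
    HasDerivWithinAt (octTerm i j l t p q) (octDeriv i j l t q c d y) S y :=
  LogPath.hasDeriv_re4 (a := octA i j l) (θ := octB t p) (m := octA i j l) (b := octB t q)
    ⟨hy, h0, hasDeriv_octA i j l (hS hy) S, hasDeriv_octB t p y S, hasDeriv_octA i j l (hS hy) S,
      hasDeriv_octB t q y S, hexp, hd, hd'⟩

lemma octR_nonneg (y : ℝ) : 0 ≤ octR y :=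
  div_nonneg (Real.log_nonneg (by nlinarith [sq_nonneg y])) zero_le_two

lemma two_mul_octR_le {y : ℝ} (hy : y ∈ Ioo (0 : ℝ) 1) : 2 * octR y ≤ L := by
  have : octR y * 2 = Real.log (1 + y ^ 2) := div_mul_cancel₀ _ two_ne_zero
  rw [mul_comm, this]
  exact Real.log_le_log (by positivity) (by nlinarith [hy.1, hy.2])

lemma log_add_le_two_mul_octR {y : ℝ} (hy : y ∈ Ioo (0 : ℝ) 1) :
    L + Real.log y ≤ 2 * octR y := by
  have : octR y * 2 = Real.log (1 + y ^ 2) := div_mul_cancel₀ _ two_ne_zero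
  rw [mul_comm 2, this, ← Real.log_mul two_ne_zero hy.1.ne']
  exact Real.log_le_log (by linarith [hy.1]) (by nlinarith [sq_nonneg (1 - y)])

lemma log_nonpos_of_mem {y : ℝ} (hy : y ∈ Ioo (0 : ℝ) 1) : Real.log y ≤ 0 :=
  Real.log_nonpos hy.1.le hy.2.le

lemma arctan_mem_Ioo {y : ℝ} (hy : y ∈ Ioo (0 : ℝ) 1) :
    0 < Real.arctan y ∧ Real.arctan y < π / 4 := by
  rw [← Real.arctan_zero, ← Real.arctan_one]
  exact ⟨Real.arctan_strictMono hy.1, Real.arctan_strictMono hy.2⟩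

lemma exp_ofReal_log {x : ℝ} (hx : 0 < x) : Complex.exp (Real.log x) = x := by
  rw [← Complex.ofReal_exp, Real.exp_log hx]

lemma exp_pi_div_two_mul_I : Complex.exp (π / 2 * Complex.I) = Complex.I := by
  have := exp_zero_add_pi_div_two
  push_cast at this
  rwa [zero_add] at this

/-- Exponentials of the letters of the octahedral path. -/
lemma exp_octahedral_letters {y : ℝ} (hy : y ∈ Ioo (0 : ℝ) 1) : ∃ p q g : ℂ,
    p = 1 + y * Complex.I ∧ q = 1 - y * Complex.I ∧ g = 1 + Complex.I ∧ p ≠ 0 ∧ q ≠ 0 ∧ g ≠ 0 ∧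
    (y : ℂ) ≠ 0 ∧
    Complex.exp (octR y + Real.arctan y * Complex.I) = p ∧
    Complex.exp (octR y - Real.arctan y * Complex.I) = q ∧
    Complex.exp (L / 2 + π / 4 * Complex.I) = g ∧
    Complex.exp (Real.log y) = y ∧ Complex.exp (Real.log (1 - y) : ℝ) = 1 - y ∧
    Complex.exp (Real.log (1 + y) : ℝ) = 1 + y := by
  have h1 := exp_half_cubicQ_add_arctan y
  have h2 := exp_half_cubicQ_sub_arctan y
  have h3 := exp_half_cubicQ_add_arctan 1
  rw [cubicQ, Real.arctan_one, show (1 + 1 ^ 2 : ℝ) = 2 by norm_num] at h3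
  refine ⟨_, _, _, rfl, rfl, rfl, one_add_mul_I_ne_zero y, one_sub_mul_I_ne_zero y, ?_,
    by exact_mod_cast hy.1.ne', ?_, ?_, ?_, exp_ofReal_log hy.1, ?_, ?_⟩
  · simpa using one_add_mul_I_ne_zero 1
  · rw [← h1, octR, cubicQ]; push_cast; rfl
  · rw [← h2, octR, cubicQ]; push_cast; rfl
  · rw [Complex.ofReal_one, one_mul] at h3
    rw [← h3]; push_cast; rfl
  · rw [exp_ofReal_log (by linarith [hy.2])]; push_cast; rfl
  · rw [exp_ofReal_log (by linarith [hy.1])]; push_cast; rfl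

lemma hasDeriv_octTerm_t1 {y : ℝ} (hy : y ∈ Ioo (0 : ℝ) 1) :
    HasDerivWithinAt (octTerm 0 (-1) 0 1 0 (-(1 / 4)))
      (octDeriv 0 (-1) 0 1 (-(1 / 4))
        (Real.log y - octR y)
        (Real.arctan y - 1 / 2 * π) y) (Ioo 0 1) y := by
  have hα := arctan_mem_Ioo hy
  refine hasDeriv_octTerm subset_rfl hy (fun x hx => ?_) ?_ (by linarith) (by linarith)
  · rw [octA]
    linarith [octR_nonneg x, two_mul_octR_le hx, log_add_le_two_mul_octR hx, log_nonpos_of_mem hx]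
  · obtain ⟨p, q, g, hp, hq, hg, hp0, hq0, hg0, hy0, hP, hQ, hG, hY, hU, hW⟩ :=
      exp_octahedral_letters hy
    rw [octA, octB, show ((Real.log y - octR y : ℝ) : ℂ)
        + (Real.arctan y - 1 / 2 * π : ℝ) * Complex.I
        = Real.log y - (octR y - Real.arctan y * Complex.I) - π / 2 * Complex.I by
      push_cast; ring,
      show ((0 * Real.log y + (-1) * octR y + 0 * L : ℝ) : ℂ)
        + (1 * Real.arctan y + 0 * π : ℝ) * Complex.I
        = 0 - (octR y - Real.arctan y * Complex.I) by
      push_cast; ring]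
    simp only [Complex.exp_add, Complex.exp_sub, Complex.exp_zero, exp_pi_div_two_mul_I, exp_log_two,
      hP, hQ, hG, hY, hU, hW]
    field_simp
    try simp only [hp, hq, hg]
    refine Complex.ext ?_ ?_ <;>
    · simp [pow_succ]
      try ring

lemma hasDeriv_octTerm_t2 {y : ℝ} (hy : y ∈ Ioo (0 : ℝ) 1) :
    HasDerivWithinAt (octTerm 1 (-1) 0 (-1) (1 / 2) (1 / 4))
      (octDeriv 1 (-1) 0 (-1) (1 / 4)
        (-octR y)
        (-Real.arctan y) y) (Ioo 0 1) y := by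
  have hα := arctan_mem_Ioo hy
  refine hasDeriv_octTerm subset_rfl hy (fun x hx => ?_) ?_ (by linarith) (by linarith)
  · rw [octA]
    linarith [octR_nonneg x, two_mul_octR_le hx, log_add_le_two_mul_octR hx, log_nonpos_of_mem hx]
  · obtain ⟨p, q, g, hp, hq, hg, hp0, hq0, hg0, hy0, hP, hQ, hG, hY, hU, hW⟩ :=
      exp_octahedral_letters hy
    rw [octA, octB, show ((-octR y : ℝ) : ℂ)
        + (-Real.arctan y : ℝ) * Complex.I
        = 0 - (octR y + Real.arctan y * Complex.I) by
      push_cast; ring,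
      show ((1 * Real.log y + (-1) * octR y + 0 * L : ℝ) : ℂ)
        + ((-1) * Real.arctan y + (1 / 2) * π : ℝ) * Complex.I
        = Real.log y + π / 2 * Complex.I - (octR y + Real.arctan y * Complex.I) by
      push_cast; ring]
    simp only [Complex.exp_add, Complex.exp_sub, Complex.exp_zero, exp_pi_div_two_mul_I, exp_log_two,
      hP, hQ, hG, hY, hU, hW]
    field_simp
    try simp only [hp, hq, hg]
    refine Complex.ext ?_ ?_ <;>
    · simp [pow_succ]
      try ring

lemma hasDeriv_octTerm_t3 {y : ℝ} (hy : y ∈ Ioo (0 : ℝ) 1) :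
    HasDerivWithinAt (octTerm 0 1 (-1) (-1) 0 (1 / 4))
      (octDeriv 0 1 (-1) (-1) (1 / 4)
        (-L + octR y)
        (Real.arctan y) y) (Ioo 0 1) y := by
  have hα := arctan_mem_Ioo hy
  refine hasDeriv_octTerm subset_rfl hy (fun x hx => ?_) ?_ (by linarith) (by linarith)
  · rw [octA]
    linarith [octR_nonneg x, two_mul_octR_le hx, log_add_le_two_mul_octR hx, log_nonpos_of_mem hx]
  · obtain ⟨p, q, g, hp, hq, hg, hp0, hq0, hg0, hy0, hP, hQ, hG, hY, hU, hW⟩ :=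
      exp_octahedral_letters hy
    rw [octA, octB, show ((-L + octR y : ℝ) : ℂ)
        + (Real.arctan y : ℝ) * Complex.I
        = (octR y + Real.arctan y * Complex.I) - L by
      push_cast; ring,
      show ((0 * Real.log y + 1 * octR y + (-1) * L : ℝ) : ℂ)
        + ((-1) * Real.arctan y + 0 * π : ℝ) * Complex.I
        = (octR y - Real.arctan y * Complex.I) - L by
      push_cast; ring]
    simp only [Complex.exp_add, Complex.exp_sub, Complex.exp_zero, exp_pi_div_two_mul_I, exp_log_two,
      hP, hQ, hG, hY, hU, hW]
    field_simp
    try simp only [hp, hq, hg]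
    refine Complex.ext ?_ ?_ <;>
    · simp [pow_succ]
      try ring

lemma hasDeriv_octTerm_t4a {y : ℝ} {S : Set ℝ} (hS : S ⊆ Ioo 0 1) (hy : y ∈ S)
    (h0 : ∀ x ∈ S, octA 1 (-1) 1 x ≤ 0) :
    HasDerivWithinAt (octTerm 1 (-1) 1 (-1) (1 / 2) (1 / 4))
      (octDeriv 1 (-1) 1 (-1) (1 / 4)
        (0)
        (-2 * Real.arctan y) y) S y := by
  have hα := arctan_mem_Ioo (hS hy)
  refine hasDeriv_octTerm hS hy h0 ?_ (by linarith) (by linarith)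
  · obtain ⟨p, q, g, hp, hq, hg, hp0, hq0, hg0, hy0, hP, hQ, hG, hY, hU, hW⟩ :=
      exp_octahedral_letters (hS hy)
    rw [octA, octB, show ((0 : ℝ) : ℂ)
        + (-2 * Real.arctan y : ℝ) * Complex.I
        = (octR y - Real.arctan y * Complex.I) - (octR y + Real.arctan y * Complex.I) by
      push_cast; ring,
      show ((1 * Real.log y + (-1) * octR y + 1 * L : ℝ) : ℂ)
        + ((-1) * Real.arctan y + (1 / 2) * π : ℝ) * Complex.I
        = Real.log y + L + π / 2 * Complex.I - (octR y + Real.arctan y * Complex.I) by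
      push_cast; ring]
    simp only [Complex.exp_add, Complex.exp_sub, Complex.exp_zero, exp_pi_div_two_mul_I, exp_log_two,
      hP, hQ, hG, hY, hU, hW]
    field_simp
    try simp only [hp, hq, hg]
    refine Complex.ext ?_ ?_ <;>
    · simp [pow_succ]
      try ring

lemma hasDeriv_octTerm_t4b {y : ℝ} {S : Set ℝ} (hS : S ⊆ Ioo 0 1) (hy : y ∈ S)
    (h0 : ∀ x ∈ S, octA (-1) 1 (-1) x ≤ 0) :
    HasDerivWithinAt (octTerm (-1) 1 (-1) 1 (-(1 / 2)) (-(1 / 4)))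
      (octDeriv (-1) 1 (-1) 1 (-(1 / 4))
        (-L - Real.log y + octR y)
        (-Real.arctan y + 1 / 2 * π) y) S y := by
  have hα := arctan_mem_Ioo (hS hy)
  refine hasDeriv_octTerm hS hy h0 ?_ (by linarith) (by linarith)
  · obtain ⟨p, q, g, hp, hq, hg, hp0, hq0, hg0, hy0, hP, hQ, hG, hY, hU, hW⟩ :=
      exp_octahedral_letters (hS hy)
    rw [octA, octB, show ((-L - Real.log y + octR y : ℝ) : ℂ)
        + (-Real.arctan y + 1 / 2 * π : ℝ) * Complex.I
        = (octR y - Real.arctan y * Complex.I) + π / 2 * Complex.I - Real.log y - L by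
      push_cast; ring,
      show (((-1) * Real.log y + 1 * octR y + (-1) * L : ℝ) : ℂ)
        + (1 * Real.arctan y + (-(1 / 2)) * π : ℝ) * Complex.I
        = (octR y + Real.arctan y * Complex.I) - Real.log y - L - π / 2 * Complex.I by
      push_cast; ring]
    simp only [Complex.exp_add, Complex.exp_sub, Complex.exp_zero, exp_pi_div_two_mul_I, exp_log_two,
      hP, hQ, hG, hY, hU, hW]
    field_simp
    try simp only [hp, hq, hg]
    refine Complex.ext ?_ ?_ <;>
    · simp [pow_succ]
      try ring

lemma hasDeriv_octTerm_t5 {y : ℝ} (hy : y ∈ Ioo (0 : ℝ) 1) :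
    HasDerivWithinAt (octTerm 0 0 0 (-4) 0 1)
      (octDeriv 0 0 0 (-4) 1
        (2 * L + Real.log y - 2 * octR y)
        (-2 * Real.arctan y + 1 / 2 * π) y) (Ioo 0 1) y := by
  have hα := arctan_mem_Ioo hy
  refine hasDeriv_octTerm subset_rfl hy (fun x hx => ?_) ?_ (by linarith) (by linarith)
  · rw [octA]
    linarith [octR_nonneg x, two_mul_octR_le hx, log_add_le_two_mul_octR hx, log_nonpos_of_mem hx]
  · obtain ⟨p, q, g, hp, hq, hg, hp0, hq0, hg0, hy0, hP, hQ, hG, hY, hU, hW⟩ :=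
      exp_octahedral_letters hy
    rw [octA, octB, show ((2 * L + Real.log y - 2 * octR y : ℝ) : ℂ)
        + (-2 * Real.arctan y + 1 / 2 * π : ℝ) * Complex.I
        = Real.log y + L + L + π / 2 * Complex.I - (octR y + Real.arctan y * Complex.I) - (octR y + Real.arctan y * Complex.I) by
      push_cast; ring,
      show ((0 * Real.log y + 0 * octR y + 0 * L : ℝ) : ℂ)
        + ((-4) * Real.arctan y + 0 * π : ℝ) * Complex.I
        = (octR y - Real.arctan y * Complex.I) + (octR y - Real.arctan y * Complex.I) - (octR y + Real.arctan y * Complex.I) - (octR y + Real.arctan y * Complex.I) by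
      push_cast; ring]
    simp only [Complex.exp_add, Complex.exp_sub, Complex.exp_zero, exp_pi_div_two_mul_I, exp_log_two,
      hP, hQ, hG, hY, hU, hW]
    field_simp
    try simp only [hp, hq, hg]
    refine Complex.ext ?_ ?_ <;>
    · simp [pow_succ]
      try ring

lemma hasDeriv_octTerm_t6 {y : ℝ} (hy : y ∈ Ioo (0 : ℝ) 1) :
    HasDerivWithinAt (octTerm 2 0 0 0 1 0)
      (octDeriv 2 0 0 0 0
        (2 * octR y)
        (0) y) (Ioo 0 1) y := by
  have hα := arctan_mem_Ioo hy
  refine hasDeriv_octTerm subset_rfl hy (fun x hx => ?_) ?_ (by linarith) (by linarith)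
  · rw [octA]
    linarith [octR_nonneg x, two_mul_octR_le hx, log_add_le_two_mul_octR hx, log_nonpos_of_mem hx]
  · obtain ⟨p, q, g, hp, hq, hg, hp0, hq0, hg0, hy0, hP, hQ, hG, hY, hU, hW⟩ :=
      exp_octahedral_letters hy
    rw [octA, octB, show ((2 * octR y : ℝ) : ℂ)
        + (0 : ℝ) * Complex.I
        = (octR y + Real.arctan y * Complex.I) + (octR y - Real.arctan y * Complex.I) by
      push_cast; ring,
      show ((2 * Real.log y + 0 * octR y + 0 * L : ℝ) : ℂ)
        + (0 * Real.arctan y + 1 * π : ℝ) * Complex.I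
        = Real.log y + Real.log y + π / 2 * Complex.I + π / 2 * Complex.I by
      push_cast; ring]
    simp only [Complex.exp_add, Complex.exp_sub, Complex.exp_zero, exp_pi_div_two_mul_I, exp_log_two,
      hP, hQ, hG, hY, hU, hW]
    field_simp
    try simp only [hp, hq, hg]
    refine Complex.ext ?_ ?_ <;>
    · simp [pow_succ]
      try ring

lemma hasDeriv_octTerm_t7 {y : ℝ} (hy : y ∈ Ioo (0 : ℝ) 1) :
    HasDerivWithinAt (octTerm 1 0 0 (-2) (1 / 2) (1 / 2))
      (octDeriv 1 0 0 (-2) (1 / 2)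
        (Real.log (1 - y) + Real.log (1 + y) - octR y)
        (-Real.arctan y) y) (Ioo 0 1) y := by
  have hα := arctan_mem_Ioo hy
  refine hasDeriv_octTerm subset_rfl hy (fun x hx => ?_) ?_ (by linarith) (by linarith)
  · rw [octA]
    linarith [octR_nonneg x, two_mul_octR_le hx, log_add_le_two_mul_octR hx, log_nonpos_of_mem hx]
  · obtain ⟨p, q, g, hp, hq, hg, hp0, hq0, hg0, hy0, hP, hQ, hG, hY, hU, hW⟩ :=
      exp_octahedral_letters hy
    rw [octA, octB, show ((Real.log (1 - y) + Real.log (1 + y) - octR y : ℝ) : ℂ)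
        + (-Real.arctan y : ℝ) * Complex.I
        = (Real.log (1 - y) : ℝ) + (Real.log (1 + y) : ℝ) - (octR y + Real.arctan y * Complex.I) by
      push_cast; ring,
      show ((1 * Real.log y + 0 * octR y + 0 * L : ℝ) : ℂ)
        + ((-2) * Real.arctan y + (1 / 2) * π : ℝ) * Complex.I
        = Real.log y + (octR y - Real.arctan y * Complex.I) + π / 2 * Complex.I - (octR y + Real.arctan y * Complex.I) by
      push_cast; ring]
    simp only [Complex.exp_add, Complex.exp_sub, Complex.exp_zero, exp_pi_div_two_mul_I, exp_log_two,
      hP, hQ, hG, hY, hU, hW]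
    field_simp
    try simp only [hp, hq, hg]
    refine Complex.ext ?_ ?_ <;>
    · simp [pow_succ]
      try ring

lemma hasDeriv_octTerm_t8 {y : ℝ} (hy : y ∈ Ioo (0 : ℝ) 1) :
    HasDerivWithinAt (octTerm 1 (-2) 1 2 (-(1 / 2)) (-(1 / 2)))
      (octDeriv 1 (-2) 1 2 (-(1 / 2))
        (Real.log (1 - y) + Real.log (1 + y) - 2 * octR y)
        (2 * Real.arctan y) y) (Ioo 0 1) y := by
  have hα := arctan_mem_Ioo hy
  refine hasDeriv_octTerm subset_rfl hy (fun x hx => ?_) ?_ (by linarith) (by linarith)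
  · rw [octA]
    linarith [octR_nonneg x, two_mul_octR_le hx, log_add_le_two_mul_octR hx, log_nonpos_of_mem hx]
  · obtain ⟨p, q, g, hp, hq, hg, hp0, hq0, hg0, hy0, hP, hQ, hG, hY, hU, hW⟩ :=
      exp_octahedral_letters hy
    rw [octA, octB, show ((Real.log (1 - y) + Real.log (1 + y) - 2 * octR y : ℝ) : ℂ)
        + (2 * Real.arctan y : ℝ) * Complex.I
        = (Real.log (1 - y) : ℝ) + (Real.log (1 + y) : ℝ) - (octR y - Real.arctan y * Complex.I) - (octR y - Real.arctan y * Complex.I) by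
      push_cast; ring,
      show ((1 * Real.log y + (-2) * octR y + 1 * L : ℝ) : ℂ)
        + (2 * Real.arctan y + (-(1 / 2)) * π : ℝ) * Complex.I
        = Real.log y + L - (octR y - Real.arctan y * Complex.I) - (octR y - Real.arctan y * Complex.I) - π / 2 * Complex.I by
      push_cast; ring]
    simp only [Complex.exp_add, Complex.exp_sub, Complex.exp_zero, exp_pi_div_two_mul_I, exp_log_two,
      hP, hQ, hG, hY, hU, hW]
    field_simp
    try simp only [hp, hq, hg]
    refine Complex.ext ?_ ?_ <;>
    · simp [pow_succ]
      try ring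

lemma hasDeriv_octTerm_t9a {y : ℝ} (hy : y ∈ Ioo (0 : ℝ) 1) :
    HasDerivWithinAt (octTerm 2 (-2) 1 0 0 0)
      (octDeriv 2 (-2) 1 0 0
        (Real.log (1 - y) + Real.log (1 + y) - 2 * octR y)
        (0) y) (Ioo 0 1) y := by
  have hα := arctan_mem_Ioo hy
  refine hasDeriv_octTerm subset_rfl hy (fun x hx => ?_) ?_ (by linarith) (by linarith)
  · rw [octA]
    linarith [octR_nonneg x, two_mul_octR_le hx, log_add_le_two_mul_octR hx, log_nonpos_of_mem hx]
  · obtain ⟨p, q, g, hp, hq, hg, hp0, hq0, hg0, hy0, hP, hQ, hG, hY, hU, hW⟩ :=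
      exp_octahedral_letters hy
    rw [octA, octB, show ((Real.log (1 - y) + Real.log (1 + y) - 2 * octR y : ℝ) : ℂ)
        + (0 : ℝ) * Complex.I
        = (Real.log (1 - y) : ℝ) + (Real.log (1 + y) : ℝ) - (octR y + Real.arctan y * Complex.I) - (octR y - Real.arctan y * Complex.I) by
      push_cast; ring,
      show ((2 * Real.log y + (-2) * octR y + 1 * L : ℝ) : ℂ)
        + (0 * Real.arctan y + 0 * π : ℝ) * Complex.I
        = Real.log y + Real.log y + L - (octR y + Real.arctan y * Complex.I) - (octR y - Real.arctan y * Complex.I) by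
      push_cast; ring]
    simp only [Complex.exp_add, Complex.exp_sub, Complex.exp_zero, exp_pi_div_two_mul_I, exp_log_two,
      hP, hQ, hG, hY, hU, hW]
    field_simp
    try simp only [hp, hq, hg]
    refine Complex.ext ?_ ?_ <;>
    · simp [pow_succ]
      try ring

lemma hasDeriv_octTerm_t9b {y : ℝ} (hy : y ∈ Ioo (0 : ℝ) 1) :
    HasDerivWithinAt (octTerm 0 2 (-1) 0 0 0)
      (octDeriv 0 2 (-1) 0 0
        (-L + Real.log (1 - y) + Real.log (1 + y))
        (0) y) (Ioo 0 1) y := by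
  have hα := arctan_mem_Ioo hy
  refine hasDeriv_octTerm subset_rfl hy (fun x hx => ?_) ?_ (by linarith) (by linarith)
  · rw [octA]
    linarith [octR_nonneg x, two_mul_octR_le hx, log_add_le_two_mul_octR hx, log_nonpos_of_mem hx]
  · obtain ⟨p, q, g, hp, hq, hg, hp0, hq0, hg0, hy0, hP, hQ, hG, hY, hU, hW⟩ :=
      exp_octahedral_letters hy
    rw [octA, octB, show ((-L + Real.log (1 - y) + Real.log (1 + y) : ℝ) : ℂ)
        + (0 : ℝ) * Complex.I
        = (Real.log (1 - y) : ℝ) + (Real.log (1 + y) : ℝ) - L by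
      push_cast; ring,
      show ((0 * Real.log y + 2 * octR y + (-1) * L : ℝ) : ℂ)
        + (0 * Real.arctan y + 0 * π : ℝ) * Complex.I
        = (octR y + Real.arctan y * Complex.I) + (octR y - Real.arctan y * Complex.I) - L by
      push_cast; ring]
    simp only [Complex.exp_add, Complex.exp_sub, Complex.exp_zero, exp_pi_div_two_mul_I, exp_log_two,
      hP, hQ, hG, hY, hU, hW]
    field_simp
    try simp only [hp, hq, hg]
    refine Complex.ext ?_ ?_ <;>
    · simp [pow_succ]
      try ring

lemma hasDeriv_octTerm_t10 {y : ℝ} (hy : y ∈ Ioo (0 : ℝ) 1) :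
    HasDerivWithinAt (octTerm 0 0 0 (-4) 1 1)
      (octDeriv 0 0 0 (-4) 1
        (L + Real.log (1 - y) + Real.log (1 + y) - 2 * octR y)
        (-2 * Real.arctan y) y) (Ioo 0 1) y := by
  have hα := arctan_mem_Ioo hy
  refine hasDeriv_octTerm subset_rfl hy (fun x hx => ?_) ?_ (by linarith) (by linarith)
  · rw [octA]
    linarith [octR_nonneg x, two_mul_octR_le hx, log_add_le_two_mul_octR hx, log_nonpos_of_mem hx]
  · obtain ⟨p, q, g, hp, hq, hg, hp0, hq0, hg0, hy0, hP, hQ, hG, hY, hU, hW⟩ :=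
      exp_octahedral_letters hy
    rw [octA, octB, show ((L + Real.log (1 - y) + Real.log (1 + y) - 2 * octR y : ℝ) : ℂ)
        + (-2 * Real.arctan y : ℝ) * Complex.I
        = (Real.log (1 - y) : ℝ) + (Real.log (1 + y) : ℝ) + L - (octR y + Real.arctan y * Complex.I) - (octR y + Real.arctan y * Complex.I) by
      push_cast; ring,
      show ((0 * Real.log y + 0 * octR y + 0 * L : ℝ) : ℂ)
        + ((-4) * Real.arctan y + 1 * π : ℝ) * Complex.I
        = (octR y - Real.arctan y * Complex.I) + (octR y - Real.arctan y * Complex.I) + π / 2 * Complex.I + π / 2 * Complex.I - (octR y + Real.arctan y * Complex.I) - (octR y + Real.arctan y * Complex.I) by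
      push_cast; ring]
    simp only [Complex.exp_add, Complex.exp_sub, Complex.exp_zero, exp_pi_div_two_mul_I, exp_log_two,
      hP, hQ, hG, hY, hU, hW]
    field_simp
    try simp only [hp, hq, hg]
    refine Complex.ext ?_ ?_ <;>
    · simp [pow_succ]
      try ring

lemma hasDeriv_octTerm_t11 {y : ℝ} (hy : y ∈ Ioo (0 : ℝ) 1) :
    HasDerivWithinAt (octTerm 2 0 0 0 0 0)
      (octDeriv 2 0 0 0 0
        (Real.log (1 - y) + Real.log (1 + y))
        (0) y) (Ioo 0 1) y := by
  have hα := arctan_mem_Ioo hy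
  refine hasDeriv_octTerm subset_rfl hy (fun x hx => ?_) ?_ (by linarith) (by linarith)
  · rw [octA]
    linarith [octR_nonneg x, two_mul_octR_le hx, log_add_le_two_mul_octR hx, log_nonpos_of_mem hx]
  · obtain ⟨p, q, g, hp, hq, hg, hp0, hq0, hg0, hy0, hP, hQ, hG, hY, hU, hW⟩ :=
      exp_octahedral_letters hy
    rw [octA, octB, show ((Real.log (1 - y) + Real.log (1 + y) : ℝ) : ℂ)
        + (0 : ℝ) * Complex.I
        = (Real.log (1 - y) : ℝ) + (Real.log (1 + y) : ℝ) by
      push_cast; ring,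
      show ((2 * Real.log y + 0 * octR y + 0 * L : ℝ) : ℂ)
        + (0 * Real.arctan y + 0 * π : ℝ) * Complex.I
        = Real.log y + Real.log y by
      push_cast; ring]
    simp only [Complex.exp_add, Complex.exp_sub, Complex.exp_zero, exp_pi_div_two_mul_I, exp_log_two,
      hP, hQ, hG, hY, hU, hW]
    field_simp
    try simp only [hp, hq, hg]
    refine Complex.ext ?_ ?_ <;>
    · simp [pow_succ]
      try ring

lemma hasDeriv_octTerm_t12a {y : ℝ} (hy : y ∈ Ioo (0 : ℝ) 1) :
    HasDerivWithinAt (octTerm 0 (-2) 0 0 0 0)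
      (octDeriv 0 (-2) 0 0 0
        (2 * Real.log y - 2 * octR y)
        (0) y) (Ioo 0 1) y := by
  have hα := arctan_mem_Ioo hy
  refine hasDeriv_octTerm subset_rfl hy (fun x hx => ?_) ?_ (by linarith) (by linarith)
  · rw [octA]
    linarith [octR_nonneg x, two_mul_octR_le hx, log_add_le_two_mul_octR hx, log_nonpos_of_mem hx]
  · obtain ⟨p, q, g, hp, hq, hg, hp0, hq0, hg0, hy0, hP, hQ, hG, hY, hU, hW⟩ :=
      exp_octahedral_letters hy
    rw [octA, octB, show ((2 * Real.log y - 2 * octR y : ℝ) : ℂ)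
        + (0 : ℝ) * Complex.I
        = Real.log y + Real.log y - (octR y + Real.arctan y * Complex.I) - (octR y - Real.arctan y * Complex.I) by
      push_cast; ring,
      show ((0 * Real.log y + (-2) * octR y + 0 * L : ℝ) : ℂ)
        + (0 * Real.arctan y + 0 * π : ℝ) * Complex.I
        = 0 - (octR y + Real.arctan y * Complex.I) - (octR y - Real.arctan y * Complex.I) by
      push_cast; ring]
    simp only [Complex.exp_add, Complex.exp_sub, Complex.exp_zero, exp_pi_div_two_mul_I, exp_log_two,
      hP, hQ, hG, hY, hU, hW]
    field_simp
    try simp only [hp, hq, hg]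
    refine Complex.ext ?_ ?_ <;>
    · simp [pow_succ]
      try ring

lemma hasDeriv_octTerm_t12b {y : ℝ} (hy : y ∈ Ioo (0 : ℝ) 1) :
    HasDerivWithinAt (octTerm 2 (-2) 0 0 0 0)
      (octDeriv 2 (-2) 0 0 0
        (-2 * octR y)
        (0) y) (Ioo 0 1) y := by
  have hα := arctan_mem_Ioo hy
  refine hasDeriv_octTerm subset_rfl hy (fun x hx => ?_) ?_ (by linarith) (by linarith)
  · rw [octA]
    linarith [octR_nonneg x, two_mul_octR_le hx, log_add_le_two_mul_octR hx, log_nonpos_of_mem hx]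
  · obtain ⟨p, q, g, hp, hq, hg, hp0, hq0, hg0, hy0, hP, hQ, hG, hY, hU, hW⟩ :=
      exp_octahedral_letters hy
    rw [octA, octB, show ((-2 * octR y : ℝ) : ℂ)
        + (0 : ℝ) * Complex.I
        = 0 - (octR y + Real.arctan y * Complex.I) - (octR y - Real.arctan y * Complex.I) by
      push_cast; ring,
      show ((2 * Real.log y + (-2) * octR y + 0 * L : ℝ) : ℂ)
        + (0 * Real.arctan y + 0 * π : ℝ) * Complex.I
        = Real.log y + Real.log y - (octR y + Real.arctan y * Complex.I) - (octR y - Real.arctan y * Complex.I) by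
      push_cast; ring]
    simp only [Complex.exp_add, Complex.exp_sub, Complex.exp_zero, exp_pi_div_two_mul_I, exp_log_two,
      hP, hQ, hG, hY, hU, hW]
    field_simp
    try simp only [hp, hq, hg]
    refine Complex.ext ?_ ?_ <;>
    · simp [pow_succ]
      try ring

lemma hasDeriv_octTerm_t13a {y : ℝ} {S : Set ℝ} (hS : S ⊆ Ioo 0 1) (hy : y ∈ S)
    (h0 : ∀ x ∈ S, octA 1 (-2) 2 x ≤ 0) :
    HasDerivWithinAt (octTerm 1 (-2) 2 (-2) (1 / 2) (1 / 2))
      (octDeriv 1 (-2) 2 (-2) (1 / 2)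
        (0)
        (-4 * Real.arctan y) y) S y := by
  have hα := arctan_mem_Ioo (hS hy)
  refine hasDeriv_octTerm hS hy h0 ?_ (by linarith) (by linarith)
  · obtain ⟨p, q, g, hp, hq, hg, hp0, hq0, hg0, hy0, hP, hQ, hG, hY, hU, hW⟩ :=
      exp_octahedral_letters (hS hy)
    rw [octA, octB, show ((0 : ℝ) : ℂ)
        + (-4 * Real.arctan y : ℝ) * Complex.I
        = (octR y - Real.arctan y * Complex.I) + (octR y - Real.arctan y * Complex.I) - (octR y + Real.arctan y * Complex.I) - (octR y + Real.arctan y * Complex.I) by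
      push_cast; ring,
      show ((1 * Real.log y + (-2) * octR y + 2 * L : ℝ) : ℂ)
        + ((-2) * Real.arctan y + (1 / 2) * π : ℝ) * Complex.I
        = Real.log y + L + L + π / 2 * Complex.I - (octR y + Real.arctan y * Complex.I) - (octR y + Real.arctan y * Complex.I) by
      push_cast; ring]
    simp only [Complex.exp_add, Complex.exp_sub, Complex.exp_zero, exp_pi_div_two_mul_I, exp_log_two,
      hP, hQ, hG, hY, hU, hW]
    field_simp
    try simp only [hp, hq, hg]
    refine Complex.ext ?_ ?_ <;>
    · simp [pow_succ]
      try ring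

lemma hasDeriv_octTerm_t13b {y : ℝ} {S : Set ℝ} (hS : S ⊆ Ioo 0 1) (hy : y ∈ S)
    (h0 : ∀ x ∈ S, octA (-1) 2 (-2) x ≤ 0) :
    HasDerivWithinAt (octTerm (-1) 2 (-2) 2 (-(1 / 2)) (-(1 / 2)))
      (octDeriv (-1) 2 (-2) 2 (-(1 / 2))
        (-2 * L - Real.log y + 2 * octR y)
        (-2 * Real.arctan y + 1 / 2 * π) y) S y := by
  have hα := arctan_mem_Ioo (hS hy)
  refine hasDeriv_octTerm hS hy h0 ?_ (by linarith) (by linarith)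
  · obtain ⟨p, q, g, hp, hq, hg, hp0, hq0, hg0, hy0, hP, hQ, hG, hY, hU, hW⟩ :=
      exp_octahedral_letters (hS hy)
    rw [octA, octB, show ((-2 * L - Real.log y + 2 * octR y : ℝ) : ℂ)
        + (-2 * Real.arctan y + 1 / 2 * π : ℝ) * Complex.I
        = (octR y - Real.arctan y * Complex.I) + (octR y - Real.arctan y * Complex.I) + π / 2 * Complex.I - Real.log y - L - L by
      push_cast; ring,
      show (((-1) * Real.log y + 2 * octR y + (-2) * L : ℝ) : ℂ)
        + (2 * Real.arctan y + (-(1 / 2)) * π : ℝ) * Complex.I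
        = (octR y + Real.arctan y * Complex.I) + (octR y + Real.arctan y * Complex.I) - Real.log y - L - L - π / 2 * Complex.I by
      push_cast; ring]
    simp only [Complex.exp_add, Complex.exp_sub, Complex.exp_zero, exp_pi_div_two_mul_I, exp_log_two,
      hP, hQ, hG, hY, hU, hW]
    field_simp
    try simp only [hp, hq, hg]
    refine Complex.ext ?_ ?_ <;>
    · simp [pow_succ]
      try ring

lemma hasDeriv_octTerm_t14 {y : ℝ} (hy : y ∈ Ioo (0 : ℝ) 1) :
    HasDerivWithinAt (octTerm 2 (-4) 2 0 0 0)
      (octDeriv 2 (-4) 2 0 0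
        (2 * Real.log (1 - y) + 2 * Real.log (1 + y) - 4 * octR y)
        (0) y) (Ioo 0 1) y := by
  have hα := arctan_mem_Ioo hy
  refine hasDeriv_octTerm subset_rfl hy (fun x hx => ?_) ?_ (by linarith) (by linarith)
  · rw [octA]
    linarith [octR_nonneg x, two_mul_octR_le hx, log_add_le_two_mul_octR hx, log_nonpos_of_mem hx]
  · obtain ⟨p, q, g, hp, hq, hg, hp0, hq0, hg0, hy0, hP, hQ, hG, hY, hU, hW⟩ :=
      exp_octahedral_letters hy
    rw [octA, octB, show ((2 * Real.log (1 - y) + 2 * Real.log (1 + y) - 4 * octR y : ℝ) : ℂ)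
        + (0 : ℝ) * Complex.I
        = (Real.log (1 - y) : ℝ) + (Real.log (1 - y) : ℝ) + (Real.log (1 + y) : ℝ) + (Real.log (1 + y) : ℝ) - (octR y + Real.arctan y * Complex.I) - (octR y + Real.arctan y * Complex.I) - (octR y - Real.arctan y * Complex.I) - (octR y - Real.arctan y * Complex.I) by
      push_cast; ring,
      show ((2 * Real.log y + (-4) * octR y + 2 * L : ℝ) : ℂ)
        + (0 * Real.arctan y + 0 * π : ℝ) * Complex.I
        = Real.log y + Real.log y + L + L - (octR y + Real.arctan y * Complex.I) - (octR y + Real.arctan y * Complex.I) - (octR y - Real.arctan y * Complex.I) - (octR y - Real.arctan y * Complex.I) by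
      push_cast; ring]
    simp only [Complex.exp_add, Complex.exp_sub, Complex.exp_zero, exp_pi_div_two_mul_I, exp_log_two,
      hP, hQ, hG, hY, hU, hW]
    field_simp
    try simp only [hp, hq, hg]
    refine Complex.ext ?_ ?_ <;>
    · simp [pow_succ]
      try ring

lemma hasDeriv_octTerm_t15a {y : ℝ} (hy : y ∈ Ioo (0 : ℝ) 1) :
    HasDerivWithinAt (octTerm 0 1 (-(1 / 2)) (-1) (-(1 / 4)) (1 / 4))
      (octDeriv 0 1 (-(1 / 2)) (-1) (1 / 4)
        (-1 / 2 * L + Real.log (1 + y))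
        (1 / 4 * π) y) (Ioo 0 1) y := by
  have hα := arctan_mem_Ioo hy
  refine hasDeriv_octTerm subset_rfl hy (fun x hx => ?_) ?_ (by linarith) (by linarith)
  · rw [octA]
    linarith [octR_nonneg x, two_mul_octR_le hx, log_add_le_two_mul_octR hx, log_nonpos_of_mem hx]
  · obtain ⟨p, q, g, hp, hq, hg, hp0, hq0, hg0, hy0, hP, hQ, hG, hY, hU, hW⟩ :=
      exp_octahedral_letters hy
    rw [octA, octB, show ((-1 / 2 * L + Real.log (1 + y) : ℝ) : ℂ)
        + (1 / 4 * π : ℝ) * Complex.I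
        = (Real.log (1 + y) : ℝ) + (L / 2 + π / 4 * Complex.I) - L by
      push_cast; ring,
      show ((0 * Real.log y + 1 * octR y + (-(1 / 2)) * L : ℝ) : ℂ)
        + ((-1) * Real.arctan y + (-(1 / 4)) * π : ℝ) * Complex.I
        = (octR y - Real.arctan y * Complex.I) + (L / 2 + π / 4 * Complex.I) - L - π / 2 * Complex.I by
      push_cast; ring]
    simp only [Complex.exp_add, Complex.exp_sub, Complex.exp_zero, exp_pi_div_two_mul_I, exp_log_two,
      hP, hQ, hG, hY, hU, hW]
    field_simp
    try simp only [hp, hq, hg]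
    refine Complex.ext ?_ ?_ <;>
    · simp [pow_succ]
      try ring

lemma hasDeriv_octTerm_t15b {y : ℝ} (hy : y ∈ Ioo (0 : ℝ) 1) :
    HasDerivWithinAt (octTerm 0 1 (-(1 / 2)) (-1) (1 / 4) (1 / 4))
      (octDeriv 0 1 (-(1 / 2)) (-1) (1 / 4)
        (-1 / 2 * L + Real.log (1 - y))
        (-1 / 4 * π) y) (Ioo 0 1) y := by
  have hα := arctan_mem_Ioo hy
  refine hasDeriv_octTerm subset_rfl hy (fun x hx => ?_) ?_ (by linarith) (by linarith)
  · rw [octA]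
    linarith [octR_nonneg x, two_mul_octR_le hx, log_add_le_two_mul_octR hx, log_nonpos_of_mem hx]
  · obtain ⟨p, q, g, hp, hq, hg, hp0, hq0, hg0, hy0, hP, hQ, hG, hY, hU, hW⟩ :=
      exp_octahedral_letters hy
    rw [octA, octB, show ((-1 / 2 * L + Real.log (1 - y) : ℝ) : ℂ)
        + (-1 / 4 * π : ℝ) * Complex.I
        = (Real.log (1 - y) : ℝ) + (L / 2 + π / 4 * Complex.I) - L - π / 2 * Complex.I by
      push_cast; ring,
      show ((0 * Real.log y + 1 * octR y + (-(1 / 2)) * L : ℝ) : ℂ)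
        + ((-1) * Real.arctan y + (1 / 4) * π : ℝ) * Complex.I
        = (octR y - Real.arctan y * Complex.I) + (L / 2 + π / 4 * Complex.I) - L by
      push_cast; ring]
    simp only [Complex.exp_add, Complex.exp_sub, Complex.exp_zero, exp_pi_div_two_mul_I, exp_log_two,
      hP, hQ, hG, hY, hU, hW]
    field_simp
    try simp only [hp, hq, hg]
    refine Complex.ext ?_ ?_ <;>
    · simp [pow_succ]
      try ring

lemma hasDeriv_octTerm_t15c {y : ℝ} (hy : y ∈ Ioo (0 : ℝ) 1) :
    HasDerivWithinAt (octTerm 1 (-1) (1 / 2) (-1) (3 / 4) (1 / 4))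
      (octDeriv 1 (-1) (1 / 2) (-1) (1 / 4)
        (Real.log (1 + y) - octR y)
        (-Real.arctan y) y) (Ioo 0 1) y := by
  have hα := arctan_mem_Ioo hy
  refine hasDeriv_octTerm subset_rfl hy (fun x hx => ?_) ?_ (by linarith) (by linarith)
  · rw [octA]
    linarith [octR_nonneg x, two_mul_octR_le hx, log_add_le_two_mul_octR hx, log_nonpos_of_mem hx]
  · obtain ⟨p, q, g, hp, hq, hg, hp0, hq0, hg0, hy0, hP, hQ, hG, hY, hU, hW⟩ :=
      exp_octahedral_letters hy
    rw [octA, octB, show ((Real.log (1 + y) - octR y : ℝ) : ℂ)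
        + (-Real.arctan y : ℝ) * Complex.I
        = (Real.log (1 + y) : ℝ) - (octR y + Real.arctan y * Complex.I) by
      push_cast; ring,
      show ((1 * Real.log y + (-1) * octR y + (1 / 2) * L : ℝ) : ℂ)
        + ((-1) * Real.arctan y + (3 / 4) * π : ℝ) * Complex.I
        = Real.log y + (L / 2 + π / 4 * Complex.I) + π / 2 * Complex.I - (octR y + Real.arctan y * Complex.I) by
      push_cast; ring]
    simp only [Complex.exp_add, Complex.exp_sub, Complex.exp_zero, exp_pi_div_two_mul_I, exp_log_two,
      hP, hQ, hG, hY, hU, hW]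
    field_simp
    try simp only [hp, hq, hg]
    refine Complex.ext ?_ ?_ <;>
    · simp [pow_succ]
      try ring

lemma hasDeriv_octTerm_t15d {y : ℝ} (hy : y ∈ Ioo (0 : ℝ) 1) :
    HasDerivWithinAt (octTerm 1 (-1) (1 / 2) (-1) (1 / 4) (1 / 4))
      (octDeriv 1 (-1) (1 / 2) (-1) (1 / 4)
        (Real.log (1 - y) - octR y)
        (-Real.arctan y) y) (Ioo 0 1) y := by
  have hα := arctan_mem_Ioo hy
  refine hasDeriv_octTerm subset_rfl hy (fun x hx => ?_) ?_ (by linarith) (by linarith)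
  · rw [octA]
    linarith [octR_nonneg x, two_mul_octR_le hx, log_add_le_two_mul_octR hx, log_nonpos_of_mem hx]
  · obtain ⟨p, q, g, hp, hq, hg, hp0, hq0, hg0, hy0, hP, hQ, hG, hY, hU, hW⟩ :=
      exp_octahedral_letters hy
    rw [octA, octB, show ((Real.log (1 - y) - octR y : ℝ) : ℂ)
        + (-Real.arctan y : ℝ) * Complex.I
        = (Real.log (1 - y) : ℝ) - (octR y + Real.arctan y * Complex.I) by
      push_cast; ring,
      show ((1 * Real.log y + (-1) * octR y + (1 / 2) * L : ℝ) : ℂ)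
        + ((-1) * Real.arctan y + (1 / 4) * π : ℝ) * Complex.I
        = Real.log y + (L / 2 + π / 4 * Complex.I) - (octR y + Real.arctan y * Complex.I) by
      push_cast; ring]
    simp only [Complex.exp_add, Complex.exp_sub, Complex.exp_zero, exp_pi_div_two_mul_I, exp_log_two,
      hP, hQ, hG, hY, hU, hW]
    field_simp
    try simp only [hp, hq, hg]
    refine Complex.ext ?_ ?_ <;>
    · simp [pow_succ]
      try ring

/-- Sum of the combinations along the octahedral path that are regular on the whole path. -/
noncomputable def octSum (y : ℝ) : ℝ :=
  8 * octTerm 0 (-1) 0 1 0 (-(1 / 4)) y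
    + 8 * octTerm 1 (-1) 0 (-1) (1 / 2) (1 / 4) y
    + 8 * octTerm 0 1 (-1) (-1) 0 (1 / 4) y
    + (1 / 16) * octTerm 0 0 0 (-4) 0 1 y
    + (1 / 16) * octTerm 2 0 0 0 1 0 y
    + 2 * octTerm 1 0 0 (-2) (1 / 2) (1 / 2) y
    + 2 * octTerm 1 (-2) 1 2 (-(1 / 2)) (-(1 / 2)) y
    + 1 * octTerm 2 (-2) 1 0 0 0 y
    + 1 * octTerm 0 2 (-1) 0 0 0 y
    + (-(1 / 8)) * octTerm 0 0 0 (-4) 1 1 y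
    + (-(1 / 8)) * octTerm 2 0 0 0 0 0 y
    + (-(1 / 4)) * octTerm 0 (-2) 0 0 0 0 y
    + (-(1 / 4)) * octTerm 2 (-2) 0 0 0 0 y
    + (-(1 / 16)) * octTerm 2 (-4) 2 0 0 0 y
    + (-16) * octTerm 0 1 (-(1 / 2)) (-1) (-(1 / 4)) (1 / 4) y
    + (-16) * octTerm 0 1 (-(1 / 2)) (-1) (1 / 4) (1 / 4) y
    + (-16) * octTerm 1 (-1) (1 / 2) (-1) (3 / 4) (1 / 4) y
    + (-16) * octTerm 1 (-1) (1 / 2) (-1) (1 / 4) (1 / 4) y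

/-- Monomials in the letters of the octahedral path. -/
noncomputable def octMonom (i j k : ℕ) : ℝ → ℝ := monom Real.log octR Real.arctan i j k

/-- Elementary part of the octahedral relation. -/
noncomputable def octPoly (y : ℝ) : ℝ :=
    (-1 / 2 * L * π ^ 3 - 12 * L ^ 3 * π) * octMonom 0 0 1 y + (6 * L * π ^ 2 + 32 * L ^ 3) *
    octMonom 0 0 2 y + (-24 * L * π) * octMonom 0 0 3 y + (32 * L) * octMonom 0 0 4 y + (32 * L
    ^ 4 - 1 / 4 * π ^ 4) * octMonom 0 1 0 y + (11 / 2 * π ^ 3) * octMonom 0 1 1 y + (-42 * π ^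
    2) * octMonom 0 1 2 y + (136 * π) * octMonom 0 1 3 y + (-160) * octMonom 0 1 4 y + (-6 * L *
    π ^ 2 - 64 * L ^ 3) * octMonom 0 2 0 y + (72 * L * π) * octMonom 0 2 1 y + (-192 * L) *
    octMonom 0 2 2 y + (64 * L ^ 2 + 14 * π ^ 2) * octMonom 0 3 0 y + (-136 * π) * octMonom 0 3
    1 y + (320) * octMonom 0 3 2 y + (-32 * L) * octMonom 0 4 0 y + (32 / 5) * octMonom 0 5 0 y
    + (-3 / 2 * π ^ 3) * octMonom 1 0 1 y + (18 * π ^ 2) * octMonom 1 0 2 y + (-72 * π) *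
    octMonom 1 0 3 y + (96) * octMonom 1 0 4 y + (-6 * π ^ 2) * octMonom 1 2 0 y + (72 * π) *
    octMonom 1 2 1 y + (-192) * octMonom 1 2 2 y

noncomputable def octBase (y : ℝ) : ℝ := octSum y - octPoly y

lemma hasDeriv_octMonom {y : ℝ} (hy : y ∈ Ioo (0 : ℝ) 1) (i j k : ℕ) :
    HasDerivWithinAt (octMonom i j k) (i * Real.log y ^ (i - 1) * (1 / y) * octR y ^ j * Real.arctan y ^ k
      + Real.log y ^ i * (j * octR y ^ (j - 1) * (y / (1 + y ^ 2))) * Real.arctan y ^ k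
      + Real.log y ^ i * octR y ^ j * (k * Real.arctan y ^ (k - 1) * (1 / (1 + y ^ 2))))
      (Ioo 0 1) y :=
  hasDeriv_monom (hasDeriv_log hy _) (hasDeriv_octR y _) (hasDeriv_arctan _) i j k

set_option maxHeartbeats 4000000 in
lemma hasDeriv_octBase {y : ℝ} (hy : y ∈ Ioo (0 : ℝ) 1) :
    HasDerivWithinAt octBase
      (-8 * octDeriv 1 (-1) 1 (-1) (1 / 4) 0 (-2 * Real.arctan y) y
        + 1 / 2 * octDeriv 1 (-2) 2 (-2) (1 / 2) 0 (-4 * Real.arctan y) y)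
      (Ioo 0 1) y := by
  have hm := hasDeriv_octMonom hy
  refine HasDerivWithinAt.congr_deriv (HasDerivWithinAt.fun_sub
    (((((((((((((((((((hasDeriv_octTerm_t1 hy).const_mul 8).fun_add ((hasDeriv_octTerm_t2
    hy).const_mul 8)).fun_add ((hasDeriv_octTerm_t3 hy).const_mul 8)).fun_add
    ((hasDeriv_octTerm_t5 hy).const_mul (1 / 16))).fun_add ((hasDeriv_octTerm_t6 hy).const_mul
    (1 / 16))).fun_add ((hasDeriv_octTerm_t7 hy).const_mul 2)).fun_add ((hasDeriv_octTerm_t8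
    hy).const_mul 2)).fun_add ((hasDeriv_octTerm_t9a hy).const_mul 1)).fun_add
    ((hasDeriv_octTerm_t9b hy).const_mul 1)).fun_add ((hasDeriv_octTerm_t10 hy).const_mul (-(1 /
    8)))).fun_add ((hasDeriv_octTerm_t11 hy).const_mul (-(1 / 8)))).fun_add
    ((hasDeriv_octTerm_t12a hy).const_mul (-(1 / 4)))).fun_add ((hasDeriv_octTerm_t12b
    hy).const_mul (-(1 / 4)))).fun_add ((hasDeriv_octTerm_t14 hy).const_mul (-(1 /
    16)))).fun_add ((hasDeriv_octTerm_t15a hy).const_mul (-16))).fun_add ((hasDeriv_octTerm_t15b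
    hy).const_mul (-16))).fun_add ((hasDeriv_octTerm_t15c hy).const_mul (-16))).fun_add
    ((hasDeriv_octTerm_t15d hy).const_mul (-16)))
    (((((((((((((((((((((((((hm 0 0 1).const_mul (-1 / 2 * L * π ^ 3 - 12 * L ^ 3 * π)).fun_add
    ((hm 0 0 2).const_mul (6 * L * π ^ 2 + 32 * L ^ 3))).fun_add ((hm 0 0 3).const_mul (-24 * L
    * π))).fun_add ((hm 0 0 4).const_mul (32 * L))).fun_add ((hm 0 1 0).const_mul (32 * L ^ 4 -
    1 / 4 * π ^ 4))).fun_add ((hm 0 1 1).const_mul (11 / 2 * π ^ 3))).fun_add ((hm 0 1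
    2).const_mul (-42 * π ^ 2))).fun_add ((hm 0 1 3).const_mul (136 * π))).fun_add ((hm 0 1
    4).const_mul (-160))).fun_add ((hm 0 2 0).const_mul (-6 * L * π ^ 2 - 64 * L ^ 3))).fun_add
    ((hm 0 2 1).const_mul (72 * L * π))).fun_add ((hm 0 2 2).const_mul (-192 * L))).fun_add ((hm
    0 3 0).const_mul (64 * L ^ 2 + 14 * π ^ 2))).fun_add ((hm 0 3 1).const_mul (-136 *
    π))).fun_add ((hm 0 3 2).const_mul (320))).fun_add ((hm 0 4 0).const_mul (-32 * L))).fun_add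
    ((hm 0 5 0).const_mul (32 / 5))).fun_add ((hm 1 0 1).const_mul (-3 / 2 * π ^ 3))).fun_add
    ((hm 1 0 2).const_mul (18 * π ^ 2))).fun_add ((hm 1 0 3).const_mul (-72 * π))).fun_add ((hm
    1 0 4).const_mul (96))).fun_add ((hm 1 2 0).const_mul (-6 * π ^ 2))).fun_add ((hm 1 2
    1).const_mul (72 * π))).fun_add ((hm 1 2 2).const_mul (-192)))) ?_
  simp only [octDeriv, octA, octB]
  generalize 1 / y = u
  generalize y / (1 + y ^ 2) = v
  generalize 1 / (1 + y ^ 2) = w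
  generalize Real.log y = Y
  generalize octR y = r
  generalize Real.arctan y = α
  generalize Real.log (1 - y) = U
  generalize Real.log (1 + y) = W
  generalize Real.log 2 = l
  generalize Real.pi = p
  norm_num
  ring

/-- Correction term in the inversion of a letter of the octahedral path. -/
noncomputable def octCorrA (y : ℝ) : ℝ :=
  4 / 5 * (octA 1 (-1) 1 y ^ 5 - 10 * octA 1 (-1) 1 y ^ 3 * octB (-1) (1 / 4) y ^ 2
      + 5 * octA 1 (-1) 1 y * octB (-1) (1 / 4) y ^ 4)
    + 3 * π / 4 * (4 * octA 1 (-1) 1 y ^ 3 * octB (-1) (1 / 4) y - 4 * octA 1 (-1) 1 y * octB (-1) (1 / 4) y ^ 3)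

lemma hasDeriv_octTerm_t4b_add {y : ℝ} {S : Set ℝ} (hS : S ⊆ Ioo 0 1) (hy : y ∈ S)
    (h0 : ∀ x ∈ S, octA (-1) 1 (-1) x ≤ 0) :
    HasDerivWithinAt (fun y => octTerm (-1) 1 (-1) 1 (-(1 / 2)) (-(1 / 4)) y + octCorrA y)
      (octDeriv 1 (-1) 1 (-1) (1 / 4) 0 (-2 * Real.arctan y) y) S y := by
  have hm := hasDeriv_octA 1 (-1) 1 (hS hy) S
  have hb := hasDeriv_octB (-1) (1 / 4) y S
  refine ((hasDeriv_octTerm_t4b hS hy h0).fun_add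
    (((((hm.fun_pow 5).fun_sub (((hm.fun_pow 3).const_mul 10).fun_mul (hb.fun_pow 2))).fun_add
      ((hm.const_mul 5).fun_mul (hb.fun_pow 4))).const_mul (4 / 5)).fun_add
      (((((hm.fun_pow 3).const_mul 4).fun_mul hb).fun_sub
        ((hm.const_mul 4).fun_mul (hb.fun_pow 3))).const_mul (3 * π / 4)))).congr_deriv ?_
  simp only [octDeriv, octA, octB]
  norm_num
  ring

/-- Correction term in the inversion of a letter of the octahedral path. -/
noncomputable def octCorrB (y : ℝ) : ℝ :=
  4 / 5 * (octA 1 (-2) 2 y ^ 5 - 10 * octA 1 (-2) 2 y ^ 3 * octB (-2) (1 / 2) y ^ 2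
      + 5 * octA 1 (-2) 2 y * octB (-2) (1 / 2) y ^ 4)
    + π * (4 * octA 1 (-2) 2 y ^ 3 * octB (-2) (1 / 2) y - 4 * octA 1 (-2) 2 y * octB (-2) (1 / 2) y ^ 3)

lemma hasDeriv_octTerm_t13b_add {y : ℝ} {S : Set ℝ} (hS : S ⊆ Ioo 0 1) (hy : y ∈ S)
    (h0 : ∀ x ∈ S, octA (-1) 2 (-2) x ≤ 0) :
    HasDerivWithinAt (fun y => octTerm (-1) 2 (-2) 2 (-(1 / 2)) (-(1 / 2)) y + octCorrB y)
      (octDeriv 1 (-2) 2 (-2) (1 / 2) 0 (-4 * Real.arctan y) y) S y := by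
  have hm := hasDeriv_octA 1 (-2) 2 (hS hy) S
  have hb := hasDeriv_octB (-2) (1 / 2) y S
  refine ((hasDeriv_octTerm_t13b hS hy h0).fun_add
    (((((hm.fun_pow 5).fun_sub (((hm.fun_pow 3).const_mul 10).fun_mul (hb.fun_pow 2))).fun_add
      ((hm.const_mul 5).fun_mul (hb.fun_pow 4))).const_mul (4 / 5)).fun_add
      (((((hm.fun_pow 3).const_mul 4).fun_mul hb).fun_sub
        ((hm.const_mul 4).fun_mul (hb.fun_pow 3))).const_mul (π)))).congr_deriv ?_
  simp only [octDeriv, octA, octB]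
  norm_num
  ring

lemma re4_conj (a θ m b : ℝ) : re4 a (-θ) m (-b) = re4 a θ m b := by
  have h1 : Complex.exp (a + (-θ : ℝ) * Complex.I)
      = starRingEnd ℂ (Complex.exp (a + θ * Complex.I)) := by
    rw [← Complex.exp_conj]; simp
  rw [re4_of_exp h1, re4_of_exp rfl]
  simp only [cpolylog_conj, Complex.conj_re, Complex.conj_im]
  ring

lemma octA_neg (i j l y : ℝ) : octA (-i) (-j) (-l) y = -octA i j l y := by
  simp only [octA]; ring

lemma octB_neg (t q y : ℝ) : octB (-t) (-q) y = -octB t q y := by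
  simp only [octB]; ring

lemma octTerm_neg_of_eq_zero {i j l t p q y : ℝ} (h : octA i j l y = 0) :
    octTerm (-i) (-j) (-l) (-t) (-p) (-q) y = octTerm i j l t p q y := by
  simp only [octTerm, octA_neg, octB_neg, h, neg_zero, re4_conj]

lemma two_mul_octA_one_neg_one_one {y : ℝ} (hy : 0 < y) :
    2 * octA 1 (-1) 1 y = Real.log (4 * y ^ 2) - Real.log (1 + y ^ 2) := by
  rw [octA, octR, Real.log_mul (by norm_num) (by positivity), Real.log_pow,
    show (4 : ℝ) = 2 ^ 2 by norm_num, Real.log_pow]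
  push_cast
  ring

lemma octA_one_neg_two_two {y : ℝ} (hy : 0 < y) :
    octA 1 (-2) 2 y = Real.log (4 * y) - Real.log (1 + y ^ 2) := by
  rw [octA, octR, Real.log_mul (by norm_num) (by positivity),
    show (4 : ℝ) = 2 ^ 2 by norm_num, Real.log_pow]
  push_cast
  ring

lemma octA_one_neg_one_one_nonpos {y : ℝ} (hy : 0 < y) (h : 3 * y ^ 2 ≤ 1) :
    octA 1 (-1) 1 y ≤ 0 := by
  have := Real.log_le_log (by positivity) (show 4 * y ^ 2 ≤ 1 + y ^ 2 by linarith)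
  linarith [two_mul_octA_one_neg_one_one hy]

lemma octA_neg_one_one_neg_one_nonpos {y : ℝ} (hy : 0 < y) (h : 1 ≤ 3 * y ^ 2) :
    octA (-1) 1 (-1) y ≤ 0 := by
  have := Real.log_le_log (by positivity) (show 1 + y ^ 2 ≤ 4 * y ^ 2 by linarith)
  have h' := octA_neg 1 (-1) 1 y
  rw [neg_neg] at h'
  linarith [two_mul_octA_one_neg_one_one hy]

lemma octA_one_neg_two_two_nonpos {y : ℝ} (hy : 0 < y) (h : 4 * y ≤ 1 + y ^ 2) :
    octA 1 (-2) 2 y ≤ 0 := by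
  have := Real.log_le_log (by positivity) h
  linarith [octA_one_neg_two_two hy]

lemma octA_neg_one_two_neg_two_nonpos {y : ℝ} (hy : 0 < y) (h : 1 + y ^ 2 ≤ 4 * y) :
    octA (-1) 2 (-2) y ≤ 0 := by
  have := Real.log_le_log (by positivity) h
  have h' := octA_neg 1 (-2) 2 y
  rw [neg_neg] at h'
  linarith [octA_one_neg_two_two hy]

/-- The combination along the octahedral path near `0`. -/
noncomputable def octLeft (y : ℝ) : ℝ :=
  octBase y + 8 * octTerm 1 (-1) 1 (-1) (1 / 2) (1 / 4) y
    - 1 / 2 * octTerm 1 (-2) 2 (-2) (1 / 2) (1 / 2) y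

/-- The combination along the octahedral path on its middle part. -/
noncomputable def octMiddle (y : ℝ) : ℝ :=
  octBase y + 8 * octTerm 1 (-1) 1 (-1) (1 / 2) (1 / 4) y
    - 1 / 2 * (octTerm (-1) 2 (-2) 2 (-(1 / 2)) (-(1 / 2)) y + octCorrB y)

/-- The combination along the octahedral path near `1`. -/
noncomputable def octRight (y : ℝ) : ℝ :=
  octBase y + 8 * (octTerm (-1) 1 (-1) 1 (-(1 / 2)) (-(1 / 4)) y + octCorrA y)
    - 1 / 2 * (octTerm (-1) 2 (-2) 2 (-(1 / 2)) (-(1 / 2)) y + octCorrB y)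

lemma octLeft_eq_octMiddle {y : ℝ} (h : octA 1 (-2) 2 y = 0) : octLeft y = octMiddle y := by
  have := octTerm_neg_of_eq_zero (t := -2) (p := 1 / 2) (q := 1 / 2) h
  rw [neg_neg] at this
  rw [octLeft, octMiddle, this, octCorrB, h]
  ring

lemma octMiddle_eq_octRight {y : ℝ} (h : octA 1 (-1) 1 y = 0) : octMiddle y = octRight y := by
  have := octTerm_neg_of_eq_zero (t := -1) (p := 1 / 2) (q := 1 / 4) h
  rw [neg_neg] at this
  rw [octMiddle, octRight, this, octCorrA, h]
  ring

lemma limit_octLeft_eq_limit_octRight {c₀ c₁ : ℝ} (h₀ : Tendsto octLeft (𝓝[>] 0) (𝓝 c₀))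
    (h₁ : Tendsto octRight (𝓝[<] 1) (𝓝 c₁)) : c₀ = c₁ := by
  have hs : √3 ^ 2 = 3 := Real.sq_sqrt (by norm_num)
  have hs1 : 1.7 < √3 := Real.lt_sqrt_of_sq_lt (by norm_num)
  have hs2 : √3 < 1.8 := (Real.sqrt_lt' (by norm_num)).2 (by norm_num)
  have e1 : 4 * (2 - √3) = 1 + (2 - √3) ^ 2 := by linear_combination -hs
  have e2 : 3 * (√3 / 3) ^ 2 = 1 := by linear_combination hs / 3
  have z1 : octA 1 (-2) 2 (2 - √3) = 0 := by
    rw [octA_one_neg_two_two (by linarith), e1, sub_self]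
  have z2 : octA 1 (-1) 1 (√3 / 3) = 0 := by
    have := two_mul_octA_one_neg_one_one (y := √3 / 3) (by positivity)
    rw [show 4 * (√3 / 3) ^ 2 = 1 + (√3 / 3) ^ 2 by linear_combination e2, sub_self] at this
    linarith
  have S1 : Ioc 0 (2 - √3) ⊆ Ioo 0 1 := fun x hx => ⟨hx.1, by linarith [hx.2]⟩
  have S2 : Icc (2 - √3) (√3 / 3) ⊆ Ioo 0 1 :=
    fun x hx => ⟨by linarith [hx.1], by linarith [hx.2]⟩
  have S3 : Ico (√3 / 3) 1 ⊆ Ioo 0 1 := fun x hx => ⟨by linarith [hx.1], hx.2⟩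
  have A1 : ∀ x ∈ Ioo (0 : ℝ) 1, x ≤ √3 / 3 → octA 1 (-1) 1 x ≤ 0 := fun x hx h =>
    octA_one_neg_one_one_nonpos hx.1 (by nlinarith [hx.1])
  have A2 : ∀ x ∈ Ioo (0 : ℝ) 1, √3 / 3 ≤ x → octA (-1) 1 (-1) x ≤ 0 := fun x hx h =>
    octA_neg_one_one_neg_one_nonpos hx.1 (by nlinarith [hx.1])
  have B1 : ∀ x ∈ Ioo (0 : ℝ) 1, x ≤ 2 - √3 → octA 1 (-2) 2 x ≤ 0 := fun x hx h =>
    octA_one_neg_two_two_nonpos hx.1 (by nlinarith [hx.1])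
  have B2 : ∀ x ∈ Ioo (0 : ℝ) 1, 2 - √3 ≤ x → octA (-1) 2 (-2) x ≤ 0 := fun x hx h =>
    octA_neg_one_two_neg_two_nonpos hx.1 (by nlinarith [hx.1, hx.2])
  have D1 : ∀ x ∈ Ioc 0 (2 - √3), HasDerivWithinAt octLeft 0 (Ioc 0 (2 - √3)) x := by
    intro x hx
    refine ((((hasDeriv_octBase (S1 hx)).mono S1).fun_add ((hasDeriv_octTerm_t4a S1 hx
      fun y hy => A1 y (S1 hy) (by linarith [hy.2])).const_mul 8)).fun_sub
      ((hasDeriv_octTerm_t13a S1 hx fun y hy => B1 y (S1 hy) hy.2).const_mul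
        (1 / 2))).congr_deriv ?_
    ring
  have D2 : ∀ x ∈ Icc (2 - √3) (√3 / 3),
      HasDerivWithinAt octMiddle 0 (Icc (2 - √3) (√3 / 3)) x := by
    intro x hx
    refine ((((hasDeriv_octBase (S2 hx)).mono S2).fun_add ((hasDeriv_octTerm_t4a S2 hx
      fun y hy => A1 y (S2 hy) hy.2).const_mul 8)).fun_sub
      ((hasDeriv_octTerm_t13b_add S2 hx fun y hy => B2 y (S2 hy) hy.1).const_mul
        (1 / 2))).congr_deriv ?_
    ring
  have D3 : ∀ x ∈ Ico (√3 / 3) 1, HasDerivWithinAt octRight 0 (Ico (√3 / 3) 1) x := by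
    intro x hx
    refine ((((hasDeriv_octBase (S3 hx)).mono S3).fun_add ((hasDeriv_octTerm_t4b_add S3 hx
      fun y hy => A2 y (S3 hy) hy.1).const_mul 8)).fun_sub
      ((hasDeriv_octTerm_t13b_add S3 hx
        fun y hy => B2 y (S3 hy) (by linarith [hy.1])).const_mul (1 / 2))).congr_deriv ?_
    ring
  have h1 := eq_of_hasDerivWithinAt_zero_of_tendsto (convex_Ioc _ _) D1
    (t₀ := 2 - √3) ⟨by linarith, le_rfl⟩ (Ioc_mem_nhdsGT (by linarith)) h₀
  have h2 := eq_of_hasDerivWithinAt_zero_of_tendsto (convex_Icc _ _) D2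
    (t₀ := 2 - √3) ⟨le_rfl, by linarith⟩ (l := pure (√3 / 3))
    (eventually_pure.2 ⟨by linarith, le_rfl⟩) (tendsto_pure_nhds octMiddle (√3 / 3))
  have h3 := eq_of_hasDerivWithinAt_zero_of_tendsto (convex_Ico _ _) D3
    (t₀ := √3 / 3) ⟨le_rfl, by linarith⟩ (Ico_mem_nhdsLT (by linarith)) h₁
  rw [← h1, ← h3, octLeft_eq_octMiddle z1, h2, octMiddle_eq_octRight z2]

lemma tendsto_octR_one : Tendsto octR (𝓝[<] 1) (𝓝 (L / 2)) := by
  have h := ((hasDeriv_octR 1 univ).continuousWithinAt.continuousAt univ_mem).tendsto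
  rw [octR, show (1 + 1 ^ 2 : ℝ) = 2 by norm_num] at h
  exact h.mono_left nhdsWithin_le_nhds

lemma tendsto_octR_zero : Tendsto octR (𝓝[>] 0) (𝓝 0) := by
  have h := ((hasDeriv_octR 0 univ).continuousWithinAt.continuousAt univ_mem).tendsto
  rw [octR, show (1 + 0 ^ 2 : ℝ) = 1 by norm_num, Real.log_one, zero_div] at h
  exact h.mono_left nhdsWithin_le_nhds

lemma tendsto_arctan_one : Tendsto Real.arctan (𝓝[<] 1) (𝓝 (π / 4)) := by
  have h := Real.continuous_arctan.tendsto 1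
  rw [Real.arctan_one] at h
  exact h.mono_left nhdsWithin_le_nhds

lemma tendsto_arctan_zero : Tendsto Real.arctan (𝓝[>] 0) (𝓝 0) := by
  have h := Real.continuous_arctan.tendsto 0
  rw [Real.arctan_zero] at h
  exact h.mono_left nhdsWithin_le_nhds

lemma tendsto_log_one : Tendsto Real.log (𝓝[<] 1) (𝓝 0) := by
  have h := (Real.continuousAt_log one_ne_zero).tendsto
  rw [Real.log_one] at h
  exact h.mono_left nhdsWithin_le_nhds

lemma tendsto_octA_one {i j l a : ℝ} (ha : j * (L / 2) + l * L = a) :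
    Tendsto (octA i j l) (𝓝[<] 1) (𝓝 a) := by
  have := ((tendsto_log_one.const_mul i).add (tendsto_octR_one.const_mul j)).add_const (l * L)
  rwa [mul_zero, zero_add, ha] at this

lemma tendsto_octB_one {t q b : ℝ} (hb : t * (π / 4) + q * π = b) :
    Tendsto (octB t q) (𝓝[<] 1) (𝓝 b) := by
  have := (tendsto_arctan_one.const_mul t).add_const (q * π)
  rwa [hb] at this

lemma tendsto_octA_zero (j l : ℝ) : Tendsto (octA 0 j l) (𝓝[>] 0) (𝓝 (l * L)) := by
  have := (tendsto_octR_zero.const_mul j).add_const (l * L)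
  rw [mul_zero, zero_add] at this
  refine this.congr fun y => ?_
  rw [octA, zero_mul, zero_add]

lemma tendsto_octA_atBot {i : ℝ} (hi : 0 < i) (j l : ℝ) :
    Tendsto (octA i j l) (𝓝[>] 0) atBot :=
  tendsto_atBot_add_const_right _ _
    ((Real.tendsto_log_nhdsGT_zero.const_mul_atBot hi).atBot_add (tendsto_octR_zero.const_mul j))

lemma tendsto_octB_zero (t q : ℝ) : Tendsto (octB t q) (𝓝[>] 0) (𝓝 (q * π)) := by
  have := (tendsto_arctan_zero.const_mul t).add_const (q * π)
  rwa [mul_zero, zero_add] at this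

lemma tendsto_octTerm_one {i j l t p q a θ b : ℝ} (ha : j * (L / 2) + l * L = a)
    (hθ : t * (π / 4) + p * π = θ) (hb : t * (π / 4) + q * π = b)
    (h0 : ∀ᶠ y in 𝓝[<] 1, octA i j l y ≤ 0) :
    Tendsto (octTerm i j l t p q) (𝓝[<] 1) (𝓝 (re4 a θ a b)) :=
  tendsto_re4 (tendsto_octA_one ha) (tendsto_octB_one hθ) (tendsto_octA_one ha)
    (tendsto_octB_one hb) h0 (le_of_tendsto (tendsto_octA_one ha) h0)

lemma tendsto_octTerm_zero {j l t p q a θ b : ℝ} (ha : l * L = a) (hθ : p * π = θ)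
    (hb : q * π = b) (h0 : ∀ y ∈ Ioo (0 : ℝ) 1, octA 0 j l y ≤ 0) :
    Tendsto (octTerm 0 j l t p q) (𝓝[>] 0) (𝓝 (re4 a θ a b)) := by
  subst ha hθ hb
  have h := eventually_of_mem (Ioo_mem_nhdsGT one_pos) h0
  exact tendsto_re4 (tendsto_octA_zero _ _) (tendsto_octB_zero _ _) (tendsto_octA_zero _ _)
    (tendsto_octB_zero _ _) h (le_of_tendsto (tendsto_octA_zero _ _) h)

lemma tendsto_octTerm_zero_of_pos {i : ℝ} (hi : 0 < i) (j l t p q : ℝ) :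
    Tendsto (octTerm i j l t p q) (𝓝[>] 0) (𝓝 0) :=
  tendsto_re4_zero (c := 0) (tendsto_octA_atBot hi j l)
    (Eventually.of_forall fun _ => (add_zero _).symm) (tendsto_octB_zero t q)

lemma octA_nonpos {i j l y : ℝ} (hy : y ∈ Ioo (0 : ℝ) 1)
    (h : ∀ Y r : ℝ, Y ≤ 0 → 0 ≤ r → 2 * r ≤ L → L + Y ≤ 2 * r → i * Y + j * r + l * L ≤ 0) :
    octA i j l y ≤ 0 :=
  h _ _ (log_nonpos_of_mem hy) (octR_nonneg y) (two_mul_octR_le hy) (log_add_le_two_mul_octR hy)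

lemma tendsto_octMonom_one (i j k : ℕ) :
    Tendsto (octMonom i j k) (𝓝[<] 1) (𝓝 (0 ^ i * (L / 2) ^ j * (π / 4) ^ k)) :=
  ((tendsto_log_one.pow i).mul (tendsto_octR_one.pow j)).mul (tendsto_arctan_one.pow k)

lemma tendsto_log_mul_zero {f : ℝ → ℝ} (h0 : ∀ y ∈ Ioo (0 : ℝ) 1, 0 ≤ f y)
    (h : ∀ y ∈ Ioo (0 : ℝ) 1, f y ≤ y) :
    Tendsto (fun y => Real.log y * f y) (𝓝[>] 0) (𝓝 0) := by
  have hl := tendsto_log_mul_rpow_nhdsGT_zero one_pos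
  simp only [Real.rpow_one] at hl
  have hm := Ioo_mem_nhdsGT (one_pos (α := ℝ))
  refine tendsto_of_tendsto_of_tendsto_of_le_of_le' hl tendsto_const_nhds ?_ ?_
  · filter_upwards [hm] with y hy
    exact mul_le_mul_of_nonpos_left (h y hy) (log_nonpos_of_mem hy)
  · filter_upwards [hm] with y hy
    exact mul_nonpos_of_nonpos_of_nonneg (log_nonpos_of_mem hy) (h0 y hy)

lemma tendsto_log_mul_arctan : Tendsto (fun y => Real.log y * Real.arctan y) (𝓝[>] 0) (𝓝 0) := by
  refine tendsto_log_mul_zero (fun y hy => (arctan_mem_Ioo hy).1.le) fun y hy => ?_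
  have h := Real.le_tan (arctan_mem_Ioo hy).1.le (Real.arctan_lt_pi_div_two y)
  rwa [Real.tan_arctan] at h

lemma tendsto_log_mul_octR : Tendsto (fun y => Real.log y * octR y) (𝓝[>] 0) (𝓝 0) := by
  refine tendsto_log_mul_zero (fun y _ => octR_nonneg y) fun y hy => ?_
  have h := Real.log_le_sub_one_of_pos (show 0 < 1 + y ^ 2 by positivity)
  rw [octR]
  nlinarith [hy.1, hy.2]

lemma tendsto_octMonom_zero (j k : ℕ) (h : j ≠ 0 ∨ k ≠ 0) :
    Tendsto (octMonom 0 j k) (𝓝[>] 0) (𝓝 0) := by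
  have := ((tendsto_octR_zero.pow j).mul (tendsto_arctan_zero.pow k)).const_mul 1
  rw [show (1 : ℝ) * (0 ^ j * 0 ^ k) = 0 by rcases h with h | h <;> simp [h]] at this
  refine this.congr fun y => ?_
  simp [octMonom, monom]

lemma tendsto_octMonom_log (j k : ℕ) (h : j ≠ 0 ∨ k ≠ 0) :
    Tendsto (octMonom 1 j k) (𝓝[>] 0) (𝓝 0) := by
  rcases h with h | h
  · obtain ⟨j, rfl⟩ := Nat.exists_eq_succ_of_ne_zero h
    have := tendsto_log_mul_octR.mul ((tendsto_octR_zero.pow j).mul (tendsto_arctan_zero.pow k))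
    rw [zero_mul] at this
    refine this.congr fun y => ?_
    simp only [octMonom, monom, pow_succ]
    ring
  · obtain ⟨k, rfl⟩ := Nat.exists_eq_succ_of_ne_zero h
    have := tendsto_log_mul_arctan.mul ((tendsto_octR_zero.pow j).mul (tendsto_arctan_zero.pow k))
    rw [zero_mul] at this
    refine this.congr fun y => ?_
    simp only [octMonom, monom, pow_succ]
    ring

lemma tendsto_octPoly_zero : Tendsto octPoly (𝓝[>] 0) (𝓝 0) := by
  have h0 := fun c j k h => (tendsto_octMonom_zero j k h).const_mul c
  have h1 := fun c j k h => (tendsto_octMonom_log j k h).const_mul c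
  simp only [mul_zero] at h0 h1
  have h : Tendsto octPoly (𝓝[>] 0) _ :=
    ((((((((((((((((((((((((h0 (-1 / 2 * L * π ^ 3 - 12 * L ^ 3 * π) 0 1 (by norm_num)).add (h0
    (6 * L * π ^ 2 + 32 * L ^ 3) 0 2 (by norm_num))).add (h0 (-24 * L * π) 0 3 (by
    norm_num))).add (h0 (32 * L) 0 4 (by norm_num))).add (h0 (32 * L ^ 4 - 1 / 4 * π ^ 4) 1 0
    (by norm_num))).add (h0 (11 / 2 * π ^ 3) 1 1 (by norm_num))).add (h0 (-42 * π ^ 2) 1 2 (by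
    norm_num))).add (h0 (136 * π) 1 3 (by norm_num))).add (h0 (-160) 1 4 (by norm_num))).add (h0
    (-6 * L * π ^ 2 - 64 * L ^ 3) 2 0 (by norm_num))).add (h0 (72 * L * π) 2 1 (by
    norm_num))).add (h0 (-192 * L) 2 2 (by norm_num))).add (h0 (64 * L ^ 2 + 14 * π ^ 2) 3 0 (by
    norm_num))).add (h0 (-136 * π) 3 1 (by norm_num))).add (h0 (320) 3 2 (by norm_num))).add (h0
    (-32 * L) 4 0 (by norm_num))).add (h0 (32 / 5) 5 0 (by norm_num))).add (h1 (-3 / 2 * π ^ 3)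
    0 1 (by norm_num))).add (h1 (18 * π ^ 2) 0 2 (by norm_num))).add (h1 (-72 * π) 0 3 (by
    norm_num))).add (h1 (96) 0 4 (by norm_num))).add (h1 (-6 * π ^ 2) 2 0 (by norm_num))).add
    (h1 (72 * π) 2 1 (by norm_num))).add (h1 (-192) 2 2 (by norm_num)))
  simpa only [add_zero] using h

lemma tendsto_octPoly_one : Tendsto octPoly (𝓝[<] 1) (𝓝 (
    (-1 / 2 * L * π ^ 3 - 12 * L ^ 3 * π) * (0 ^ 0 * (L / 2) ^ 0 * (π / 4) ^ 1) + (6 * L * π ^ 2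
    + 32 * L ^ 3) * (0 ^ 0 * (L / 2) ^ 0 * (π / 4) ^ 2) + (-24 * L * π) * (0 ^ 0 * (L / 2) ^ 0 *
    (π / 4) ^ 3) + (32 * L) * (0 ^ 0 * (L / 2) ^ 0 * (π / 4) ^ 4) + (32 * L ^ 4 - 1 / 4 * π ^ 4)
    * (0 ^ 0 * (L / 2) ^ 1 * (π / 4) ^ 0) + (11 / 2 * π ^ 3) * (0 ^ 0 * (L / 2) ^ 1 * (π / 4) ^
    1) + (-42 * π ^ 2) * (0 ^ 0 * (L / 2) ^ 1 * (π / 4) ^ 2) + (136 * π) * (0 ^ 0 * (L / 2) ^ 1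
    * (π / 4) ^ 3) + (-160) * (0 ^ 0 * (L / 2) ^ 1 * (π / 4) ^ 4) + (-6 * L * π ^ 2 - 64 * L ^
    3) * (0 ^ 0 * (L / 2) ^ 2 * (π / 4) ^ 0) + (72 * L * π) * (0 ^ 0 * (L / 2) ^ 2 * (π / 4) ^
    1) + (-192 * L) * (0 ^ 0 * (L / 2) ^ 2 * (π / 4) ^ 2) + (64 * L ^ 2 + 14 * π ^ 2) * (0 ^ 0 *
    (L / 2) ^ 3 * (π / 4) ^ 0) + (-136 * π) * (0 ^ 0 * (L / 2) ^ 3 * (π / 4) ^ 1) + (320) * (0 ^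
    0 * (L / 2) ^ 3 * (π / 4) ^ 2) + (-32 * L) * (0 ^ 0 * (L / 2) ^ 4 * (π / 4) ^ 0) + (32 / 5)
    * (0 ^ 0 * (L / 2) ^ 5 * (π / 4) ^ 0))) := by
  have hm := tendsto_octMonom_one
  have h : Tendsto octPoly (𝓝[<] 1) _ :=
    (((((((((((((((((((((((((hm 0 0 1).const_mul (-1 / 2 * L * π ^ 3 - 12 * L ^ 3 * π)).add ((hm
    0 0 2).const_mul (6 * L * π ^ 2 + 32 * L ^ 3))).add ((hm 0 0 3).const_mul (-24 * L *
    π))).add ((hm 0 0 4).const_mul (32 * L))).add ((hm 0 1 0).const_mul (32 * L ^ 4 - 1 / 4 * π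
    ^ 4))).add ((hm 0 1 1).const_mul (11 / 2 * π ^ 3))).add ((hm 0 1 2).const_mul (-42 * π ^
    2))).add ((hm 0 1 3).const_mul (136 * π))).add ((hm 0 1 4).const_mul (-160))).add ((hm 0 2
    0).const_mul (-6 * L * π ^ 2 - 64 * L ^ 3))).add ((hm 0 2 1).const_mul (72 * L * π))).add
    ((hm 0 2 2).const_mul (-192 * L))).add ((hm 0 3 0).const_mul (64 * L ^ 2 + 14 * π ^ 2))).add
    ((hm 0 3 1).const_mul (-136 * π))).add ((hm 0 3 2).const_mul (320))).add ((hm 0 4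
    0).const_mul (-32 * L))).add ((hm 0 5 0).const_mul (32 / 5))).add ((hm 1 0 1).const_mul (-3
    / 2 * π ^ 3))).add ((hm 1 0 2).const_mul (18 * π ^ 2))).add ((hm 1 0 3).const_mul (-72 *
    π))).add ((hm 1 0 4).const_mul (96))).add ((hm 1 2 0).const_mul (-6 * π ^ 2))).add ((hm 1 2
    1).const_mul (72 * π))).add ((hm 1 2 2).const_mul (-192)))
  convert h using 2
  ring

lemma tendsto_octSum_zero : Tendsto octSum (𝓝[>] 0) (𝓝 (
    8 * re4 0 0 0 (-(π / 4)) + 8 * re4 (-L) 0 (-L) (π / 4) + (1 / 16) * re4 0 0 0 π + 1 * re4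
    (-L) 0 (-L) 0 + (-(1 / 8)) * re4 0 π 0 π + (-(1 / 4)) * re4 0 0 0 0 + (-16) * re4 (-(L / 2))
    (-(π / 4)) (-(L / 2)) (π / 4) + (-16) * re4 (-(L / 2)) (π / 4) (-(L / 2)) (π / 4))) := by
  have t1 : Tendsto (octTerm 0 (-1) 0 1 0 (-(1 / 4))) (𝓝[>] 0) (𝓝 (re4 0 0 0 (-(π / 4)))) :=
    tendsto_octTerm_zero (by ring) (by ring) (by ring)
      fun x hx => octA_nonpos hx fun _ _ _ _ _ _ => by linarith
  have t2 : Tendsto (octTerm 1 (-1) 0 (-1) (1 / 2) (1 / 4)) (𝓝[>] 0) (𝓝 (0)) :=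
    tendsto_octTerm_zero_of_pos (by norm_num) _ _ _ _ _
  have t3 : Tendsto (octTerm 0 1 (-1) (-1) 0 (1 / 4)) (𝓝[>] 0) (𝓝 (re4 (-L) 0 (-L) (π / 4))) :=
    tendsto_octTerm_zero (by ring) (by ring) (by ring)
      fun x hx => octA_nonpos hx fun _ _ _ _ _ _ => by linarith
  have t5 : Tendsto (octTerm 0 0 0 (-4) 0 1) (𝓝[>] 0) (𝓝 (re4 0 0 0 π)) :=
    tendsto_octTerm_zero (by ring) (by ring) (by ring)
      fun x hx => octA_nonpos hx fun _ _ _ _ _ _ => by linarith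
  have t6 : Tendsto (octTerm 2 0 0 0 1 0) (𝓝[>] 0) (𝓝 (0)) :=
    tendsto_octTerm_zero_of_pos (by norm_num) _ _ _ _ _
  have t7 : Tendsto (octTerm 1 0 0 (-2) (1 / 2) (1 / 2)) (𝓝[>] 0) (𝓝 (0)) :=
    tendsto_octTerm_zero_of_pos (by norm_num) _ _ _ _ _
  have t8 : Tendsto (octTerm 1 (-2) 1 2 (-(1 / 2)) (-(1 / 2))) (𝓝[>] 0) (𝓝 (0)) :=
    tendsto_octTerm_zero_of_pos (by norm_num) _ _ _ _ _
  have t9a : Tendsto (octTerm 2 (-2) 1 0 0 0) (𝓝[>] 0) (𝓝 (0)) :=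
    tendsto_octTerm_zero_of_pos (by norm_num) _ _ _ _ _
  have t9b : Tendsto (octTerm 0 2 (-1) 0 0 0) (𝓝[>] 0) (𝓝 (re4 (-L) 0 (-L) 0)) :=
    tendsto_octTerm_zero (by ring) (by ring) (by ring)
      fun x hx => octA_nonpos hx fun _ _ _ _ _ _ => by linarith
  have t10 : Tendsto (octTerm 0 0 0 (-4) 1 1) (𝓝[>] 0) (𝓝 (re4 0 π 0 π)) :=
    tendsto_octTerm_zero (by ring) (by ring) (by ring)
      fun x hx => octA_nonpos hx fun _ _ _ _ _ _ => by linarith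
  have t11 : Tendsto (octTerm 2 0 0 0 0 0) (𝓝[>] 0) (𝓝 (0)) :=
    tendsto_octTerm_zero_of_pos (by norm_num) _ _ _ _ _
  have t12a : Tendsto (octTerm 0 (-2) 0 0 0 0) (𝓝[>] 0) (𝓝 (re4 0 0 0 0)) :=
    tendsto_octTerm_zero (by ring) (by ring) (by ring)
      fun x hx => octA_nonpos hx fun _ _ _ _ _ _ => by linarith
  have t12b : Tendsto (octTerm 2 (-2) 0 0 0 0) (𝓝[>] 0) (𝓝 (0)) :=
    tendsto_octTerm_zero_of_pos (by norm_num) _ _ _ _ _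
  have t14 : Tendsto (octTerm 2 (-4) 2 0 0 0) (𝓝[>] 0) (𝓝 (0)) :=
    tendsto_octTerm_zero_of_pos (by norm_num) _ _ _ _ _
  have t15a : Tendsto (octTerm 0 1 (-(1 / 2)) (-1) (-(1 / 4)) (1 / 4)) (𝓝[>] 0) (𝓝 (re4 (-(L / 2)) (-(π / 4)) (-(L / 2)) (π / 4))) :=
    tendsto_octTerm_zero (by ring) (by ring) (by ring)
      fun x hx => octA_nonpos hx fun _ _ _ _ _ _ => by linarith
  have t15b : Tendsto (octTerm 0 1 (-(1 / 2)) (-1) (1 / 4) (1 / 4)) (𝓝[>] 0) (𝓝 (re4 (-(L / 2)) (π / 4) (-(L / 2)) (π / 4))) :=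
    tendsto_octTerm_zero (by ring) (by ring) (by ring)
      fun x hx => octA_nonpos hx fun _ _ _ _ _ _ => by linarith
  have t15c : Tendsto (octTerm 1 (-1) (1 / 2) (-1) (3 / 4) (1 / 4)) (𝓝[>] 0) (𝓝 (0)) :=
    tendsto_octTerm_zero_of_pos (by norm_num) _ _ _ _ _
  have t15d : Tendsto (octTerm 1 (-1) (1 / 2) (-1) (1 / 4) (1 / 4)) (𝓝[>] 0) (𝓝 (0)) :=
    tendsto_octTerm_zero_of_pos (by norm_num) _ _ _ _ _
  have h : Tendsto octSum (𝓝[>] 0) _ :=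
    ((((((((((((((((((t1.const_mul 8).add (t2.const_mul 8)).add (t3.const_mul 8)).add
    (t5.const_mul (1 / 16))).add (t6.const_mul (1 / 16))).add (t7.const_mul 2)).add
    (t8.const_mul 2)).add (t9a.const_mul 1)).add (t9b.const_mul 1)).add (t10.const_mul (-(1 /
    8)))).add (t11.const_mul (-(1 / 8)))).add (t12a.const_mul (-(1 / 4)))).add (t12b.const_mul
    (-(1 / 4)))).add (t14.const_mul (-(1 / 16)))).add (t15a.const_mul (-16))).add
    (t15b.const_mul (-16))).add (t15c.const_mul (-16))).add (t15d.const_mul (-16)))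
  convert h using 2
  ring

lemma tendsto_octSum_one : Tendsto octSum (𝓝[<] 1) (𝓝 (
    16 * re4 (-(L / 2)) (π / 4) (-(L / 2)) 0 + 8 * re4 (-(L / 2)) (-(π / 4)) (-(L / 2)) 0 + (1 /
    16) * re4 0 (-π) 0 0 + (1 / 16) * re4 0 π 0 0 + (-(421 / 16)) * re4 0 0 0 0 + (-(1 / 2)) *
    re4 (-L) 0 (-L) 0 + (-16) * re4 0 (-(π / 2)) 0 0 + (-16) * re4 0 (π / 2) 0 0)) := by
  have hm : ∀ᶠ y in 𝓝[<] (1 : ℝ), y ∈ Ioo 0 1 := Ioo_mem_nhdsLT one_pos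
  have t1 : Tendsto (octTerm 0 (-1) 0 1 0 (-(1 / 4))) (𝓝[<] 1) (𝓝 (re4 (-(L / 2)) (π / 4) (-(L / 2)) 0)) :=
    tendsto_octTerm_one (by ring) (by ring) (by ring)
      (hm.mono fun x hx => octA_nonpos hx fun _ _ _ _ _ _ => by linarith)
  have t2 : Tendsto (octTerm 1 (-1) 0 (-1) (1 / 2) (1 / 4)) (𝓝[<] 1) (𝓝 (re4 (-(L / 2)) (π / 4) (-(L / 2)) 0)) :=
    tendsto_octTerm_one (by ring) (by ring) (by ring)
      (hm.mono fun x hx => octA_nonpos hx fun _ _ _ _ _ _ => by linarith)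
  have t3 : Tendsto (octTerm 0 1 (-1) (-1) 0 (1 / 4)) (𝓝[<] 1) (𝓝 (re4 (-(L / 2)) (-(π / 4)) (-(L / 2)) 0)) :=
    tendsto_octTerm_one (by ring) (by ring) (by ring)
      (hm.mono fun x hx => octA_nonpos hx fun _ _ _ _ _ _ => by linarith)
  have t5 : Tendsto (octTerm 0 0 0 (-4) 0 1) (𝓝[<] 1) (𝓝 (re4 0 (-π) 0 0)) :=
    tendsto_octTerm_one (by ring) (by ring) (by ring)
      (hm.mono fun x hx => octA_nonpos hx fun _ _ _ _ _ _ => by linarith)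
  have t6 : Tendsto (octTerm 2 0 0 0 1 0) (𝓝[<] 1) (𝓝 (re4 0 π 0 0)) :=
    tendsto_octTerm_one (by ring) (by ring) (by ring)
      (hm.mono fun x hx => octA_nonpos hx fun _ _ _ _ _ _ => by linarith)
  have t7 : Tendsto (octTerm 1 0 0 (-2) (1 / 2) (1 / 2)) (𝓝[<] 1) (𝓝 (re4 0 0 0 0)) :=
    tendsto_octTerm_one (by ring) (by ring) (by ring)
      (hm.mono fun x hx => octA_nonpos hx fun _ _ _ _ _ _ => by linarith)
  have t8 : Tendsto (octTerm 1 (-2) 1 2 (-(1 / 2)) (-(1 / 2))) (𝓝[<] 1) (𝓝 (re4 0 0 0 0)) :=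
    tendsto_octTerm_one (by ring) (by ring) (by ring)
      (hm.mono fun x hx => octA_nonpos hx fun _ _ _ _ _ _ => by linarith)
  have t9a : Tendsto (octTerm 2 (-2) 1 0 0 0) (𝓝[<] 1) (𝓝 (re4 0 0 0 0)) :=
    tendsto_octTerm_one (by ring) (by ring) (by ring)
      (hm.mono fun x hx => octA_nonpos hx fun _ _ _ _ _ _ => by linarith)
  have t9b : Tendsto (octTerm 0 2 (-1) 0 0 0) (𝓝[<] 1) (𝓝 (re4 0 0 0 0)) :=
    tendsto_octTerm_one (by ring) (by ring) (by ring)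
      (hm.mono fun x hx => octA_nonpos hx fun _ _ _ _ _ _ => by linarith)
  have t10 : Tendsto (octTerm 0 0 0 (-4) 1 1) (𝓝[<] 1) (𝓝 (re4 0 0 0 0)) :=
    tendsto_octTerm_one (by ring) (by ring) (by ring)
      (hm.mono fun x hx => octA_nonpos hx fun _ _ _ _ _ _ => by linarith)
  have t11 : Tendsto (octTerm 2 0 0 0 0 0) (𝓝[<] 1) (𝓝 (re4 0 0 0 0)) :=
    tendsto_octTerm_one (by ring) (by ring) (by ring)
      (hm.mono fun x hx => octA_nonpos hx fun _ _ _ _ _ _ => by linarith)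
  have t12a : Tendsto (octTerm 0 (-2) 0 0 0 0) (𝓝[<] 1) (𝓝 (re4 (-L) 0 (-L) 0)) :=
    tendsto_octTerm_one (by ring) (by ring) (by ring)
      (hm.mono fun x hx => octA_nonpos hx fun _ _ _ _ _ _ => by linarith)
  have t12b : Tendsto (octTerm 2 (-2) 0 0 0 0) (𝓝[<] 1) (𝓝 (re4 (-L) 0 (-L) 0)) :=
    tendsto_octTerm_one (by ring) (by ring) (by ring)
      (hm.mono fun x hx => octA_nonpos hx fun _ _ _ _ _ _ => by linarith)
  have t14 : Tendsto (octTerm 2 (-4) 2 0 0 0) (𝓝[<] 1) (𝓝 (re4 0 0 0 0)) :=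
    tendsto_octTerm_one (by ring) (by ring) (by ring)
      (hm.mono fun x hx => octA_nonpos hx fun _ _ _ _ _ _ => by linarith)
  have t15a : Tendsto (octTerm 0 1 (-(1 / 2)) (-1) (-(1 / 4)) (1 / 4)) (𝓝[<] 1) (𝓝 (re4 0 (-(π / 2)) 0 0)) :=
    tendsto_octTerm_one (by ring) (by ring) (by ring)
      (hm.mono fun x hx => octA_nonpos hx fun _ _ _ _ _ _ => by linarith)
  have t15b : Tendsto (octTerm 0 1 (-(1 / 2)) (-1) (1 / 4) (1 / 4)) (𝓝[<] 1) (𝓝 (re4 0 0 0 0)) :=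
    tendsto_octTerm_one (by ring) (by ring) (by ring)
      (hm.mono fun x hx => octA_nonpos hx fun _ _ _ _ _ _ => by linarith)
  have t15c : Tendsto (octTerm 1 (-1) (1 / 2) (-1) (3 / 4) (1 / 4)) (𝓝[<] 1) (𝓝 (re4 0 (π / 2) 0 0)) :=
    tendsto_octTerm_one (by ring) (by ring) (by ring)
      (hm.mono fun x hx => octA_nonpos hx fun _ _ _ _ _ _ => by linarith)
  have t15d : Tendsto (octTerm 1 (-1) (1 / 2) (-1) (1 / 4) (1 / 4)) (𝓝[<] 1) (𝓝 (re4 0 0 0 0)) :=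
    tendsto_octTerm_one (by ring) (by ring) (by ring)
      (hm.mono fun x hx => octA_nonpos hx fun _ _ _ _ _ _ => by linarith)
  have h : Tendsto octSum (𝓝[<] 1) _ :=
    ((((((((((((((((((t1.const_mul 8).add (t2.const_mul 8)).add (t3.const_mul 8)).add
    (t5.const_mul (1 / 16))).add (t6.const_mul (1 / 16))).add (t7.const_mul 2)).add
    (t8.const_mul 2)).add (t9a.const_mul 1)).add (t9b.const_mul 1)).add (t10.const_mul (-(1 /
    8)))).add (t11.const_mul (-(1 / 8)))).add (t12a.const_mul (-(1 / 4)))).add (t12b.const_mul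
    (-(1 / 4)))).add (t14.const_mul (-(1 / 16)))).add (t15a.const_mul (-16))).add
    (t15b.const_mul (-16))).add (t15c.const_mul (-16))).add (t15d.const_mul (-16)))
  convert h using 2
  ring

lemma tendsto_octCorr {F : Filter ℝ} {a b : ℝ → ℝ} {c : ℝ} (k : ℝ) (ha : Tendsto a F (𝓝 c))
    (hb : Tendsto b F (𝓝 0)) :
    Tendsto (fun y => 4 / 5 * (a y ^ 5 - 10 * a y ^ 3 * b y ^ 2 + 5 * a y * b y ^ 4)
      + k * (4 * a y ^ 3 * b y - 4 * a y * b y ^ 3)) F (𝓝 (4 / 5 * c ^ 5)) := by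
  have h := (((((ha.pow 5).sub (((ha.pow 3).const_mul 10).mul (hb.pow 2))).add
      ((ha.const_mul 5).mul (hb.pow 4))).const_mul (4 / 5)).add
      (((((ha.pow 3).const_mul 4).mul hb).sub ((ha.const_mul 4).mul (hb.pow 3))).const_mul k))
  convert h using 2
  ring

/-- The relation between polylogarithms of weight five at the two ends of the octahedral path. -/
lemma octahedral_relation :
    8 * re4 0 0 0 (-(π / 4)) + 8 * re4 (-L) 0 (-L) (π / 4) + (1 / 16) * re4 0 0 0 π + 1 * re4
    (-L) 0 (-L) 0 + (-(1 / 8)) * re4 0 π 0 π + (-(1 / 4)) * re4 0 0 0 0 + (-16) * re4 (-(L / 2))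
    (-(π / 4)) (-(L / 2)) (π / 4) + (-16) * re4 (-(L / 2)) (π / 4) (-(L / 2)) (π / 4)
    =
    16 * re4 (-(L / 2)) (π / 4) (-(L / 2)) 0 + 8 * re4 (-(L / 2)) (-(π / 4)) (-(L / 2)) 0 + (1 /
    16) * re4 0 (-π) 0 0 + (1 / 16) * re4 0 π 0 0 + (-(421 / 16)) * re4 0 0 0 0 + (-(1 / 2)) *
    re4 (-L) 0 (-L) 0 + (-16) * re4 0 (-(π / 2)) 0 0 + (-16) * re4 0 (π / 2) 0 0
    - (
    (-1 / 2 * L * π ^ 3 - 12 * L ^ 3 * π) * (0 ^ 0 * (L / 2) ^ 0 * (π / 4) ^ 1) + (6 * L * π ^ 2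
    + 32 * L ^ 3) * (0 ^ 0 * (L / 2) ^ 0 * (π / 4) ^ 2) + (-24 * L * π) * (0 ^ 0 * (L / 2) ^ 0 *
    (π / 4) ^ 3) + (32 * L) * (0 ^ 0 * (L / 2) ^ 0 * (π / 4) ^ 4) + (32 * L ^ 4 - 1 / 4 * π ^ 4)
    * (0 ^ 0 * (L / 2) ^ 1 * (π / 4) ^ 0) + (11 / 2 * π ^ 3) * (0 ^ 0 * (L / 2) ^ 1 * (π / 4) ^
    1) + (-42 * π ^ 2) * (0 ^ 0 * (L / 2) ^ 1 * (π / 4) ^ 2) + (136 * π) * (0 ^ 0 * (L / 2) ^ 1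
    * (π / 4) ^ 3) + (-160) * (0 ^ 0 * (L / 2) ^ 1 * (π / 4) ^ 4) + (-6 * L * π ^ 2 - 64 * L ^
    3) * (0 ^ 0 * (L / 2) ^ 2 * (π / 4) ^ 0) + (72 * L * π) * (0 ^ 0 * (L / 2) ^ 2 * (π / 4) ^
    1) + (-192 * L) * (0 ^ 0 * (L / 2) ^ 2 * (π / 4) ^ 2) + (64 * L ^ 2 + 14 * π ^ 2) * (0 ^ 0 *
    (L / 2) ^ 3 * (π / 4) ^ 0) + (-136 * π) * (0 ^ 0 * (L / 2) ^ 3 * (π / 4) ^ 1) + (320) * (0 ^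
    0 * (L / 2) ^ 3 * (π / 4) ^ 2) + (-32 * L) * (0 ^ 0 * (L / 2) ^ 4 * (π / 4) ^ 0) + (32 / 5)
    * (0 ^ 0 * (L / 2) ^ 5 * (π / 4) ^ 0))
    + 8 * (re4 (-(L / 2)) (-(π / 4)) (-(L / 2)) 0 + 4 / 5 * (L / 2) ^ 5)
    - 1 / 2 * (re4 (-L) 0 (-L) 0 + 4 / 5 * L ^ 5) := by
  have hm : ∀ᶠ y in 𝓝[<] (1 : ℝ), y ∈ Ioo 0 1 := Ioo_mem_nhdsLT one_pos
  have a0 := tendsto_octTerm_zero_of_pos one_pos (-1) 1 (-1) (1 / 2) (1 / 4)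
  have b0 := tendsto_octTerm_zero_of_pos one_pos (-2) 2 (-2) (1 / 2) (1 / 2)
  have a1 : Tendsto (octTerm (-1) 1 (-1) 1 (-(1 / 2)) (-(1 / 4))) (𝓝[<] 1)
      (𝓝 (re4 (-(L / 2)) (-(π / 4)) (-(L / 2)) 0)) :=
    tendsto_octTerm_one (by ring) (by ring) (by ring) (by
      filter_upwards [Ioo_mem_nhdsLT (show (3 / 4 : ℝ) < 1 by norm_num)] with y hy
      exact octA_neg_one_one_neg_one_nonpos (by linarith [hy.1]) (by nlinarith [hy.1]))
  have b1 : Tendsto (octTerm (-1) 2 (-2) 2 (-(1 / 2)) (-(1 / 2))) (𝓝[<] 1)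
      (𝓝 (re4 (-L) 0 (-L) 0)) :=
    tendsto_octTerm_one (by ring) (by ring) (by ring) (by
      filter_upwards [Ioo_mem_nhdsLT (show (3 / 4 : ℝ) < 1 by norm_num)] with y hy
      exact octA_neg_one_two_neg_two_nonpos (by linarith [hy.1]) (by nlinarith [hy.1, hy.2]))
  have c1 : Tendsto octCorrA (𝓝[<] 1) (𝓝 (4 / 5 * (L / 2) ^ 5)) :=
    tendsto_octCorr _ (tendsto_octA_one (by ring)) (tendsto_octB_one (by ring))
  have d1 : Tendsto octCorrB (𝓝[<] 1) (𝓝 (4 / 5 * L ^ 5)) :=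
    tendsto_octCorr _ (tendsto_octA_one (by ring)) (tendsto_octB_one (by ring))
  have h := limit_octLeft_eq_limit_octRight
    (((tendsto_octSum_zero.sub tendsto_octPoly_zero).add (a0.const_mul 8)).sub
      (b0.const_mul (1 / 2)))
    (((tendsto_octSum_one.sub tendsto_octPoly_one).add ((a1.add c1).const_mul 8)).sub
      ((b1.add d1).const_mul (1 / 2)))
  rw [mul_zero, mul_zero, sub_zero, sub_zero, add_zero] at h
  exact h

end OctahedralRelation

section Evaluation

local notation "L" => Real.log 2

local notation "π" => Real.pi

lemma cpolylog_at_one (k : ℕ) : cpolylog k 1 = (rpolylog k 1 : ℂ) := by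
  rw [← cpolylog_ofReal, Complex.ofReal_one]

lemma cpolylog_at_neg_one (k : ℕ) : cpolylog k (-1) = (rpolylog k (-1) : ℂ) := by
  rw [← cpolylog_ofReal, Complex.ofReal_neg, Complex.ofReal_one]

lemma exp_zero_add_neg_pi : Complex.exp ((0 : ℝ) + ((-π : ℝ) : ℂ) * Complex.I) = -1 := by
  simp [Complex.exp_neg]

lemma rpolylog_two_neg_one : rpolylog 2 (-1) = -π ^ 2 / 12 := by
  rw [rpolylog_neg_one (by norm_num), rpolylog_two_one]; ring

lemma rpolylog_three_neg_one : rpolylog 3 (-1) = -3 / 4 * rpolylog 3 1 := by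
  rw [rpolylog_neg_one (by norm_num)]; ring

lemma rpolylog_four_neg_one : rpolylog 4 (-1) = -7 * π ^ 4 / 720 := by
  rw [rpolylog_neg_one (by norm_num), rpolylog_four_one]; ring

lemma rpolylog_five_neg_one : rpolylog 5 (-1) = -15 / 16 * rpolylog 5 1 := by
  rw [rpolylog_neg_one (by norm_num)]; ring

lemma cpolylog_two_I_re : (cpolylog 2 Complex.I).re = -π ^ 2 / 48 := by
  rw [cpolylog_I_re (by norm_num), rpolylog_two_one]; ring

lemma cpolylog_three_I_re : (cpolylog 3 Complex.I).re = -3 / 32 * rpolylog 3 1 := by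
  rw [cpolylog_I_re (by norm_num)]; ring

lemma cpolylog_four_I_re : (cpolylog 4 Complex.I).re = -7 * π ^ 4 / 11520 := by
  rw [cpolylog_I_re (by norm_num), rpolylog_four_one]; ring

lemma cpolylog_five_I_re : (cpolylog 5 Complex.I).re = -15 / 512 * rpolylog 5 1 := by
  rw [cpolylog_I_re (by norm_num)]; ring

lemma rpolylog_two_half : rpolylog 2 (1 / 2) = π ^ 2 / 12 - L ^ 2 / 2 := by
  have h := eq_of_hasDerivWithinAt_zero_of_tendsto convex_cubicDom
    (fun s hs => hasDeriv_cubicW2A hs) one_mem_cubicDom tendsto_cubicDom tendsto_cubicW2A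
  rw [cubicW2A_one] at h
  simp only [re1_of_exp exp_neg_log_two_add_zero, re1_of_exp exp_zero_add_neg_pi_div_two,
    cpolylog_ofReal, cpolylog_conj, Complex.conj_re, Complex.ofReal_re, cpolylog_two_I_re] at h
  linear_combination -h

lemma cpolylog_two_half_one_add_I_re :
    (cpolylog 2 ((1 + Complex.I) / 2)).re = 5 * π ^ 2 / 96 - L ^ 2 / 8 := by
  have h := eq_of_hasDerivWithinAt_zero_of_tendsto convex_cubicDom
    (fun s hs => hasDeriv_cubicW2B hs) one_mem_cubicDom tendsto_cubicDom tendsto_cubicW2B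
  rw [cubicW2B_one] at h
  simp only [re1_of_exp exp_neg_log_two_add_zero, re1_of_exp exp_zero_add_zero, cpolylog_at_one,
    re1_of_exp exp_neg_half_log_two_add_neg_pi_div_four,
    cpolylog_ofReal, cpolylog_conj, Complex.conj_re, Complex.ofReal_re, rpolylog_two_one,
    rpolylog_two_half] at h
  linear_combination -1 / 2 * h

lemma cubicW3_relations :
    rpolylog 3 (1 / 2) = 7 / 8 * rpolylog 3 1 - π ^ 2 / 12 * L + L ^ 3 / 6 ∧
    (cpolylog 3 ((1 + Complex.I) / 2)).re
      = 35 / 64 * rpolylog 3 1 - 5 * π ^ 2 / 192 * L + L ^ 3 / 48 := by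
  have h := eq_of_hasDerivWithinAt_zero_of_tendsto convex_cubicDom
    (fun s hs => hasDeriv_cubicW3A hs) one_mem_cubicDom tendsto_cubicDom tendsto_cubicW3A
  have g := eq_of_hasDerivWithinAt_zero_of_tendsto convex_cubicDom
    (fun s hs => hasDeriv_cubicW3B hs) one_mem_cubicDom tendsto_cubicDom tendsto_cubicW3B
  rw [cubicW3A_one] at h
  rw [cubicW3B_one] at g
  simp only [re2_of_exp exp_neg_log_two_add_zero, re2_of_exp exp_zero_add_zero, cpolylog_at_one,
    re2_of_exp exp_neg_half_log_two_add_neg_pi_div_four, re2_of_exp exp_zero_add_pi,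
    re2_of_exp exp_neg_half_log_two_add_pi_div_four, re2_of_exp exp_zero_add_neg_pi_div_two,
    cpolylog_ofReal, cpolylog_conj, Complex.conj_re, Complex.conj_im, Complex.ofReal_re,
    Complex.ofReal_im, rpolylog_two_one, rpolylog_two_half, cpolylog_two_I_re,
    cpolylog_three_I_re, cpolylog_at_neg_one, rpolylog_two_neg_one, rpolylog_three_neg_one] at h g
  constructor
  · linear_combination 1 / 3 * h + 1 / 6 * g
  · linear_combination 1 / 24 * g - 1 / 24 * h

lemma rpolylog_three_half :
    rpolylog 3 (1 / 2) = 7 / 8 * rpolylog 3 1 - π ^ 2 / 12 * L + L ^ 3 / 6 :=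
  cubicW3_relations.1

lemma cpolylog_three_half_one_add_I_re : (cpolylog 3 ((1 + Complex.I) / 2)).re
    = 35 / 64 * rpolylog 3 1 - 5 * π ^ 2 / 192 * L + L ^ 3 / 48 :=
  cubicW3_relations.2

lemma cpolylog_four_half_one_add_I_re : (cpolylog 4 ((1 + Complex.I) / 2)).re
    = 5 / 16 * rpolylog 4 (1 / 2) + L ^ 4 / 96 - 5 / 768 * π ^ 2 * L ^ 2
      + 343 / 92160 * π ^ 4 := by
  have h := eq_of_hasDerivWithinAt_zero_of_tendsto convex_cubicDom
    (fun s hs => hasDeriv_cubicW4 hs) one_mem_cubicDom tendsto_cubicDom tendsto_cubicW4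
  rw [cubicW4_one] at h
  simp only [re3_of_exp _ _ exp_neg_log_two_add_zero, re3_of_exp _ _ exp_zero_add_zero,
    cpolylog_at_one,
    re3_of_exp _ _ exp_neg_half_log_two_add_neg_pi_div_four, re3_of_exp _ _ exp_zero_add_pi,
    re3_of_exp _ _ exp_neg_half_log_two_add_pi_div_four,
    re3_of_exp _ _ exp_zero_add_neg_pi_div_two,
    cpolylog_ofReal, cpolylog_conj, Complex.conj_re, Complex.conj_im, Complex.ofReal_re,
    Complex.ofReal_im, rpolylog_two_one, rpolylog_two_half, cpolylog_two_I_re,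
    cpolylog_three_I_re, cpolylog_at_neg_one, rpolylog_two_neg_one, rpolylog_three_neg_one,
    rpolylog_four_one, rpolylog_four_neg_one, cpolylog_four_I_re] at h
  linear_combination 1 / 96 * h

lemma cpolylog_five_half_one_add_I_re :
    (cpolylog 5 ((1 + Complex.I) / 2)).re
      = 5 / 32 * rpolylog 5 (1 / 2) + 2139 / 4096 * rpolylog 5 1 - L ^ 5 / 960
        + 5 / 4608 * π ^ 2 * L ^ 3 - 343 / 184320 * π ^ 4 * L := by
  have h := octahedral_relation
  simp only [re4_of_exp exp_neg_log_two_add_zero, re4_of_exp exp_zero_add_zero,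
    cpolylog_at_one, re4_of_exp exp_zero_add_pi_div_two, re4_of_exp exp_zero_add_neg_pi,
    re4_of_exp exp_neg_half_log_two_add_neg_pi_div_four, re4_of_exp exp_zero_add_pi,
    re4_of_exp exp_neg_half_log_two_add_pi_div_four,
    re4_of_exp exp_zero_add_neg_pi_div_two,
    cpolylog_ofReal, cpolylog_conj, Complex.conj_re, Complex.conj_im, Complex.ofReal_re,
    Complex.ofReal_im, rpolylog_two_one, rpolylog_two_half, rpolylog_three_half,
    cpolylog_two_I_re, cpolylog_two_half_one_add_I_re, cpolylog_three_half_one_add_I_re,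
    cpolylog_three_I_re, cpolylog_at_neg_one, rpolylog_two_neg_one, rpolylog_three_neg_one,
    rpolylog_four_one, rpolylog_four_neg_one, cpolylog_four_I_re, rpolylog_five_neg_one,
    cpolylog_five_I_re, cpolylog_four_half_one_add_I_re] at h
  linear_combination -1 / 1536 * h

lemma binomSeries_five_half_eq : binomSeries 5 (1 / 2)
    = 4 * π * (cpolylog 4 ((1 + Complex.I) / 2)).im + 3 * π * diriBeta4
      - 51 / 2 * rpolylog 5 (1 / 2) - 15 * rpolylog 4 (1 / 2) * L + π ^ 2 * rpolylog 3 1 / 4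
      + 9 * rpolylog 5 1 / 2 - 3 * rpolylog 3 1 * L ^ 2 - 97 / 240 * L ^ 5
      + 41 / 144 * π ^ 2 * L ^ 3 - 61 / 960 * π ^ 4 * L := by
  have h := binomSeries_five_half
  rw [cubicW5_one] at h
  simp only [re4_of_exp exp_neg_log_two_add_zero, re4_of_exp exp_zero_add_zero,
    cpolylog_at_one, re4_of_exp exp_neg_half_log_two_add_neg_pi_div_four,
    re4_of_exp exp_zero_add_pi, re4_of_exp exp_neg_half_log_two_add_pi_div_four,
    re4_of_exp exp_zero_add_neg_pi_div_two,
    re3_of_exp _ _ exp_neg_log_two_add_zero, re3_of_exp _ _ exp_zero_add_zero,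
    re3_of_exp _ _ exp_neg_half_log_two_add_neg_pi_div_four, re3_of_exp _ _ exp_zero_add_pi,
    re3_of_exp _ _ exp_neg_half_log_two_add_pi_div_four,
    re3_of_exp _ _ exp_zero_add_neg_pi_div_two,
    cpolylog_ofReal, cpolylog_conj, Complex.conj_re, Complex.conj_im, Complex.ofReal_re,
    Complex.ofReal_im, rpolylog_two_one, rpolylog_two_half, rpolylog_three_half,
    cpolylog_two_I_re, cpolylog_two_half_one_add_I_re, cpolylog_three_half_one_add_I_re,
    cpolylog_three_I_re, cpolylog_at_neg_one, rpolylog_two_neg_one, rpolylog_three_neg_one,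
    rpolylog_four_one, rpolylog_four_neg_one, cpolylog_four_I_re, rpolylog_five_neg_one,
    cpolylog_five_I_re, cpolylog_four_half_one_add_I_re, cpolylog_five_half_one_add_I_re,
    cpolylog_four_I_im] at h
  linear_combination h

end Evaluation

/-- `∑_{n=1}^∞ 1/(n⁵·2ⁿ·C(3n,n)) = 4π·Im(Li₄((1+i)/2)) + 3π·β(4)
− (51/2)Li₅(1/2) − 15·Li₄(1/2)·log 2 + π²ζ(3)/4 + 9ζ(5)/2 − 3ζ(3)log²2 − (97/240)log⁵2
+ (41/144)π²log³2 − (61/960)π⁴·log 2`. -/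
theorem statement12 :
    ((∑' n : ℕ, 1 / (((n + 1 : ℕ) : ℝ) ^ 5 * 2 ^ (n + 1)
        * (Nat.choose (3 * (n + 1)) (n + 1) : ℝ)) : ℝ) : ℂ)
      = 4 * (Real.pi : ℂ) * ((cpolylog 4 ((1 + Complex.I) / 2)).im : ℂ)
        + 3 * (Real.pi : ℂ) * (diriBeta4 : ℂ)
        - 51 / 2 * (rpolylog 5 (1 / 2) : ℂ)
        - 15 * (rpolylog 4 (1 / 2) : ℂ) * (Real.log 2 : ℂ)
        + (Real.pi : ℂ) ^ 2 * riemannZeta 3 / 4 + 9 * riemannZeta 5 / 2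
        - 3 * riemannZeta 3 * (Real.log 2 : ℂ) ^ 2
        - 97 / 240 * (Real.log 2 : ℂ) ^ 5
        + 41 / 144 * (Real.pi : ℂ) ^ 2 * (Real.log 2 : ℂ) ^ 3
        - 61 / 960 * (Real.pi : ℂ) ^ 4 * (Real.log 2 : ℂ) := by
  have h : ∑' n : ℕ, 1 / (((n + 1 : ℕ) : ℝ) ^ 5 * 2 ^ (n + 1)
      * (Nat.choose (3 * (n + 1)) (n + 1) : ℝ)) = binomSeries 5 (1 / 2) := by
    refine tsum_congr fun n => ?_
    rw [one_div_pow, div_div]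
    ring_nf
  have h3 : riemannZeta 3 = (rpolylog 3 1 : ℂ) := by
    exact_mod_cast riemannZeta_eq_rpolylog (k := 3) (by norm_num)
  have h5 : riemannZeta 5 = (rpolylog 5 1 : ℂ) := by
    exact_mod_cast riemannZeta_eq_rpolylog (k := 5) (by norm_num)
  rw [h, binomSeries_five_half_eq, h3, h5]
  push_cast
  rfl
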